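/- arXiv:2403.04219 — 4 statements merged into one kernel-verified Lean document; each statement's English description precedes it below -/
import Mathlib

section
/- Let 0<α<1/2 and β>2α. Suppose γ_i : 𝕋×[0,T] → ℝ² (i = 1,2) are C^{1,β} flows of two C^{1,β} patch solutions (Ω_{i,t}) of α-SQG, with unit tangents T_i and arc-length metrics g_i. Then there exists a constant C > 0 such that for all t ∈ [0,T], |g_1(·,t)−g_2(·,t)|²_{L²} ≤ |g_1(·,0)−g_2(·,0)|²_{L²} + C ∫_0^t ( |T_1(·,τ)−T_2(·,τ)|²_{L²} + |g_1(·,τ)−g_2(·,τ)|²_{L²} ) dτ. -/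
open MeasureTheory Real Set Function Filter Bornology
open scoped RealInnerProductSpace Topology

noncomputable section

/-- The plane `ℝ²`. -/
abbrev R2 := EuclideanSpace ℝ (Fin 2)

/-- The counterclockwise rotation by 90°: `(a,b)^⊥ = (-b,a)`. -/
def perp (v : R2) : R2 := (WithLp.equiv 2 (Fin 2 → ℝ)).symm ![-(v 1), v 0]

/-- The α-SQG velocity generated by a bounded set `U`:
`v_U(x) = ∫_U (x-y)^⊥ / ‖x-y‖^{2+2α} dy`. -/
def sqgVelocity (α : ℝ) (U : Set R2) (x : R2) : R2 :=
  ∫ y in U, (‖x - y‖ ^ (2 + 2 * α))⁻¹ • perp (x - y)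

/-- Eulerian (weak) patch solution of the α-SQG equation on `[0,T]`: a time-dependent
bounded domain such that `χ_{Ω_t}` is a weak solution of the transport equation by the
α-SQG velocity of `Ω_t`, tested against smooth compactly supported functions on
`ℝ² × [0,T)`. -/
def IsPatchSol (α T : ℝ) (Ω : ℝ → Set R2) : Prop :=
  (∀ t ∈ Icc (0:ℝ) T, IsOpen (Ω t) ∧ IsBounded (Ω t) ∧ IsConnected (Ω t)) ∧
  ∀ φ : R2 × ℝ → ℝ, ContDiff ℝ (⊤ : ℕ∞) φ → HasCompactSupport φ →
    (∀ p : R2 × ℝ, T ≤ p.2 → φ p = 0) →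
    ∫ x in Ω 0, φ (x, 0) =
      - ∫ t in Ioc (0:ℝ) T, ∫ x in Ω t,
          (deriv (fun s => φ (x, s)) t +
            ⟪sqgVelocity α (Ω t) x, gradient (fun y => φ (y, t)) x⟫)

/-- `γ` is an `L`-periodic arc-length (unit-speed) parametrization of the set `S`:
`L`-periodic, injective on `[0,L)`, `C¹` with `‖γ'‖ ≡ 1`, and with image `S`. -/
def IsArcLengthParam (L : ℝ) (γ : ℝ → R2) (S : Set R2) : Prop :=
  0 < L ∧ Periodic γ L ∧ InjOn γ (Ico 0 L) ∧ ContDiff ℝ 1 γ ∧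
    (∀ s, ‖deriv γ s‖ = 1) ∧ range γ = S

/-- `C^{1,β}` patch solution: a patch solution whose boundaries admit arc-length
parametrizations with a `β`-Hölder bound on the derivative, uniform in time. -/
def IsC1BetaPatchSol (α T β : ℝ) (Ω : ℝ → Set R2) : Prop :=
  IsPatchSol α T Ω ∧ ∃ M : ℝ, ∀ t ∈ Icc (0:ℝ) T, ∃ L γ,
    IsArcLengthParam L γ (frontier (Ω t)) ∧
    ∀ s s' : ℝ, ‖deriv γ s - deriv γ s'‖ ≤ M * |s - s'| ^ β

/-- Spatial derivative `∂ₓγ` of a time-dependent parametrization. -/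
def pderiv (γ : ℝ → ℝ → R2) (x t : ℝ) : R2 := deriv (fun x' => γ x' t) x

/-- Arc-length metric `g = ‖∂ₓγ‖` of a time-dependent parametrization. -/
def metricOf (γ : ℝ → ℝ → R2) (x t : ℝ) : ℝ := ‖pderiv γ x t‖

/-- Unit tangent `T = ∂ₓγ / ‖∂ₓγ‖` of a time-dependent parametrization. -/
def tangentOf (γ : ℝ → ℝ → R2) (x t : ℝ) : R2 := (metricOf γ x t)⁻¹ • pderiv γ x t

/-- Squared `L²`-norm over one period `[0,2π]` of the torus `𝕋 = ℝ/2πℤ`. -/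
def L2sq {E : Type*} [NormedAddCommGroup E] (f : ℝ → E) : ℝ :=
  ∫ x in Ioc (0:ℝ) (2 * π), ‖f x‖ ^ 2

/-- `γ` is a (Lagrangian) flow of the patch solution `Ω` on `[0,T]`: for each `t` it is
a `2π`-periodic `C¹` parametrization of `∂Ω_t` with nonvanishing derivative, and the
trajectories solve `∂ₜγ(x,t) = v(γ(x,t),t)` with `v(·,t)` the α-SQG velocity of `Ω_t`. -/
def IsFlowOf (α T : ℝ) (Ω : ℝ → Set R2) (γ : ℝ → ℝ → R2) : Prop :=
  (∀ t ∈ Icc (0:ℝ) T,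
     Periodic (fun x => γ x t) (2 * π) ∧
     ContDiff ℝ 1 (fun x => γ x t) ∧
     InjOn (fun x => γ x t) (Ico 0 (2 * π)) ∧
     (∀ x, pderiv γ x t ≠ 0) ∧
     range (fun x => γ x t) = frontier (Ω t)) ∧
  (∀ x : ℝ, ∀ t ∈ Icc (0:ℝ) T,
     HasDerivWithinAt (fun s => γ x s) (sqgVelocity α (Ω t) (γ x t)) (Icc (0:ℝ) T) t)

/-- A `C^{1,β}` flow: a flow bounded in `C^{1,β}(𝕋)` uniformly in time. -/
def IsC1BetaFlow (α β T : ℝ) (Ω : ℝ → Set R2) (γ : ℝ → ℝ → R2) : Prop :=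
  IsFlowOf α T Ω γ ∧ ∃ M : ℝ, ∀ t ∈ Icc (0:ℝ) T, ∀ x y : ℝ,
    ‖γ x t‖ ≤ M ∧ ‖pderiv γ x t‖ ≤ M ∧
    ‖pderiv γ x t - pderiv γ y t‖ ≤ M * |x - y| ^ β

/-! ### Planar linear algebra -/

/-- The scalar cross product `a × b = a₀ b₁ - a₁ b₀`. -/
def cross (a b : R2) : ℝ := a 0 * b 1 - a 1 * b 0

@[simp] lemma perp_zero_coord (v : R2) : perp v 0 = -(v 1) := by simp [perp]

@[simp] lemma perp_one_coord (v : R2) : perp v 1 = v 0 := by simp [perp]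

lemma R2.ext_coord {a b : R2} (h0 : a 0 = b 0) (h1 : a 1 = b 1) : a = b := by
  ext i; fin_cases i <;> simpa

lemma R2.inner_coord (a b : R2) : ⟪a, b⟫ = a 0 * b 0 + a 1 * b 1 := by
  simp [PiLp.inner_apply, Fin.sum_univ_two, mul_comm]

lemma R2.norm_sq_coord (a : R2) : ‖a‖ ^ 2 = a 0 ^ 2 + a 1 ^ 2 := by
  simp [EuclideanSpace.norm_sq_eq, Fin.sum_univ_two]

lemma norm_perp (v : R2) : ‖perp v‖ = ‖v‖ := by
  rw [← sq_eq_sq₀ (norm_nonneg _) (norm_nonneg _), R2.norm_sq_coord, R2.norm_sq_coord]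
  simp; ring

lemma perp_sub (a b : R2) : perp (a - b) = perp a - perp b := by
  apply R2.ext_coord <;> simp; ring

lemma perp_smul (c : ℝ) (a : R2) : perp (c • a) = c • perp a := by
  apply R2.ext_coord <;> simp

lemma perp_neg (a : R2) : perp (-a) = -perp a := by
  apply R2.ext_coord <;> simp

@[fun_prop] lemma continuous_perp : Continuous perp := by
  unfold perp
  refine (PiLp.continuous_toLp 2 _).comp ?_
  refine continuous_pi fun i => ?_
  fin_cases i <;> simp <;> fun_prop

lemma cross_eq_inner (a b : R2) : cross a b = ⟪perp a, b⟫ := by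
  simp [cross, R2.inner_coord]; ring

lemma cross_perp (a b : R2) : cross a (perp b) = ⟪a, b⟫ := by
  simp [cross, R2.inner_coord]

lemma abs_cross_le (a b : R2) : |cross a b| ≤ ‖a‖ * ‖b‖ := by
  rw [cross_eq_inner, ← norm_perp a]; exact abs_real_inner_le_norm _ _

lemma cross_same (a : R2) : cross a a = 0 := by simp [cross]; ring

lemma cross_add_left (a b c : R2) : cross (a + b) c = cross a c + cross b c := by
  simp [cross]; ring

lemma cross_sub_left (a b c : R2) : cross (a - b) c = cross a c - cross b c := by
  simp [cross]; ring

lemma cross_sub_right (a b c : R2) : cross a (b - c) = cross a b - cross a c := by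
  simp [cross]; ring

lemma cross_smul_left (r : ℝ) (a b : R2) : cross (r • a) b = r * cross a b := by
  simp [cross]; ring

lemma cross_swap (a b : R2) : cross a b = - cross b a := by
  simp [cross]; ring

@[fun_prop] lemma Continuous.cross {X : Type*} [TopologicalSpace X] {f g : X → R2}
    (hf : Continuous f) (hg : Continuous g) : Continuous fun x => cross (f x) (g x) := by
  unfold _root_.cross; fun_prop

lemma HasDerivAt.coord {f : ℝ → R2} {f' : R2} {x : ℝ} (h : HasDerivAt f f' x) (i : Fin 2) :
    HasDerivAt (fun y => f y i) (f' i) x :=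
  (EuclideanSpace.proj i : R2 →L[ℝ] ℝ).hasFDerivAt.comp_hasDerivAt x h

/-- The decomposition `(a × ν) μ = (μ × ν) a + (a × μ) ν`. -/
lemma cross_smul_eq (a ν μ : R2) : cross a ν • μ = cross μ ν • a + cross a μ • ν := by
  apply R2.ext_coord <;> simp [cross] <;> ring

/-- The triple product identity `⟨d, a⟩ b - ⟨d, b⟩ a = (a × b) d^⊥`. -/
lemma inner_smul_sub_inner_smul (d a b : R2) :
    ⟪d, a⟫ • b - ⟪d, b⟫ • a = cross a b • perp d := by
  apply R2.ext_coord <;> simp [cross, R2.inner_coord] <;> ring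

/-- The identification of the plane with `ℝ × ℝ`. -/
def planeEquiv : R2 ≃ᵐ ℝ × ℝ :=
  (MeasurableEquiv.toLp 2 (Fin 2 → ℝ)).symm.trans MeasurableEquiv.finTwoArrow

lemma planeEquiv_apply (z : R2) : planeEquiv z = (z 0, z 1) := rfl

lemma measurePreserving_planeEquiv : MeasurePreserving planeEquiv volume volume :=
  (volume_preserving_finTwoArrow ℝ).comp
    (EuclideanSpace.volume_preserving_symm_measurableEquiv_toLp (Fin 2))

lemma setIntegral_box (F : ℝ × ℝ → ℝ) (hF : Continuous F) {a b c d : ℝ} (hab : a ≤ b)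
    (hcd : c ≤ d) :
    ∫ z in {z : R2 | z 0 ∈ Ioo a b ∧ z 1 ∈ Ioo c d}, F (z 0, z 1) =
      ∫ x in a..b, ∫ s in c..d, F (x, s) := by
  have h := measurePreserving_planeEquiv.setIntegral_preimage_emb
    planeEquiv.measurableEmbedding F (Ioo a b ×ˢ Ioo c d)
  have hs : planeEquiv ⁻¹' (Ioo a b ×ˢ Ioo c d) = {z : R2 | z 0 ∈ Ioo a b ∧ z 1 ∈ Ioo c d} := by
    ext z; simp [planeEquiv_apply]
  rw [hs] at h
  rw [show (∫ z in {z : R2 | z 0 ∈ Ioo a b ∧ z 1 ∈ Ioo c d}, F (z 0, z 1)) = _ from h, Measure.volume_eq_prod, setIntegral_prod]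
  · rw [intervalIntegral.integral_of_le hab, integral_Ioc_eq_integral_Ioo]
    refine setIntegral_congr_fun measurableSet_Ioo fun x _ => ?_
    rw [intervalIntegral.integral_of_le hcd, integral_Ioc_eq_integral_Ioo]
  · exact (hF.continuousOn.integrableOn_compact (isCompact_Icc.prod isCompact_Icc)).mono_set
      (prod_mono Ioo_subset_Icc_self Ioo_subset_Icc_self)

/-- The linear map `(a, b) ↦ a p + b ν` of the plane. -/
def frameMap (p ν : R2) : R2 →L[ℝ] R2 :=
  (EuclideanSpace.proj (0 : Fin 2) : R2 →L[ℝ] ℝ).smulRight p +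
    (EuclideanSpace.proj (1 : Fin 2) : R2 →L[ℝ] ℝ).smulRight ν

lemma frameMap_apply (p ν z : R2) : frameMap p ν z = z 0 • p + z 1 • ν := rfl

lemma det_frameMap (p ν : R2) : (frameMap p ν).det = cross p ν := by
  have h := LinearMap.det_toMatrix (EuclideanSpace.basisFun (Fin 2) ℝ).toBasis
    (frameMap p ν : R2 →ₗ[ℝ] R2)
  rw [ContinuousLinearMap.det, ← h, Matrix.det_fin_two]
  simp [LinearMap.toMatrix_apply, frameMap, cross]
  ring

lemma range_frameMap {p ν : R2} (h : cross p ν ≠ 0) : (frameMap p ν).range = ⊤ := by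
  rw [eq_top_iff]
  intro y _
  refine ⟨!₂[(cross p ν)⁻¹ * cross y ν, (cross p ν)⁻¹ * cross p y], ?_⟩
  have := cross_smul_eq p ν y
  change frameMap p ν _ = y
  rw [frameMap_apply]
  simp only [Matrix.cons_val_zero, Matrix.cons_val_one]
  rw [mul_smul, mul_smul, ← smul_add, ← this, smul_smul, inv_mul_cancel₀ h, one_smul]

lemma IsPreconnected.subset_or_disjoint_of_disjoint_frontier {X : Type*} [TopologicalSpace X]
    {u s : Set X} (hu : IsPreconnected u) (hd : Disjoint u (frontier s)) :
    u ⊆ s ∨ Disjoint u s := by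
  by_contra! h
  obtain ⟨h1, h2⟩ := h
  obtain ⟨x, hx, hxs⟩ := not_subset.1 h1
  obtain ⟨z, hz, hzs⟩ := not_disjoint_iff.1 h2
  have key : ∀ w ∈ u, w ∈ closure s → w ∈ interior s := fun w hw hc => by
    by_contra hi
    exact disjoint_left.1 hd hw ⟨hc, hi⟩
  obtain ⟨w, -, hw1, hw2⟩ := hu (interior s) (closure s)ᶜ isOpen_interior
    isClosed_closure.isOpen_compl
    (fun w hw => (em (w ∈ closure s)).imp (key w hw) id)
    ⟨z, hz, key z hz (subset_closure hzs)⟩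
    ⟨x, hx, fun hc => hxs (interior_subset (key x hx hc))⟩
  exact hw2 (subset_closure (interior_subset hw1))

/-! ### Green's theorem -/

lemma integral_swap_of_continuous {E : Type*} [NormedAddCommGroup E] [NormedSpace ℝ E]
    {f : ℝ → ℝ → E} (hf : Continuous (uncurry f)) (a b c d : ℝ) :
    ∫ x in a..b, ∫ y in c..d, f x y = ∫ y in c..d, ∫ x in a..b, f x y := by
  refine intervalIntegral_intervalIntegral_swap ?_
  exact (hf.continuousOn.integrableOn_compact (isCompact_uIcc.prod isCompact_uIcc)).mono_set
    (prod_mono uIoc_subset_uIcc uIoc_subset_uIcc)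

/-- A regular `C¹` simple closed curve of period `2π`, with derivative `P`. -/
structure IsRegularLoop (γ P : ℝ → R2) : Prop where
  periodic : Periodic γ (2 * π)
  hasDerivAt : ∀ x, HasDerivAt γ (P x) x
  continuous_deriv : Continuous P
  injOn : InjOn γ (Ico 0 (2 * π))
  deriv_ne_zero : ∀ x, P x ≠ 0

namespace IsRegularLoop

variable {γ P : ℝ → R2}

lemma continuous (h : IsRegularLoop γ P) : Continuous γ :=
  continuous_iff_continuousAt.2 fun x => (h.hasDerivAt x).continuousAt

lemma periodic_deriv (h : IsRegularLoop γ P) : Periodic P (2 * π) := fun x => by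
  have h1 := (h.hasDerivAt (x + 2 * π)).comp_add_const x (2 * π)
  have h2 : (fun y => γ (y + 2 * π)) = γ := funext h.periodic
  rw [h2] at h1
  exact h1.unique (h.hasDerivAt x)

lemma eq_of_abs_sub_lt (h : IsRegularLoop γ P) {x y : ℝ} (hxy : |x - y| < 2 * π)
    (he : γ x = γ y) : x = y := by
  have h1 : toIcoMod two_pi_pos 0 y = toIcoMod two_pi_pos 0 x := by
    refine h.injOn ?_ ?_ ?_
    · simpa using toIcoMod_mem_Ico two_pi_pos 0 y
    · simpa using toIcoMod_mem_Ico two_pi_pos 0 x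
    · have e : ∀ z, γ (toIcoMod two_pi_pos 0 z) = γ z := fun z => by
        rw [toIcoMod, h.periodic.sub_zsmul_eq]
      rw [e, e, he]
  obtain ⟨n, hn⟩ := (toIcoMod_eq_toIcoMod two_pi_pos).1 h1
  rw [hn, zsmul_eq_mul, abs_mul, abs_of_pos two_pi_pos] at hxy
  have hn1 : |(n : ℝ)| < 1 := by
    by_contra! hc
    nlinarith [two_pi_pos]
  have hn0 : n = 0 := by
    rw [← Int.abs_lt_one_iff]; exact_mod_cast hn1
  rw [hn0] at hn; simp at hn; linarith

lemma integral_fderiv_box (h : IsRegularLoop γ P) (ν μ : R2) {φ : R2 → ℝ} (hφ : ContDiff ℝ 1 φ)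
    {a b c d : ℝ}
    (h0 : ∀ s ∈ uIcc c d, φ (γ a + s • ν) = 0 ∧ φ (γ b + s • ν) = 0) :
    ∫ x in a..b, ∫ s in c..d, cross (P x) ν * fderiv ℝ φ (γ x + s • ν) μ =
      ∫ x in a..b, cross (P x) μ * (φ (γ x + d • ν) - φ (γ x + c • ν)) := by
  have hγ := h.continuous
  have hP := h.continuous_deriv
  have hD : Continuous (fderiv ℝ φ) := hφ.continuous_fderiv one_ne_zero
  have hd : ∀ y, HasFDerivAt φ (fderiv ℝ φ y) y := fun y =>
    (hφ.differentiable one_ne_zero y).hasFDerivAt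
  have e : ∀ x s : ℝ, cross (P x) ν * fderiv ℝ φ (γ x + s • ν) μ =
      cross μ ν * fderiv ℝ φ (γ x + s • ν) (P x) +
        cross (P x) μ * fderiv ℝ φ (γ x + s • ν) ν := fun x s => by
    have := congrArg (fderiv ℝ φ (γ x + s • ν)) (cross_smul_eq (P x) ν μ)
    simpa using this
  have hc1 : Continuous (uncurry fun x s : ℝ => cross μ ν * fderiv ℝ φ (γ x + s • ν) (P x)) := by
    unfold uncurry; fun_prop
  have hc2 : Continuous (uncurry fun x s : ℝ => cross (P x) μ * fderiv ℝ φ (γ x + s • ν) ν) := by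
    unfold uncurry; fun_prop
  simp_rw [e]
  have s1 : ∀ x, ∫ s in c..d, (cross μ ν * fderiv ℝ φ (γ x + s • ν) (P x) +
        cross (P x) μ * fderiv ℝ φ (γ x + s • ν) ν) =
      (∫ s in c..d, cross μ ν * fderiv ℝ φ (γ x + s • ν) (P x)) +
        cross (P x) μ * (φ (γ x + d • ν) - φ (γ x + c • ν)) := fun x => by
    rw [intervalIntegral.integral_add]
    · congr 1
      rw [intervalIntegral.integral_const_mul]
      congr 1
      refine intervalIntegral.integral_eq_sub_of_hasDerivAt
        (f := fun s => φ (γ x + s • ν)) (fun s _ => ?_) ?_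
      · have := (hd (γ x + s • ν)).comp_hasDerivAt s
          (((hasDerivAt_id s).smul_const ν).const_add (γ x))
        simpa [Function.comp_def] using this
      · exact Continuous.intervalIntegrable (by fun_prop) _ _
    · exact (hc1.comp (by fun_prop : Continuous fun s : ℝ => (x, s))).intervalIntegrable _ _
    · exact (hc2.comp (by fun_prop : Continuous fun s : ℝ => (x, s))).intervalIntegrable _ _
  simp_rw [s1]
  rw [intervalIntegral.integral_add]
  · rw [integral_swap_of_continuous hc1]
    have : ∫ s in c..d, ∫ x in a..b, cross μ ν * fderiv ℝ φ (γ x + s • ν) (P x) =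
        ∫ s in c..d, (0 : ℝ) := by
      refine intervalIntegral.integral_congr fun s hs => ?_
      rw [intervalIntegral.integral_const_mul]
      rw [intervalIntegral.integral_eq_sub_of_hasDerivAt (f := fun x => φ (γ x + s • ν))
        (fun x _ => ?_) (Continuous.intervalIntegrable (by fun_prop) _ _)]
      · simp [h0 s hs]
      · have := (hd (γ x + s • ν)).comp_hasDerivAt x ((h.hasDerivAt x).add_const (s • ν))
        simpa [Function.comp_def] using this
    rw [this]; simp
  · exact (intervalIntegral.continuous_parametric_intervalIntegral_of_continuous'
      hc1 _ _).intervalIntegrable _ _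
  · have := hφ.continuous
    exact Continuous.intervalIntegrable (by fun_prop) _ _

end IsRegularLoop

namespace IsRegularLoop

variable {γ P : ℝ → R2}

/-- Transversal coordinates `(x, s) ↦ γ x + s ν` near a point of a regular loop. -/
lemma exists_transversal_box (h : IsRegularLoop γ P) (x₀ : ℝ) :
    ∃ δ > 0, δ < π ∧ (∀ x, |x - x₀| ≤ δ → 0 < cross (P x) (perp (P x₀))) ∧
      (∀ x x' s s' : ℝ, |x - x₀| ≤ δ → |x' - x₀| ≤ δ →
        γ x + s • perp (P x₀) = γ x' + s' • perp (P x₀) → x = x' ∧ s = s') ∧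
      ∀ x s : ℝ, |x - x₀| ≤ δ → |s| ≤ δ → γ x + s • perp (P x₀) ∈ range γ → s = 0 := by
  set ν := perp (P x₀) with hν
  have hγ := h.continuous
  have hP := h.continuous_deriv
  have hpos : 0 < cross (P x₀) ν := by
    rw [hν, cross_perp, real_inner_self_eq_norm_sq]
    have := norm_pos_iff.2 (h.deriv_ne_zero x₀)
    positivity
  have hν0 : ν ≠ 0 := by
    rintro h0
    rw [h0] at hpos
    simp [cross] at hpos
  obtain ⟨δ₀, hδ₀, hball⟩ := Metric.eventually_nhds_iff.1
    ((show Continuous fun x => cross (P x) ν by fun_prop).continuousAt.eventually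
      (lt_mem_nhds hpos))
  set δ₁ := min (δ₀ / 2) (π / 2) with hδ₁
  have hδ₁0 : 0 < δ₁ := by have := pi_pos; positivity
  have hδ₁π : δ₁ < π := by
    have : δ₁ ≤ π / 2 := min_le_right _ _
    linarith [pi_pos]
  have hcross : ∀ x, |x - x₀| ≤ δ₁ → 0 < cross (P x) ν := fun x hx => by
    refine hball ?_
    have : δ₁ ≤ δ₀ / 2 := min_le_left _ _
    rw [Real.dist_eq]; linarith
  have hmono : StrictMonoOn (fun x => cross (γ x) ν) (Icc (x₀ - δ₁) (x₀ + δ₁)) := by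
    have hd : ∀ x, HasDerivAt (fun x => cross (γ x) ν) (cross (P x) ν) x := fun x =>
      (((h.hasDerivAt x).coord 0).mul_const (ν 1)).sub (((h.hasDerivAt x).coord 1).mul_const (ν 0))
    refine strictMonoOn_of_deriv_pos (convex_Icc _ _) (by fun_prop) fun x hx => ?_
    rw [interior_Icc] at hx
    rw [(hd x).deriv]
    exact hcross x (abs_le.2 ⟨by linarith [hx.1], by linarith [hx.2]⟩)
  have hinj : ∀ x x' s s' : ℝ, |x - x₀| ≤ δ₁ → |x' - x₀| ≤ δ₁ →
        γ x + s • ν = γ x' + s' • ν → x = x' ∧ s = s' := fun x x' s s' hx hx' he => by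
    have h1 : cross (γ x) ν = cross (γ x') ν := by
      have := congrArg (fun y => cross y ν) he
      simpa [cross_add_left, cross_smul_left, cross_same] using this
    rw [abs_le] at hx hx'
    have h2 : x = x' := hmono.injOn ⟨by linarith, by linarith⟩ ⟨by linarith, by linarith⟩ h1
    refine ⟨h2, ?_⟩
    rw [h2] at he
    exact smul_left_injective ℝ hν0 (add_left_cancel he)
  set K := γ '' (Icc (x₀ - π) (x₀ + π) \ Ioo (x₀ - δ₁) (x₀ + δ₁)) with hK
  have hKc : IsCompact K := (isCompact_Icc.diff isOpen_Ioo).image hγ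
  have hxK : γ x₀ ∉ K := by
    rintro ⟨y, ⟨hy, hy'⟩, he⟩
    have : y = x₀ := h.eq_of_abs_sub_lt (by
      rw [abs_lt]; constructor <;> linarith [hy.1, hy.2, pi_pos]) he
    rw [this] at hy'
    exact hy' ⟨by linarith, by linarith⟩
  obtain ⟨ρ, hρ, hρK⟩ := Metric.isOpen_iff.1 hKc.isClosed.isOpen_compl _ hxK
  have hcont : Continuous fun p : ℝ × ℝ => γ p.1 + p.2 • ν := by fun_prop
  obtain ⟨δ₂, hδ₂, hb⟩ := Metric.continuousAt_iff.1 (hcont.continuousAt (x := (x₀, 0))) ρ hρ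
  have hb' : ∀ x s : ℝ, |x - x₀| ≤ min δ₁ (δ₂ / 2) → |s| ≤ min δ₁ (δ₂ / 2) →
      γ x + s • ν ∈ Metric.ball (γ x₀) ρ := fun x s hx hs => by
    have := @hb (x, s) (by
      rw [Prod.dist_eq, Real.dist_eq, Real.dist_eq, sub_zero]
      have : min δ₁ (δ₂ / 2) ≤ δ₂ / 2 := min_le_right _ _
      exact max_lt (by linarith) (by linarith))
    simpa using this
  refine ⟨min δ₁ (δ₂ / 2), by positivity, lt_of_le_of_lt (min_le_left _ _) hδ₁π,
    fun x hx => hcross x (hx.trans (min_le_left _ _)),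
    fun x x' s s' hx hx' => hinj x x' s s' (hx.trans (min_le_left _ _))
      (hx'.trans (min_le_left _ _)), ?_⟩
  rintro x s hx hs ⟨y, hy⟩
  obtain ⟨y', hy', hyy'⟩ := h.periodic.exists_mem_Ico two_pi_pos y (x₀ - π)
  have hmem : γ y' ∉ K := hρK (by rw [← hyy', hy]; exact hb' x s hx hs)
  have hy'1 : y' ∈ Ioo (x₀ - δ₁) (x₀ + δ₁) := by
    by_contra hc
    exact hmem ⟨y', ⟨⟨hy'.1, by linarith [hy'.2]⟩, hc⟩, rfl⟩
  have := hinj x y' s 0 (hx.trans (min_le_left _ _))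
    (abs_le.2 ⟨by linarith [hy'1.1], by linarith [hy'1.2]⟩) (by rw [← hy, hyy']; simp)
  exact this.2

end IsRegularLoop

lemma integral_period_eq_of_support {ψ : ℝ → ℝ} (hψ : Periodic ψ (2 * π))
    {x₀ δ : ℝ} (hδ0 : 0 < δ) (hδ : δ < π)
    (h0 : ∀ x, δ ≤ |x - x₀| → |x - x₀| ≤ π → ψ x = 0) :
    ∫ x in (0:ℝ)..2 * π, ψ x = ∫ x in (x₀ - δ)..(x₀ + δ), ψ x := by
  have h1 := hψ.intervalIntegral_add_eq 0 (x₀ - π)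
  rw [zero_add] at h1
  rw [h1, intervalIntegral.integral_of_le (by linarith), intervalIntegral.integral_of_le (by linarith)]
  refine setIntegral_eq_of_subset_of_forall_sdiff_eq_zero measurableSet_Ioc
    (Ioc_subset_Ioc (by linarith) (by linarith)) fun x hx => h0 x ?_ ?_
  · by_contra! hc
    rw [abs_lt] at hc
    exact hx.2 ⟨by linarith, by linarith⟩
  · have := hx.1
    rw [abs_le]
    constructor <;> linarith [this.1, this.2]

namespace IsRegularLoop

variable {γ P : ℝ → R2}

/-- Green's theorem for test functions supported near a point of the boundary loop, up to
a factor `c ∈ {-1, 0, 1}`. -/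
lemma exists_local_green (h : IsRegularLoop γ P) {Ω : Set R2} (hΩ : IsOpen Ω)
    (hr : range γ = frontier Ω) (x₀ : ℝ) :
    ∃ V : Set R2, IsOpen V ∧ γ x₀ ∈ V ∧ ∃ c : ℝ, (c = -1 ∨ c = 0 ∨ c = 1) ∧
      (∃ δ > 0, δ < π ∧ (∀ x, |x - x₀| ≤ δ → 0 < cross (P x) (perp (P x₀))) ∧
        ∀ x, δ ≤ |x - x₀| → |x - x₀| ≤ π → γ x ∉ V) ∧
      ∀ φ : R2 → ℝ, ContDiff ℝ 1 φ → tsupport φ ⊆ V → ∀ μ : R2,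
        ∫ y in Ω, fderiv ℝ φ y μ = c * ∫ x in (0:ℝ)..2 * π, φ (γ x) * cross μ (P x) := by
  obtain ⟨δ, hδ0, hδπ, hcross, hinj, hon⟩ := h.exists_transversal_box x₀
  set ν := perp (P x₀) with hν
  have hγ := h.continuous
  have hP := h.continuous_deriv
  set Φ : R2 → R2 := fun z => γ (z 0) + z 1 • ν with hΦ
  have hΦc : Continuous Φ := by fun_prop
  have hΦd : ∀ z, HasFDerivAt Φ (frameMap (P (z 0)) ν) z := fun z => by
    have h1 := (h.hasDerivAt (z 0)).hasFDerivAt.comp z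
      (EuclideanSpace.proj (0 : Fin 2) : R2 →L[ℝ] ℝ).hasFDerivAt
    have h2 := ((EuclideanSpace.proj (1 : Fin 2) : R2 →L[ℝ] ℝ).hasFDerivAt (x := z)).smul_const ν
    refine (h1.add h2).congr_fderiv ?_
    ext w i
    simp [frameMap]
  have box_conv : ∀ a b c d : ℝ, Convex ℝ {z : R2 | z 0 ∈ Ioo a b ∧ z 1 ∈ Ioo c d} :=
    fun a b c d => ((convex_Ioo a b).linear_preimage
      (EuclideanSpace.proj (0 : Fin 2) : R2 →L[ℝ] ℝ).toLinearMap).inter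
      ((convex_Ioo c d).linear_preimage
      (EuclideanSpace.proj (1 : Fin 2) : R2 →L[ℝ] ℝ).toLinearMap)
  have box_open : ∀ a b c d : ℝ, IsOpen {z : R2 | z 0 ∈ Ioo a b ∧ z 1 ∈ Ioo c d} :=
    fun a b c d => (isOpen_Ioo.preimage (by fun_prop : Continuous fun z : R2 => z 0)).inter
      (isOpen_Ioo.preimage (by fun_prop : Continuous fun z : R2 => z 1))
  set B : ℝ → ℝ → Set R2 := fun c d => {z : R2 | z 0 ∈ Ioo (x₀ - δ) (x₀ + δ) ∧ z 1 ∈ Ioo c d}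
    with hB
  have hBabs : ∀ {c d z}, z ∈ B c d → |z 0 - x₀| ≤ δ := fun {c d z} hz =>
    abs_le.2 ⟨by linarith [hz.1.1], by linarith [hz.1.2]⟩
  have hBd : ∀ {z}, z ∈ B (-δ) δ → |z 1| ≤ δ := fun {z} hz =>
    abs_le.2 ⟨by linarith [hz.2.1], by linarith [hz.2.2]⟩
  have hBinj : InjOn Φ (B (-δ) δ) := fun z hz w hw he => by
    obtain ⟨e0, e1⟩ := hinj _ _ _ _ (hBabs hz) (hBabs hw) he
    exact R2.ext_coord e0 e1
  have dich : ∀ c d, -δ ≤ c → d ≤ δ → (0 ≤ c ∨ d ≤ 0) →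
      ∃ a : ℝ, (a = 0 ∨ a = 1) ∧ ∀ F : R2 → ℝ,
        ∫ z in B c d ∩ Φ ⁻¹' Ω, F z = a * ∫ z in B c d, F z := fun c d hc hd h0 => by
    have hd1 : Disjoint (Φ '' B c d) (frontier Ω) := by
      rw [← hr, disjoint_left]
      rintro _ ⟨z, hz, rfl⟩ hz'
      have : z 1 = 0 := hon (z 0) (z 1) (hBabs hz)
        (hBd ⟨hz.1, by linarith [hz.2.1], by linarith [hz.2.2]⟩) hz'
      rcases h0 with h0 | h0 <;> linarith [hz.2.1, hz.2.2]
    rcases ((box_conv _ _ c d).isPreconnected.image Φ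
      hΦc.continuousOn).subset_or_disjoint_of_disjoint_frontier hd1 with hs | hs
    · refine ⟨1, Or.inr rfl, fun F => ?_⟩
      rw [inter_eq_left.2 (image_subset_iff.1 hs), one_mul]
    · refine ⟨0, Or.inl rfl, fun F => ?_⟩
      have : B c d ∩ Φ ⁻¹' Ω = ∅ := by
        rw [← disjoint_iff_inter_eq_empty, disjoint_left]
        exact fun z hz hz' => disjoint_left.1 hs ⟨z, hz, rfl⟩ hz'
      simp [this]
  obtain ⟨a₁, ha₁, hI₁⟩ := dich 0 δ (by linarith) le_rfl (Or.inl le_rfl)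
  obtain ⟨a₂, ha₂, hI₂⟩ := dich (-δ) 0 le_rfl (by linarith) (Or.inr le_rfl)
  set U := Φ '' B (-δ) δ with hU
  have hUnhds : U ∈ 𝓝 (γ x₀) := by
    set z₀ : R2 := !₂[x₀, 0] with hz₀
    have hz0 : z₀ 0 = x₀ := rfl
    have hz1 : z₀ 1 = 0 := rfl
    have hst : HasStrictFDerivAt Φ (frameMap (P (z₀ 0)) ν) z₀ := by
      refine hasStrictFDerivAt_of_hasFDerivAt_of_continuousAt (Eventually.of_forall hΦd) ?_
      have : Continuous fun z : R2 => frameMap (P (z 0)) ν := by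
        unfold frameMap
        refine Continuous.add ?_ continuous_const
        exact ((ContinuousLinearMap.smulRightL ℝ R2 R2
          (EuclideanSpace.proj (0 : Fin 2))).continuous.comp hP).comp (by fun_prop)
      exact this.continuousAt
    have hmap := hst.map_nhds_eq_of_surj (range_frameMap (hcross _ (by simp [hz0, hδ0.le])).ne')
    have : Φ z₀ = γ x₀ := by simp [hΦ, hz0, hz1]
    rw [← this, ← hmap]
    refine image_mem_map ((box_open _ _ _ _).mem_nhds ⟨?_, ?_⟩)
    · rw [hz0]; exact ⟨by linarith, by linarith⟩
    · rw [hz1]; exact ⟨by linarith, by linarith⟩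
  have hVout : ∀ x s : ℝ, |x - x₀| ≤ δ → |s| ≤ δ → (|x - x₀| = δ ∨ |s| = δ) →
      γ x + s • ν ∉ U := by
    rintro x s hx hs hor ⟨z, hz, he⟩
    obtain ⟨e0, e1⟩ := hinj _ _ _ _ (hBabs hz) hx he
    have h1 : |x - x₀| < δ := by
      rw [← e0, abs_lt]; exact ⟨by linarith [hz.1.1], by linarith [hz.1.2]⟩
    have h2 : |s| < δ := by rw [← e1, abs_lt]; exact hz.2
    rcases hor with h | h <;> linarith
  have hVγ : ∀ x, δ ≤ |x - x₀| → |x - x₀| ≤ π → γ x ∉ U := by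
    rintro x hx1 hx2 ⟨z, hz, he⟩
    have e1 : z 1 = 0 := hon _ _ (hBabs hz) (hBd hz) ⟨x, he.symm⟩
    have he' : γ (z 0) = γ x := by simpa [hΦ, e1] using he
    have hlt : |z 0 - x₀| < δ := by
      rw [abs_lt]; exact ⟨by linarith [hz.1.1], by linarith [hz.1.2]⟩
    have : z 0 = x := by
      refine h.eq_of_abs_sub_lt ?_ he'
      have := abs_sub_le (z 0) x₀ x
      rw [abs_sub_comm x₀ x] at this
      linarith
    rw [this] at hlt
    linarith
  refine ⟨interior U, isOpen_interior, mem_interior_iff_mem_nhds.2 hUnhds, a₁ - a₂, ?_,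
    ⟨δ, hδ0, hδπ, hcross, fun x h1 h2 h3 => hVγ x h1 h2 (interior_subset h3)⟩, ?_⟩
  · rcases ha₁ with rfl | rfl <;> rcases ha₂ with rfl | rfl <;> norm_num
  intro φ hφ hsupp μ
  have hsU : tsupport φ ⊆ U := hsupp.trans interior_subset
  have hφ0 : ∀ y, y ∉ U → φ y = 0 := fun y hy => by
    by_contra hc
    exact hy (hsU (subset_tsupport φ hc))
  have hDφ0 : ∀ y, y ∉ U → fderiv ℝ φ y μ = 0 := fun y hy => by
    have : fderiv ℝ φ y = 0 := by
      by_contra hc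
      exact hy (hsU (support_fderiv_subset ℝ hc))
    simp [this]
  have hD : Continuous (fderiv ℝ φ) := hφ.continuous_fderiv one_ne_zero
  set F : ℝ × ℝ → ℝ := fun p => cross (P p.1) ν * fderiv ℝ φ (γ p.1 + p.2 • ν) μ with hF
  have hFc : Continuous F := by fun_prop
  have hS : Φ '' (B (-δ) δ ∩ Φ ⁻¹' Ω) = U ∩ Ω := image_inter_preimage _ _ _
  have step1 : ∫ y in Ω, fderiv ℝ φ y μ =
      ∫ z in B (-δ) δ ∩ Φ ⁻¹' Ω, F (z 0, z 1) := by
    rw [setIntegral_eq_of_subset_of_forall_sdiff_eq_zero hΩ.measurableSet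
      (inter_subset_right : U ∩ Ω ⊆ Ω) (fun y hy => hDφ0 y fun hyU => hy.2 ⟨hyU, hy.1⟩), ← hS,
      integral_image_eq_integral_abs_det_fderiv_smul volume
        ((box_open _ _ _ _).inter (hΩ.preimage hΦc)).measurableSet
        (fun z _ => (hΦd z).hasFDerivWithinAt) (hBinj.mono inter_subset_left)]
    refine setIntegral_congr_fun ((box_open _ _ _ _).inter (hΩ.preimage hΦc)).measurableSet
      fun z hz => ?_
    simp only [det_frameMap, hF, smul_eq_mul]
    rw [abs_of_pos (hcross _ (hBabs hz.1))]
  have hsplit : B (-δ) δ ∩ Φ ⁻¹' Ω = (B 0 δ ∩ Φ ⁻¹' Ω) ∪ (B (-δ) 0 ∩ Φ ⁻¹' Ω) := by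
    ext z
    constructor
    · rintro ⟨hz, hzΩ⟩
      have hz1 : z 1 ≠ 0 := fun hz1 => by
        have hm : Φ z ∈ frontier Ω := by
          rw [← hr]; exact ⟨z 0, by simp [hΦ, hz1]⟩
        rw [frontier, hΩ.interior_eq] at hm
        exact hm.2 hzΩ
      rcases lt_or_gt_of_ne hz1 with h1 | h1
      · exact Or.inr ⟨⟨hz.1, hz.2.1, h1⟩, hzΩ⟩
      · exact Or.inl ⟨⟨hz.1, h1, hz.2.2⟩, hzΩ⟩
    · rintro (⟨hz, hzΩ⟩ | ⟨hz, hzΩ⟩)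
      · exact ⟨⟨hz.1, by linarith [hz.2.1], hz.2.2⟩, hzΩ⟩
      · exact ⟨⟨hz.1, hz.2.1, by linarith [hz.2.2]⟩, hzΩ⟩
  have hdisj : Disjoint (B 0 δ ∩ Φ ⁻¹' Ω) (B (-δ) 0 ∩ Φ ⁻¹' Ω) := by
    rw [disjoint_left]
    rintro z ⟨hz, -⟩ ⟨hz', -⟩
    linarith [hz.2.1, hz'.2.2]
  have hint : ∀ c d, IntegrableOn (fun z : R2 => F (z 0, z 1)) (B c d ∩ Φ ⁻¹' Ω) := fun c d => by
    have hbdd : IsBounded (B c d) := by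
      have : B c d ⊆ PiLp.homeomorph 2 (fun _ : Fin 2 => ℝ) ⁻¹'
          (Icc ![x₀ - δ, c] ![x₀ + δ, d]) := by
        intro z hz
        constructor
        · intro i; fin_cases i
          · exact hz.1.1.le
          · exact hz.2.1.le
        · intro i; fin_cases i
          · exact hz.1.2.le
          · exact hz.2.2.le
      refine IsCompact.isBounded ?_ |>.subset this
      exact (Homeomorph.isCompact_preimage _).2 isCompact_Icc
    have : Continuous fun z : R2 => F (z 0, z 1) := by fun_prop
    exact (this.continuousOn.integrableOn_compact hbdd.isCompact_closure).mono_set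
      (inter_subset_left.trans subset_closure)
  have hper : Periodic (fun x => φ (γ x) * cross μ (P x)) (2 * π) := fun x => by
    simp only [h.periodic x, h.periodic_deriv x]
  have hend : ∀ s, |s| ≤ δ → φ (γ (x₀ - δ) + s • ν) = 0 ∧ φ (γ (x₀ + δ) + s • ν) = 0 :=
    fun s hs => by
      have e1 : |x₀ - δ - x₀| = δ := by
        rw [show x₀ - δ - x₀ = -δ by ring, abs_neg, abs_of_pos hδ0]
      have e2 : |x₀ + δ - x₀| = δ := by
        rw [show x₀ + δ - x₀ = δ by ring, abs_of_pos hδ0]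
      exact ⟨hφ0 _ (hVout _ _ e1.le hs (Or.inl e1)), hφ0 _ (hVout _ _ e2.le hs (Or.inl e2))⟩
  have htop : ∀ x ∈ uIcc (x₀ - δ) (x₀ + δ), φ (γ x + δ • ν) = 0 ∧ φ (γ x + (-δ) • ν) = 0 := by
    intro x hx
    rw [uIcc_of_le (by linarith)] at hx
    have e : |x - x₀| ≤ δ := abs_le.2 ⟨by linarith [hx.1], by linarith [hx.2]⟩
    have e1 : |δ| = δ := abs_of_pos hδ0
    have e2 : |-δ| = δ := by rw [abs_neg, e1]
    exact ⟨hφ0 _ (hVout _ _ e e1.le (Or.inr e1)), hφ0 _ (hVout _ _ e e2.le (Or.inr e2))⟩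
  rw [step1, hsplit, setIntegral_union hdisj ((box_open _ _ _ _).inter
    (hΩ.preimage hΦc)).measurableSet (hint _ _) (hint _ _), hI₁, hI₂,
    setIntegral_box F hFc (by linarith) hδ0.le, setIntegral_box F hFc (by linarith) (by linarith),
    integral_period_eq_of_support hper hδ0 hδπ (fun x h1 h2 => by rw [hφ0 _ (hVγ x h1 h2), zero_mul]),
    h.integral_fderiv_box ν μ hφ (fun s hs => hend s ?_),
    h.integral_fderiv_box ν μ hφ (fun s hs => hend s ?_)]
  · have e1 : ∫ x in (x₀ - δ)..(x₀ + δ), cross (P x) μ * (φ (γ x + δ • ν) - φ (γ x + (0:ℝ) • ν))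
        = ∫ x in (x₀ - δ)..(x₀ + δ), φ (γ x) * cross μ (P x) :=
      intervalIntegral.integral_congr fun x hx => by
        simp only [(htop x hx).1, zero_smul, add_zero, cross_swap μ]; ring
    have e2 : ∫ x in (x₀ - δ)..(x₀ + δ), cross (P x) μ *
        (φ (γ x + (0:ℝ) • ν) - φ (γ x + (-δ) • ν))
        = - ∫ x in (x₀ - δ)..(x₀ + δ), φ (γ x) * cross μ (P x) := by
      rw [← intervalIntegral.integral_neg]
      exact intervalIntegral.integral_congr fun x hx => by
        simp only [(htop x hx).2, zero_smul, add_zero, cross_swap μ]; ring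
    rw [e1, e2]; ring
  · rw [uIcc_of_le (by linarith)] at hs
    exact abs_le.2 ⟨by linarith [hs.1], by linarith [hs.2]⟩
  · rw [uIcc_of_le hδ0.le] at hs
    exact abs_le.2 ⟨by linarith [hs.1], by linarith [hs.2]⟩

end IsRegularLoop

namespace IsRegularLoop

variable {γ P : ℝ → R2}

lemma integral_fderiv_eq_zero_of_tsupport_subset {Ω : Set R2} (hΩb : IsBounded Ω)
    {φ : R2 → ℝ} (hφ : ContDiff ℝ 1 φ) (hs : tsupport φ ⊆ Ω) (μ : R2) :
    ∫ y in Ω, fderiv ℝ φ y μ = 0 := by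
  have hc : HasCompactSupport φ := by
    rw [hasCompactSupport_def, ← tsupport]
    exact Metric.isCompact_of_isClosed_isBounded (isClosed_tsupport φ) (hΩb.subset hs)
  have hD : Continuous (fun y => fderiv ℝ φ y μ) :=
    (hφ.continuous_fderiv one_ne_zero).clm_apply continuous_const
  have hDc : HasCompactSupport (fun y => fderiv ℝ φ y μ) := hc.fderiv_apply ℝ μ
  rw [setIntegral_eq_integral_of_forall_compl_eq_zero fun y hy => by
    rw [image_eq_zero_of_notMem_tsupport (f := fun y => fderiv ℝ φ y μ)]
    intro h
    exact hy (hs (tsupport_fderiv_apply_subset ℝ μ h))]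
  have := integral_mul_fderiv_eq_neg_fderiv_mul_of_integrable (μ := (volume : Measure R2))
    (f := fun _ : R2 => (1 : ℝ)) (g := φ) (v := μ) (by simp)
    (by simpa using hD.integrable_of_hasCompactSupport hDc)
    (by simpa using hφ.continuous.integrable_of_hasCompactSupport hc)
    (fun _ _ => differentiableAt_const _) (fun y _ => hφ.differentiable one_ne_zero y)
  simpa using this

/-- **Green's theorem** for a bounded domain whose frontier is a regular loop. -/
lemma exists_green (h : IsRegularLoop γ P) {Ω : Set R2} (hΩ : IsOpen Ω) (hΩb : IsBounded Ω)
    (hΩn : Ω.Nonempty) (hr : range γ = frontier Ω) :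
    ∃ c : ℝ, (c = -1 ∨ c = 1) ∧ 0 < c * (∫ x in (0:ℝ)..2 * π, γ x 0 * P x 1) ∧
      ∀ φ : R2 → ℝ, ContDiff ℝ 1 φ → ∀ μ : R2,
      ∫ y in Ω, fderiv ℝ φ y μ = c * ∫ x in (0:ℝ)..2 * π, φ (γ x) * cross μ (P x) := by
  choose V hVo hVm c hc hδ hG using h.exists_local_green hΩ hr
  have hγ := h.continuous
  have hP := h.continuous_deriv
  have hconst : ∀ x, c x = c 0 := by
    have hl : IsLocallyConstant c := by
      rw [IsLocallyConstant.iff_eventually_eq]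
      intro x₀
      obtain ⟨δ, hδ0, hδπ, hpos, hout⟩ := hδ x₀
      have e1 : ∀ᶠ x₁ in 𝓝 x₀, γ x₁ ∈ V x₀ :=
        hγ.continuousAt.eventually ((hVo x₀).mem_nhds (hVm x₀))
      filter_upwards [e1, Metric.closedBall_mem_nhds x₀ hδ0] with x₁ h1 h2
      have h2' : |x₁ - x₀| ≤ δ := by simpa [Real.dist_eq] using h2
      obtain ⟨φ, hs, -, hφ, hφr, hφ1⟩ := exists_contDiff_tsupport_subset (n := 1)
        (((hVo x₀).inter (hVo x₁)).mem_nhds ⟨h1, hVm x₁⟩)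
      have hφ0 : ∀ y, 0 ≤ φ y := fun y => (hφr (mem_range_self y)).1
      have hφc := hφ.continuous
      have g0 := hG x₀ φ hφ (hs.trans inter_subset_left) (-perp (P x₀))
      have g1 := hG x₁ φ hφ (hs.trans inter_subset_right) (-perp (P x₀))
      have hval : ∀ x, cross (-perp (P x₀)) (P x) = cross (P x) (perp (P x₀)) := fun x => by
        rw [cross_swap (P x)]; simp [cross]; ring
      simp_rw [hval] at g0 g1
      have hI : 0 < ∫ x in (0:ℝ)..2 * π, φ (γ x) * cross (P x) (perp (P x₀)) := by
        rw [integral_period_eq_of_support (fun x => by simp only [h.periodic x, h.periodic_deriv x])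
          hδ0 hδπ fun x hx1 hx2 => by
            rw [image_eq_zero_of_notMem_tsupport fun hm => hout x hx1 hx2 (hs hm).1, zero_mul]]
        refine intervalIntegral.integral_pos (by linarith) (by fun_prop) (fun x hx => ?_)
          ⟨x₁, ?_, ?_⟩
        · exact mul_nonneg (hφ0 _) (hpos x (abs_le.2 ⟨by linarith [hx.1], by linarith [hx.2]⟩)).le
        · rw [abs_le] at h2'; exact ⟨by linarith, by linarith⟩
        · rw [hφ1, one_mul]; exact hpos x₁ h2'
      exact mul_right_cancel₀ hI.ne' (g1.symm.trans g0)
    exact fun x => hl.apply_eq_of_preconnectedSpace x 0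
  have hgreen : ∀ φ : R2 → ℝ, ContDiff ℝ 1 φ → ∀ μ : R2,
      ∫ y in Ω, fderiv ℝ φ y μ = c 0 * ∫ x in (0:ℝ)..2 * π, φ (γ x) * cross μ (P x) := by
    intro φ hφ μ
    let U : Option ℝ → Set R2 := fun i => i.elim Ω V
    have hUo : ∀ i, IsOpen (U i) := fun i => by
      cases i with
      | none => exact hΩ
      | some x => exact hVo x
    have hcov : closure Ω ⊆ ⋃ i, U i := by
      rw [closure_eq_self_union_frontier, ← hr]
      rintro y (hy | ⟨x, rfl⟩)
      · exact mem_iUnion.2 ⟨none, hy⟩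
      · exact mem_iUnion.2 ⟨some x, hVm x⟩
    obtain ⟨t, ht⟩ := hΩb.isCompact_closure.elim_finite_subcover U hUo hcov
    obtain ⟨ρ, hρ⟩ := SmoothPartitionOfUnity.exists_isSubordinate (modelWithCornersSelf ℝ R2)
      (isClosed_closure (s := Ω)) (fun i : t => U i) (fun i => hUo i) (by
        intro y hy
        obtain ⟨i, hi, hy⟩ := mem_iUnion₂.1 (ht hy)
        exact mem_iUnion.2 ⟨⟨i, hi⟩, hy⟩)
    have hρc : ∀ i, ContDiff ℝ 1 (fun y => ρ i y * φ y) := fun i =>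
      ((ρ i).contMDiff.contDiff.of_le (by norm_cast)).mul hφ
    have hρsum : ∀ y ∈ closure Ω, ∑ i, ρ i y * φ y = φ y := fun y hy => by
      rw [← Finset.sum_mul, ← finsum_eq_sum_of_fintype, ρ.sum_eq_one hy, one_mul]
    have hρs : ∀ i : t, tsupport (fun y => ρ i y * φ y) ⊆ U i := fun i =>
      (closure_mono (support_mul_subset_left (ρ i) φ)).trans (hρ i)
    have hloc : ∀ i : t, ∫ y in Ω, fderiv ℝ (fun y => ρ i y * φ y) y μ =
        c 0 * ∫ x in (0:ℝ)..2 * π, ρ i (γ x) * φ (γ x) * cross μ (P x) := by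
      rintro ⟨i, hi⟩
      have hsi := hρs ⟨i, hi⟩
      cases i with
      | none =>
        rw [integral_fderiv_eq_zero_of_tsupport_subset hΩb (hρc _) hsi μ]
        have : ∀ x, ρ ⟨none, hi⟩ (γ x) * φ (γ x) = 0 := fun x => by
          refine image_eq_zero_of_notMem_tsupport (f := fun y => ρ ⟨none, hi⟩ y * φ y) fun hm => ?_
          have hf : γ x ∈ frontier Ω := hr ▸ mem_range_self x
          rw [frontier, hΩ.interior_eq] at hf
          exact hf.2 (hsi hm)
        simp [this]
      | some x => rw [hG x _ (hρc _) hsi μ, hconst x]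
    have hDi : ∀ i, IntegrableOn (fun y => fderiv ℝ (fun y => ρ i y * φ y) y μ) Ω := fun i =>
      ((((hρc i).continuous_fderiv one_ne_zero).clm_apply
        continuous_const).continuousOn.integrableOn_compact hΩb.isCompact_closure).mono_set
        subset_closure
    have hleft : ∫ y in Ω, fderiv ℝ φ y μ =
        ∑ i, ∫ y in Ω, fderiv ℝ (fun y => ρ i y * φ y) y μ := by
      rw [← integral_finsetSum _ fun i _ => hDi i]
      refine setIntegral_congr_fun hΩ.measurableSet fun y hy => ?_
      have : φ =ᶠ[𝓝 y] fun y => ∑ i, ρ i y * φ y := by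
        filter_upwards [hΩ.mem_nhds hy] with z hz
        exact (hρsum z (subset_closure hz)).symm
      rw [this.fderiv_eq, fderiv_fun_sum fun i _ => (hρc i).differentiable one_ne_zero y]
      simp
    rw [hleft, Finset.sum_congr rfl fun i _ => hloc i, ← Finset.mul_sum,
      ← intervalIntegral.integral_finsetSum]
    · congr 1
      refine intervalIntegral.integral_congr fun x _ => ?_
      rw [← Finset.sum_mul, hρsum]
      rw [closure_eq_self_union_frontier, ← hr]
      exact Or.inr (mem_range_self x)
    · intro i _
      have := (hρc i).continuous
      have : Continuous fun x => ρ i (γ x) * φ (γ x) := this.comp hγ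
      exact (this.mul (by fun_prop)).intervalIntegrable _ _
  have harea : 0 < c 0 * (∫ x in (0:ℝ)..2 * π, γ x 0 * P x 1) := by
    have h1 := hgreen (fun y => y 0) (by fun_prop) (EuclideanSpace.single 0 1)
    have h2 : ∀ y : R2, fderiv ℝ (fun y : R2 => y 0) y (EuclideanSpace.single 0 1) = 1 := fun y => by
      have : (fun y : R2 => y 0) = EuclideanSpace.proj (𝕜 := ℝ) (0 : Fin 2) := rfl
      rw [this, ContinuousLinearMap.fderiv]; simp
    have h3 : ∀ x, cross (EuclideanSpace.single 0 1) (P x) = P x 1 := fun x => by simp [cross]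
    simp_rw [h2, h3] at h1
    rw [← h1]
    simp only [integral_const, smul_eq_mul, mul_one, measureReal_restrict_apply_univ]
    exact ENNReal.toReal_pos (hΩ.measure_pos _ hΩn).ne' hΩb.measure_lt_top.ne
  refine ⟨c 0, ?_, harea, hgreen⟩
  rcases hc 0 with h0 | h0 | h0
  · exact Or.inl h0
  · rw [h0, zero_mul] at harea; exact absurd harea (lt_irrefl _)
  · exact Or.inr h0

end IsRegularLoop

/-! ### The regularised velocity along the boundary -/

/-- Regularisation of the potential `‖z‖^{-2α}`. -/
def regPotential (α ε : ℝ) (z : R2) : ℝ := (‖z‖ ^ 2 + ε ^ 2) ^ (-α)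

/-- Regularisation of the weight `‖z‖^{-2-2α}`. -/
def regWeight (α ε : ℝ) (z : R2) : ℝ := (‖z‖ ^ 2 + ε ^ 2) ^ (-1 - α)

lemma sq_norm_add_sq_pos {ε : ℝ} (hε : ε ≠ 0) (z : R2) : 0 < ‖z‖ ^ 2 + ε ^ 2 := by positivity

lemma continuous_regWeight (α : ℝ) {ε : ℝ} (hε : ε ≠ 0) : Continuous (regWeight α ε) := by
  unfold regWeight
  exact Continuous.rpow_const (by fun_prop) fun z => Or.inl (sq_norm_add_sq_pos hε z).ne'

lemma contDiff_regPotential (α : ℝ) {ε : ℝ} (hε : ε ≠ 0) : ContDiff ℝ 1 (regPotential α ε) := by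
  unfold regPotential
  exact ContDiff.rpow_const_of_ne ((contDiff_id.norm_sq ℝ).add contDiff_const)
    fun z => (sq_norm_add_sq_pos hε z).ne'

lemma HasDerivAt.regPotential {f : ℝ → R2} {f' : R2} {t : ℝ} (hf : HasDerivAt f f' t) (α : ℝ)
    {ε : ℝ} (hε : ε ≠ 0) :
    HasDerivAt (fun s => regPotential α ε (f s))
      (-(2 * α) * (regWeight α ε (f t) * ⟪f t, f'⟫)) t := by
  have h1 : HasDerivAt (fun s => ‖f s‖ ^ 2 + ε ^ 2) (2 * ⟪f t, f'⟫) t :=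
    hf.norm_sq.add_const _
  have h2 := h1.rpow_const (p := -α) (Or.inl (sq_norm_add_sq_pos hε (f t)).ne')
  refine h2.congr_deriv ?_
  rw [regWeight, show -1 - α = -α - 1 by ring]
  ring

namespace IsRegularLoop

variable {γ P : ℝ → R2}

lemma integral_regWeight {Ω : Set R2} {c : ℝ}
    (hG : ∀ φ : R2 → ℝ, ContDiff ℝ 1 φ → ∀ μ : R2,
      ∫ y in Ω, fderiv ℝ φ y μ = c * ∫ x in (0:ℝ)..2 * π, φ (γ x) * cross μ (P x))
    (α : ℝ) {ε : ℝ} (hε : ε ≠ 0) (x μ : R2) :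
    2 * α * ∫ y in Ω, regWeight α ε (x - y) * ⟪μ, perp (x - y)⟫ =
      c * ∫ s in (0:ℝ)..2 * π, regPotential α ε (x - γ s) * ⟪P s, μ⟫ := by
  have hφ : ContDiff ℝ 1 fun y => regPotential α ε (x - y) :=
    (contDiff_regPotential α hε).comp (contDiff_const.sub contDiff_id)
  have h := hG _ hφ (-perp μ)
  have h1 : ∀ y, fderiv ℝ (fun y => regPotential α ε (x - y)) y (-perp μ) =
      2 * α * (regWeight α ε (x - y) * ⟪μ, perp (x - y)⟫) := fun y => by
    have hl : HasDerivAt (fun t : ℝ => y + t • -perp μ) (-perp μ) 0 := by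
      simpa using ((hasDerivAt_id (0:ℝ)).smul_const (-perp μ)).const_add y
    have ha : HasFDerivAt (fun y => regPotential α ε (x - y))
        (fderiv ℝ (fun y => regPotential α ε (x - y)) y) (y + (0:ℝ) • -perp μ) := by
      simpa using (hφ.differentiable one_ne_zero y).hasFDerivAt
    have e1 := ha.comp_hasDerivAt (0:ℝ) hl
    have e2 := (hl.const_sub x).regPotential α hε
    have e3 := e1.unique e2
    rw [e3]
    simp only [zero_smul, add_zero, neg_neg]
    have : ⟪x - y, perp μ⟫ = - ⟪μ, perp (x - y)⟫ := by
      simp [R2.inner_coord]; ring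
    rw [this]; ring
  have h2 : ∀ s, cross (-perp μ) (P s) = ⟪P s, μ⟫ := fun s => by
    simp [cross, R2.inner_coord]; ring
  simp_rw [h1, h2] at h
  rw [← h, integral_const_mul]

lemma regPotential_sub (h : IsRegularLoop γ P) (α : ℝ) {ε : ℝ} (hε : ε ≠ 0) (a b : ℝ) (μ : R2) :
    (∫ s in (0:ℝ)..2 * π, regPotential α ε (γ b - γ s) * ⟪P s, μ⟫) -
      (∫ s in (0:ℝ)..2 * π, regPotential α ε (γ a - γ s) * ⟪P s, μ⟫) =
    2 * α * ∫ x in a..b, ∫ u in (-π)..π, regWeight α ε (γ (x + u) - γ x) *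
      (cross (P x) (P (x + u)) * ⟪perp (γ (x + u) - γ x), μ⟫) := by
  have hγ := h.continuous
  have hP := h.continuous_deriv
  have hW := continuous_regWeight α hε
  have hK := (contDiff_regPotential α hε).continuous
  have c1 : Continuous (uncurry fun s x : ℝ =>
      -(2 * α) * (regWeight α ε (γ x - γ s) * ⟪γ x - γ s, P x⟫) * ⟪P s, μ⟫) := by
    unfold uncurry; fun_prop
  have s1 : ∀ s, regPotential α ε (γ b - γ s) * ⟪P s, μ⟫ - regPotential α ε (γ a - γ s) * ⟪P s, μ⟫ =
      ∫ x in a..b, -(2 * α) * (regWeight α ε (γ x - γ s) * ⟪γ x - γ s, P x⟫) * ⟪P s, μ⟫ := fun s => by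
    refine (intervalIntegral.integral_eq_sub_of_hasDerivAt
      (f := fun x => regPotential α ε (γ x - γ s) * ⟪P s, μ⟫) (fun x _ => ?_) ?_).symm
    · exact (((h.hasDerivAt x).sub_const (γ s)).regPotential α hε).mul_const _
    · exact Continuous.intervalIntegrable (by fun_prop) _ _
  rw [← intervalIntegral.integral_sub (Continuous.intervalIntegrable (by fun_prop) _ _)
    (Continuous.intervalIntegrable (by fun_prop) _ _)]
  simp_rw [s1]
  rw [integral_swap_of_continuous c1, ← intervalIntegral.integral_const_mul]
  refine intervalIntegral.integral_congr fun x _ => ?_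
  have z : ∫ s in (0:ℝ)..2 * π, -(2 * α) * (regWeight α ε (γ x - γ s) * ⟪γ x - γ s, P s⟫) = 0 := by
    have e : ∀ s, HasDerivAt (fun s => -regPotential α ε (γ x - γ s))
        (-(2 * α) * (regWeight α ε (γ x - γ s) * ⟪γ x - γ s, P s⟫)) s := fun s => by
      refine (((h.hasDerivAt s).const_sub (γ x)).regPotential α hε).neg.congr_deriv ?_
      rw [inner_neg_right]; ring
    rw [intervalIntegral.integral_eq_sub_of_hasDerivAt (fun s _ => e s)
      (Continuous.intervalIntegrable (by fun_prop) _ _)]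
    have := h.periodic 0
    rw [zero_add] at this
    rw [this, sub_self]
  have key : ∀ s, -(2 * α) * (regWeight α ε (γ x - γ s) * ⟪γ x - γ s, P x⟫) * ⟪P s, μ⟫ =
      2 * α * (regWeight α ε (γ s - γ x) * (cross (P x) (P s) * ⟪perp (γ s - γ x), μ⟫)) +
      -(2 * α) * (regWeight α ε (γ x - γ s) * ⟪γ x - γ s, P s⟫) * ⟪P x, μ⟫ := fun s => by
    have hi := congrArg (fun z => ⟪z, μ⟫) (inner_smul_sub_inner_smul (γ x - γ s) (P x) (P s))
    simp only [inner_sub_left, inner_smul_left, RCLike.conj_to_real] at hi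
    have hw : regWeight α ε (γ s - γ x) = regWeight α ε (γ x - γ s) := by
      rw [regWeight, regWeight, norm_sub_rev]
    have hp : ⟪perp (γ s - γ x), μ⟫ = - ⟪perp (γ x - γ s), μ⟫ := by
      rw [← inner_neg_left, ← perp_neg, neg_sub]
    rw [hw, hp]
    simp only [inner_sub_left] at hi ⊢
    linear_combination (-(2 * α) * regWeight α ε (γ x - γ s)) * hi
  have per : Periodic (fun s => regWeight α ε (γ s - γ x) *
      (cross (P x) (P s) * ⟪perp (γ s - γ x), μ⟫)) (2 * π) := fun s => by
    simp only [h.periodic s, h.periodic_deriv s]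
  simp_rw [key]
  rw [intervalIntegral.integral_add (Continuous.intervalIntegrable (by fun_prop) _ _)
    (Continuous.intervalIntegrable (by fun_prop) _ _), intervalIntegral.integral_mul_const, z,
    zero_mul, add_zero, intervalIntegral.integral_const_mul]
  congr 1
  have t1 := per.intervalIntegral_add_eq 0 (x - π)
  rw [zero_add] at t1
  rw [t1, show x - π + 2 * π = x + π by ring, sub_eq_add_neg,
    ← intervalIntegral.integral_comp_add_left (fun s => regWeight α ε (γ s - γ x) *
      (cross (P x) (P s) * ⟪perp (γ s - γ x), μ⟫)) x]

end IsRegularLoop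

/-! ### The velocity difference along the boundary -/

lemma regWeight_nonneg (α ε : ℝ) (z : R2) : 0 ≤ regWeight α ε z := by
  unfold regWeight; positivity

lemma sq_norm_rpow (α : ℝ) (z : R2) : (‖z‖ ^ 2) ^ (-1 - α) = (‖z‖ ^ (2 + 2 * α))⁻¹ := by
  rw [← Real.rpow_natCast, ← Real.rpow_mul (norm_nonneg _), ← Real.rpow_neg (norm_nonneg _)]
  congr 1; push_cast; ring

lemma regWeight_le {α : ℝ} (hα : 0 < α) (ε : ℝ) {z : R2} (hz : z ≠ 0) :
    regWeight α ε z ≤ (‖z‖ ^ (2 + 2 * α))⁻¹ := by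
  rw [← sq_norm_rpow, regWeight]
  have : 0 < ‖z‖ ^ 2 := by positivity
  exact Real.rpow_le_rpow_of_nonpos this (by nlinarith [sq_nonneg ε]) (by linarith)

lemma tendsto_regWeight (α : ℝ) {z : R2} (hz : z ≠ 0) :
    Tendsto (fun ε => regWeight α ε z) (𝓝[≠] 0) (𝓝 (‖z‖ ^ (2 + 2 * α))⁻¹) := by
  rw [← sq_norm_rpow]
  have h0 : ‖z‖ ^ 2 ≠ 0 := by positivity
  have : ContinuousAt (fun ε => regWeight α ε z) 0 := by
    unfold regWeight
    exact ContinuousAt.rpow_const (by fun_prop) (Or.inl (by simpa using h0))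
  have h := this.tendsto
  rw [regWeight] at h
  simp only [ne_eq, OfNat.ofNat_ne_zero, not_false_eq_true, zero_pow, add_zero] at h
  exact h.mono_left nhdsWithin_le_nhds

lemma integrableOn_norm_sub_rpow {r : ℝ} (hr : r < 2) {Ω : Set R2} (hΩ : IsBounded Ω) (x : R2) :
    IntegrableOn (fun y => ‖x - y‖ ^ (-r)) Ω := by
  obtain ⟨R, hR⟩ := hΩ.subset_ball x
  have h1 : IntegrableOn (fun z : R2 => ‖z‖ ^ (-r)) (Metric.ball 0 R) := by
    refine integrableOn_ball_of_norm_le_rpow (C := 1) (α := r) (by simp) (by simpa using hr)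
      (Eventually.of_forall fun z => ?_)
      (measurable_norm.pow_const _).aestronglyMeasurable
    rw [one_mul, Real.norm_of_nonneg (by positivity)]
  have h2 := ((Measure.measurePreserving_sub_left volume x).integrableOn_comp_preimage
    (Homeomorph.subLeft x).measurableEmbedding).2 h1
  refine h2.mono_set fun y hy => ?_
  have := hR hy
  rw [Metric.mem_ball, dist_comm, dist_eq_norm] at this
  simpa using this

lemma inv_rpow_mul_norm {α : ℝ} (z : R2) :
    (‖z‖ ^ (2 + 2 * α))⁻¹ * ‖z‖ ≤ ‖z‖ ^ (-(1 + 2 * α)) := by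
  rcases eq_or_ne z 0 with rfl | hz
  · simp only [norm_zero, mul_zero]; positivity
  · have h0 : 0 < ‖z‖ := norm_pos_iff.2 hz
    rw [← Real.rpow_neg h0.le]
    nth_rw 2 [← Real.rpow_one ‖z‖]
    rw [← Real.rpow_add h0]
    exact (congrArg _ (by ring)).le

lemma integrableOn_sqgKernel {α : ℝ} (hα : α < 1 / 2) {Ω : Set R2} (hΩ : IsBounded Ω) (x : R2) :
    IntegrableOn (fun y => (‖x - y‖ ^ (2 + 2 * α))⁻¹ • perp (x - y)) Ω := by
  refine Integrable.mono' (integrableOn_norm_sub_rpow (r := 1 + 2 * α) (by linarith) hΩ x)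
    ?_ (Eventually.of_forall fun y => ?_)
  · have : Measurable fun y : R2 => perp (x - y) := (by fun_prop : Continuous _).measurable
    exact (Measurable.smul ((by fun_prop : Continuous fun y : R2 =>
      ‖x - y‖).measurable.pow_const _).inv this).aestronglyMeasurable
  · rw [norm_smul, norm_perp, Real.norm_of_nonneg (by positivity)]
    exact inv_rpow_mul_norm _

lemma tendsto_regVelocity {α : ℝ} (hα0 : 0 < α) (hα : α < 1 / 2) {Ω : Set R2}
    (hΩ : IsBounded Ω) (x μ : R2) :
    Tendsto (fun ε => ∫ y in Ω, regWeight α ε (x - y) * ⟪μ, perp (x - y)⟫) (𝓝[≠] 0)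
      (𝓝 ⟪μ, sqgVelocity α Ω x⟫) := by
  rw [sqgVelocity, ← integral_inner (integrableOn_sqgKernel hα hΩ x)]
  refine tendsto_integral_filter_of_dominated_convergence
    (fun y => ‖μ‖ * ‖x - y‖ ^ (-(1 + 2 * α))) ?_ ?_
    ((integrableOn_norm_sub_rpow (by linarith) hΩ x).const_mul _) ?_
  · filter_upwards [self_mem_nhdsWithin] with ε hε
    have := continuous_regWeight α hε
    exact (by fun_prop : Continuous _).aestronglyMeasurable
  · refine Eventually.of_forall fun ε => Eventually.of_forall fun y => ?_
    rw [norm_mul, Real.norm_of_nonneg (regWeight_nonneg _ _ _)]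
    have h1 := norm_inner_le_norm (𝕜 := ℝ) μ (perp (x - y))
    rw [norm_perp] at h1
    rcases eq_or_ne (x - y) 0 with h0 | h0
    · have : ⟪μ, perp (x - y)⟫ = 0 := by simpa [h0] using h1
      rw [this]; simp; positivity
    · calc _ ≤ (‖x - y‖ ^ (2 + 2 * α))⁻¹ * (‖μ‖ * ‖x - y‖) :=
            mul_le_mul (regWeight_le hα0 ε h0) h1 (norm_nonneg _) (by positivity)
        _ = ‖μ‖ * ((‖x - y‖ ^ (2 + 2 * α))⁻¹ * ‖x - y‖) := by ring
        _ ≤ _ := by gcongr; exact inv_rpow_mul_norm _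
  · refine Eventually.of_forall fun y => ?_
    simp only [inner_smul_right]
    rcases eq_or_ne (x - y) 0 with h0 | h0
    · have : perp (x - y) = 0 := by rw [← norm_eq_zero, norm_perp, h0, norm_zero]
      simp [this]
    · exact (tendsto_regWeight α h0).mul_const _

lemma intervalIntegrable_abs_rpow {r : ℝ} (hr : -1 < r) (a b : ℝ) :
    IntervalIntegrable (fun u : ℝ => |u| ^ r) volume a b := by
  have h0 : ∀ c, 0 ≤ c → IntervalIntegrable (fun u : ℝ => |u| ^ r) volume 0 c := fun c hc => by
    refine (intervalIntegral.intervalIntegrable_rpow' hr).congr fun u hu => ?_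
    rw [uIoc_of_le hc] at hu
    simp only [abs_of_pos hu.1]
  have h1 : ∀ c, IntervalIntegrable (fun u : ℝ => |u| ^ r) volume 0 c := fun c => by
    rcases le_total 0 c with hc | hc
    · exact h0 c hc
    · rw [IntervalIntegrable.iff_comp_neg]
      simpa using h0 (-c) (by linarith)
  exact (h1 a).symm.trans (h1 b)

/-- A regular loop of class `C^{1,β}` satisfying a chord-arc condition. -/
structure IsHolderLoop (β κ M : ℝ) (γ P : ℝ → R2) : Prop extends IsRegularLoop γ P where
  pos : 0 < κ
  norm_deriv_le : ∀ x, ‖P x‖ ≤ M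
  holder : ∀ x y, ‖P x - P y‖ ≤ M * |x - y| ^ β
  chord : ∀ x u, |u| ≤ π → κ * |u| ≤ ‖γ (x + u) - γ x‖

/-- The integrand of the stretching of the tangent. -/
def stretchKernel (α : ℝ) (γ P : ℝ → R2) (x u : ℝ) : R2 :=
  (‖γ (x + u) - γ x‖ ^ (2 + 2 * α))⁻¹ • cross (P x) (P (x + u)) • perp (γ (x + u) - γ x)

/-- The tangential derivative of the velocity, up to the orientation of the loop. -/
def stretching (α : ℝ) (γ P : ℝ → R2) (x : ℝ) : R2 := ∫ u in (-π)..π, stretchKernel α γ P x u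

namespace IsHolderLoop

variable {α β κ M : ℝ} {γ P : ℝ → R2}

lemma norm_sub_le (h : IsHolderLoop β κ M γ P) (x y : ℝ) : ‖γ y - γ x‖ ≤ M * |y - x| := by
  have := convex_univ.norm_image_sub_le_of_norm_hasDerivWithin_le (f := γ) (f' := P) (C := M)
    (fun z _ => (h.hasDerivAt z).hasDerivWithinAt) (fun z _ => h.norm_deriv_le z)
    (mem_univ x) (mem_univ y)
  simpa using this

lemma bound_nonneg (h : IsHolderLoop β κ M γ P) : 0 ≤ M := (norm_nonneg _).trans (h.norm_deriv_le 0)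

lemma abs_cross_le (h : IsHolderLoop β κ M γ P) (x u : ℝ) :
    |cross (P x) (P (x + u))| ≤ M * (M * |u| ^ β) := by
  have e : cross (P x) (P (x + u)) = cross (P x) (P (x + u) - P x) := by
    rw [cross_sub_right, cross_same, sub_zero]
  have h1 := h.holder (x + u) x
  rw [add_sub_cancel_left] at h1
  rw [e]
  exact (_root_.abs_cross_le _ _).trans
    (mul_le_mul (h.norm_deriv_le x) h1 (norm_nonneg _) h.bound_nonneg)

lemma inv_rpow_le (h : IsHolderLoop β κ M γ P) (hα : 0 < α) {x u : ℝ} (hu : |u| ≤ π) (hu0 : u ≠ 0) :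
    (‖γ (x + u) - γ x‖ ^ (2 + 2 * α))⁻¹ ≤ (κ ^ (2 + 2 * α))⁻¹ * |u| ^ (-(2 + 2 * α)) := by
  have hu1 : 0 < |u| := abs_pos.2 hu0
  rw [Real.rpow_neg hu1.le, ← mul_inv, ← Real.mul_rpow h.pos.le hu1.le]
  have hk := h.pos
  exact inv_anti₀ (by positivity)
    (Real.rpow_le_rpow (by positivity) (h.chord x u hu) (by linarith))

lemma chord_ne_zero (h : IsHolderLoop β κ M γ P) {x u : ℝ} (hu : |u| ≤ π) (hu0 : u ≠ 0) :
    γ (x + u) - γ x ≠ 0 := by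
  have := h.chord x u hu
  have hu1 : 0 < |u| := abs_pos.2 hu0
  have := mul_pos h.pos hu1
  rw [← norm_pos_iff]; linarith

lemma weight_mul_le (h : IsHolderLoop β κ M γ P) (hα : 0 < α) {x u w : ℝ} (hu : |u| ≤ π)
    (hu0 : u ≠ 0) (hw : w ≤ (‖γ (x + u) - γ x‖ ^ (2 + 2 * α))⁻¹) :
    w * (|cross (P x) (P (x + u))| * ‖γ (x + u) - γ x‖) ≤
      (κ ^ (2 + 2 * α))⁻¹ * M ^ 3 * |u| ^ (β - 1 - 2 * α) := by
  have hu1 : 0 < |u| := abs_pos.2 hu0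
  have hM := h.bound_nonneg
  have hk := h.pos
  have h1 := h.norm_sub_le x (x + u)
  rw [add_sub_cancel_left] at h1
  calc _ ≤ ((κ ^ (2 + 2 * α))⁻¹ * |u| ^ (-(2 + 2 * α))) * ((M * (M * |u| ^ β)) * (M * |u|)) :=
        mul_le_mul (hw.trans (h.inv_rpow_le hα hu hu0)) (mul_le_mul (h.abs_cross_le x u) h1
          (norm_nonneg _) (by positivity)) (by positivity) (by positivity)
    _ = (κ ^ (2 + 2 * α))⁻¹ * M ^ 3 * (|u| ^ (-(2 + 2 * α)) * |u| ^ β * |u| ^ (1:ℝ)) := by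
        rw [Real.rpow_one]; ring
    _ = _ := by
        rw [← Real.rpow_add hu1, ← Real.rpow_add hu1]; congr 2; ring

lemma norm_stretchKernel_le (h : IsHolderLoop β κ M γ P) (hα : 0 < α) {x u : ℝ} (hu : |u| ≤ π)
    (hu0 : u ≠ 0) :
    ‖stretchKernel α γ P x u‖ ≤ (κ ^ (2 + 2 * α))⁻¹ * M ^ 3 * |u| ^ (β - 1 - 2 * α) := by
  rw [stretchKernel, norm_smul, norm_smul, norm_perp, Real.norm_of_nonneg (by positivity),
    Real.norm_eq_abs]
  exact h.weight_mul_le hα hu hu0 le_rfl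

end IsHolderLoop

lemma abs_le_of_mem_uIoc_pi {u : ℝ} (hu : u ∈ uIoc (-π) π) : |u| ≤ π := by
  rw [uIoc_of_le (by linarith [pi_pos])] at hu
  exact abs_le.2 ⟨hu.1.le, hu.2⟩

lemma ae_ne_zero : ∀ᵐ u : ℝ, u ≠ 0 := by
  simp [ae_iff, measure_singleton]

lemma measurable_stretchKernel {γ P : ℝ → R2} (α : ℝ) (hγ : Continuous γ) (hP : Continuous P)
    (x : ℝ) : Measurable (stretchKernel α γ P x) := by
  have h1 : Measurable fun u => ‖γ (x + u) - γ x‖ ^ (2 + 2 * α) :=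
    ((by fun_prop : Continuous fun u => ‖γ (x + u) - γ x‖).measurable).pow_const _
  have h2 : Measurable fun u => cross (P x) (P (x + u)) • perp (γ (x + u) - γ x) :=
    (by fun_prop : Continuous _).measurable
  exact h1.inv.smul h2

lemma continuous_stretching {X : Type*} [TopologicalSpace X] [FirstCountableTopology X]
    {α β κ M : ℝ} (hα : 0 < α) (hβ : 2 * α < β) {γ P : ℝ → X → R2}
    (hγ : Continuous (uncurry γ)) (hP : Continuous (uncurry P))
    (h : ∀ t, IsHolderLoop β κ M (γ · t) (P · t)) :
    Continuous fun p : ℝ × X => stretching α (γ · p.2) (P · p.2) p.1 := by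
  unfold stretching
  refine intervalIntegral.continuous_of_dominated_interval
    (bound := fun u => (κ ^ (2 + 2 * α))⁻¹ * M ^ 3 * |u| ^ (β - 1 - 2 * α)) (fun p => ?_)
    (fun p => ?_) ((intervalIntegrable_abs_rpow (by linarith) _ _).const_mul _) ?_
  · exact (measurable_stretchKernel α (h p.2).continuous (h p.2).continuous_deriv
      p.1).aestronglyMeasurable
  · filter_upwards [ae_ne_zero] with u hu0 hu
    exact (h p.2).norm_stretchKernel_le hα (abs_le_of_mem_uIoc_pi hu) hu0
  · filter_upwards [ae_ne_zero] with u hu0 hu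
    have e1 : Continuous fun p : ℝ × X => γ (p.1 + u) p.2 :=
      hγ.comp (by fun_prop : Continuous fun p : ℝ × X => (p.1 + u, p.2))
    have e2 : Continuous fun p : ℝ × X => P (p.1 + u) p.2 :=
      hP.comp (by fun_prop : Continuous fun p : ℝ × X => (p.1 + u, p.2))
    have e3 : Continuous fun p : ℝ × X => γ p.1 p.2 := hγ
    have e4 : Continuous fun p : ℝ × X => P p.1 p.2 := hP
    have hne : ∀ p : ℝ × X, ‖γ (p.1 + u) p.2 - γ p.1 p.2‖ ≠ 0 := fun p =>
      norm_ne_zero_iff.2 ((h p.2).chord_ne_zero (abs_le_of_mem_uIoc_pi hu) hu0)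
    unfold stretchKernel
    refine Continuous.smul (Continuous.inv₀ (Continuous.rpow_const (by fun_prop)
      fun p => Or.inl (hne p)) fun p => ?_) (by fun_prop)
    exact (Real.rpow_pos_of_pos ((norm_nonneg _).lt_of_ne' (hne p)) _).ne'

namespace IsHolderLoop

variable {α β κ M : ℝ} {γ P : ℝ → R2}

lemma continuous_stretching (h : IsHolderLoop β κ M γ P) (hα : 0 < α) (hβ : 2 * α < β) :
    Continuous (stretching α γ P) := by
  have hγ := h.continuous
  have hP := h.continuous_deriv
  have := _root_.continuous_stretching (X := Unit) hα hβ (γ := fun x _ => γ x) (P := fun x _ => P x)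
    (by unfold uncurry; fun_prop) (by unfold uncurry; fun_prop) (κ := κ) (M := M) (fun _ => h)
  simpa only [comp_def] using this.comp (Continuous.prodMk_left ())

lemma intervalIntegrable_stretchKernel (h : IsHolderLoop β κ M γ P) (hα : 0 < α)
    (hβ : 2 * α < β) (x : ℝ) :
    IntervalIntegrable (stretchKernel α γ P x) volume (-π) π := by
  have hb : IntervalIntegrable
      (fun u : ℝ => (κ ^ (2 + 2 * α))⁻¹ * M ^ 3 * |u| ^ (β - 1 - 2 * α)) volume (-π) π :=
    (intervalIntegrable_abs_rpow (by linarith) _ _).const_mul _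
  refine hb.mono_fun'
    (measurable_stretchKernel α h.continuous h.continuous_deriv x).aestronglyMeasurable ?_
  filter_upwards [ae_restrict_mem measurableSet_uIoc, ae_restrict_of_ae ae_ne_zero] with u hu hu0
  exact h.norm_stretchKernel_le hα (abs_le_of_mem_uIoc_pi hu) hu0

lemma tendsto_regStretching (h : IsHolderLoop β κ M γ P) (hα : 0 < α) (hβ : 2 * α < β)
    (a b : ℝ) (μ : R2) :
    Tendsto (fun ε => ∫ x in a..b, ∫ u in (-π)..π, regWeight α ε (γ (x + u) - γ x) *
      (cross (P x) (P (x + u)) * ⟪perp (γ (x + u) - γ x), μ⟫)) (𝓝[≠] 0)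
      (𝓝 (∫ x in a..b, ⟪μ, stretching α γ P x⟫)) := by
  have hγ := h.continuous
  have hP := h.continuous_deriv
  set K : ℝ := (κ ^ (2 + 2 * α))⁻¹ * M ^ 3 * ‖μ‖ with hK
  have hint : IntervalIntegrable (fun u : ℝ => K * |u| ^ (β - 1 - 2 * α)) volume (-π) π :=
    (intervalIntegrable_abs_rpow (by linarith) _ _).const_mul _
  have hpi : -π ≤ π := by linarith [pi_pos]
  have hbound : ∀ ε x u, |u| ≤ π → u ≠ 0 → ‖regWeight α ε (γ (x + u) - γ x) *
      (cross (P x) (P (x + u)) * ⟪perp (γ (x + u) - γ x), μ⟫)‖ ≤ K * |u| ^ (β - 1 - 2 * α) := by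
    intro ε x u hu hu0
    have h1 := h.weight_mul_le hα hu hu0 (regWeight_le hα ε (h.chord_ne_zero (x := x) hu hu0))
    have h2 := norm_inner_le_norm (𝕜 := ℝ) (perp (γ (x + u) - γ x)) μ
    rw [norm_perp] at h2
    rw [norm_mul, norm_mul, Real.norm_of_nonneg (regWeight_nonneg _ _ _), Real.norm_eq_abs (cross _ _)]
    calc _ ≤ regWeight α ε (γ (x + u) - γ x) * (|cross (P x) (P (x + u))| *
          (‖γ (x + u) - γ x‖ * ‖μ‖)) := by
          gcongr; exact regWeight_nonneg _ _ _
      _ = regWeight α ε (γ (x + u) - γ x) * (|cross (P x) (P (x + u))| *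
          ‖γ (x + u) - γ x‖) * ‖μ‖ := by ring
      _ ≤ (κ ^ (2 + 2 * α))⁻¹ * M ^ 3 * |u| ^ (β - 1 - 2 * α) * ‖μ‖ := by gcongr
      _ = _ := by rw [hK]; ring
  refine intervalIntegral.tendsto_integral_filter_of_dominated_convergence
    (fun _ => ∫ u in (-π)..π, K * |u| ^ (β - 1 - 2 * α)) ?_ ?_ intervalIntegrable_const ?_
  · filter_upwards [self_mem_nhdsWithin] with ε hε
    have := continuous_regWeight α hε
    refine Continuous.aestronglyMeasurable ?_
    refine intervalIntegral.continuous_parametric_intervalIntegral_of_continuous' ?_ _ _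
    unfold uncurry; fun_prop
  · refine Eventually.of_forall fun ε => Eventually.of_forall fun x _ => ?_
    refine intervalIntegral.norm_integral_le_of_norm_le hpi ?_ hint
    filter_upwards [ae_ne_zero] with u hu0 hu
    exact hbound ε x u (abs_le_of_mem_uIoc_pi (by rwa [uIoc_of_le hpi])) hu0
  · refine Eventually.of_forall fun x _ => ?_
    have e : ⟪μ, stretching α γ P x⟫ = ∫ u in (-π)..π, ⟪μ, stretchKernel α γ P x u⟫ := by
      have := (innerSL ℝ μ).intervalIntegral_comp_comm
        (h.intervalIntegrable_stretchKernel hα hβ x)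
      simpa [stretching] using this.symm
    rw [e]
    refine intervalIntegral.tendsto_integral_filter_of_dominated_convergence
      (fun u => K * |u| ^ (β - 1 - 2 * α)) ?_ ?_ hint ?_
    · filter_upwards [self_mem_nhdsWithin] with ε hε
      have := continuous_regWeight α hε
      exact (by fun_prop : Continuous _).aestronglyMeasurable
    · refine Eventually.of_forall fun ε => ?_
      filter_upwards [ae_ne_zero] with u hu0 hu
      exact hbound ε x u (abs_le_of_mem_uIoc_pi hu) hu0
    · filter_upwards [ae_ne_zero] with u hu0 hu
      have := (tendsto_regWeight α (h.chord_ne_zero (x := x) (abs_le_of_mem_uIoc_pi hu) hu0)).mul_const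
        (cross (P x) (P (x + u)) * ⟪perp (γ (x + u) - γ x), μ⟫)
      convert this using 2
      rw [stretchKernel, inner_smul_right, inner_smul_right, real_inner_comm]

/-- The difference of boundary velocities is the integral of the stretching. -/
lemma velocity_sub (h : IsHolderLoop β κ M γ P) (hα0 : 0 < α) (hα : α < 1 / 2) (hβ : 2 * α < β)
    {Ω : Set R2} (hΩ : IsBounded Ω) {c : ℝ}
    (hG : ∀ φ : R2 → ℝ, ContDiff ℝ 1 φ → ∀ μ : R2,
      ∫ y in Ω, fderiv ℝ φ y μ = c * ∫ x in (0:ℝ)..2 * π, φ (γ x) * cross μ (P x)) (a b : ℝ) :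
    sqgVelocity α Ω (γ b) - sqgVelocity α Ω (γ a) = c • ∫ x in a..b, stretching α γ P x := by
  refine ext_inner_left ℝ fun μ => ?_
  have hlim := (tendsto_regVelocity hα0 hα hΩ (γ b) μ).sub (tendsto_regVelocity hα0 hα hΩ (γ a) μ)
  have hlim' := (h.tendsto_regStretching hα0 hβ a b μ).const_mul c
  rw [inner_sub_right, inner_smul_right]
  have e : ⟪μ, ∫ x in a..b, stretching α γ P x⟫ = ∫ x in a..b, ⟪μ, stretching α γ P x⟫ := by
    have := (innerSL ℝ μ).intervalIntegral_comp_comm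
      ((h.continuous_stretching hα0 hβ).intervalIntegrable (μ := volume) a b)
    simpa using this.symm
  rw [e]
  refine tendsto_nhds_unique (hlim.congr' ?_) hlim'
  filter_upwards [self_mem_nhdsWithin] with ε hε
  have h1 := IsRegularLoop.integral_regWeight hG α hε (γ b) μ
  have h2 := IsRegularLoop.integral_regWeight hG α hε (γ a) μ
  have h3 := h.regPotential_sub α hε a b μ
  have h4 : (2 * α) ≠ 0 := by positivity
  apply mul_left_cancel₀ h4
  rw [mul_sub, h1, h2, ← mul_sub, h3]
  ring

end IsHolderLoop

/-! ### Families of loops depending on time -/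

lemma norm_slope_sub_le {γ P : ℝ → R2} {β M : ℝ} (hβ : 0 ≤ β) (hM : 0 ≤ M)
    (hd : ∀ x, HasDerivAt γ (P x) x) (hH : ∀ x y, ‖P x - P y‖ ≤ M * |x - y| ^ β) {δ : ℝ}
    (hδ : 0 < δ) (x : ℝ) : ‖δ⁻¹ • (γ (x + δ) - γ x) - P x‖ ≤ M * δ ^ β := by
  have h1 := (convex_Icc x (x + δ)).norm_image_sub_le_of_norm_hasDerivWithin_le
    (f := fun y => γ y - y • P x) (f' := fun y => P y - P x) (C := M * δ ^ β)
    (fun y _ => by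
      have := (hd y).sub ((hasDerivAt_id y).smul_const (P x))
      rw [one_smul] at this
      exact this.hasDerivWithinAt)
    (fun y hy => by
      refine (hH y x).trans ?_
      have : |y - x| ≤ δ := abs_le.2 ⟨by linarith [hy.1], by linarith [hy.2]⟩
      gcongr)
    (left_mem_Icc.2 (by linarith)) (right_mem_Icc.2 (by linarith))
  have e : δ⁻¹ • (γ (x + δ) - γ x) - P x =
      δ⁻¹ • (γ (x + δ) - (x + δ) • P x - (γ x - x • P x)) := by
    have : P x = δ⁻¹ • δ • P x := by rw [smul_smul, inv_mul_cancel₀ hδ.ne', one_smul]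
    nth_rw 1 [this]
    rw [← smul_sub, add_smul]; congr 1; abel
  rw [e, norm_smul, Real.norm_of_nonneg (by positivity), inv_mul_le_iff₀ hδ]
  refine h1.trans (le_of_eq ?_)
  rw [add_sub_cancel_left, Real.norm_of_nonneg hδ.le]; ring

lemma continuous_deriv_of_holder {γ P : ℝ → ℝ → R2} {β M : ℝ} (hβ : 0 < β) (hM : 0 ≤ M)
    (hγ : Continuous (uncurry γ)) (hd : ∀ t x, HasDerivAt (γ · t) (P x t) x)
    (hH : ∀ t x y, ‖P x t - P y t‖ ≤ M * |x - y| ^ β) : Continuous (uncurry P) := by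
  have hu : TendstoUniformly (fun (δ : ℝ) (p : ℝ × ℝ) => δ⁻¹ • (γ (p.1 + δ) p.2 - γ p.1 p.2))
      (uncurry P) (𝓝[>] 0) := by
    rw [Metric.tendstoUniformly_iff]
    intro ε hε
    have h0 : Tendsto (fun δ : ℝ => M * δ ^ β) (𝓝[>] 0) (𝓝 0) := by
      have : ContinuousAt (fun δ : ℝ => M * δ ^ β) 0 :=
        (continuousAt_const.mul (Real.continuousAt_rpow_const 0 β (Or.inr hβ.le)))
      have h := this.tendsto
      rw [Real.zero_rpow hβ.ne', mul_zero] at h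
      exact h.mono_left nhdsWithin_le_nhds
    filter_upwards [h0.eventually_lt_const hε, self_mem_nhdsWithin] with δ h1 h2 p
    rw [dist_comm, dist_eq_norm]
    exact (norm_slope_sub_le hβ.le hM (hd p.2) (hH p.2) h2 p.1).trans_lt h1
  refine hu.continuous (Frequently.of_forall fun δ => ?_)
  have h1 : Continuous fun p : ℝ × ℝ => γ (p.1 + δ) p.2 :=
    hγ.comp (by fun_prop : Continuous fun p : ℝ × ℝ => (p.1 + δ, p.2))
  have h2 : Continuous fun p : ℝ × ℝ => γ p.1 p.2 := hγ
  fun_prop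

/-- The mean of the tangent over `[x, x + u]`. -/
def meanTangent (P : ℝ → R2) (x u : ℝ) : R2 := ∫ s in (0:ℝ)..1, P (x + s * u)

lemma smul_meanTangent {γ P : ℝ → R2} (hP : Continuous P) (hd : ∀ x, HasDerivAt γ (P x) x)
    (x u : ℝ) : u • meanTangent P x u = γ (x + u) - γ x := by
  rw [meanTangent, ← intervalIntegral.integral_smul,
    intervalIntegral.integral_eq_sub_of_hasDerivAt (f := fun s => γ (x + s * u)) (fun s _ => ?_)
    (Continuous.intervalIntegrable (by fun_prop) _ _)]
  · simp
  · have h1 : HasDerivAt (fun s : ℝ => x + s * u) u s := by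
      simpa using ((hasDerivAt_id s).mul_const u).const_add x
    exact (hd (x + s * u)).scomp s h1

lemma continuous_meanTangent {P : ℝ → ℝ → R2} (hP : Continuous (uncurry P)) :
    Continuous fun q : ℝ × ℝ × ℝ => meanTangent (P · q.2.2) q.1 q.2.1 := by
  unfold meanTangent
  refine intervalIntegral.continuous_parametric_intervalIntegral_of_continuous' ?_ _ _
  exact hP.comp (by fun_prop : Continuous fun r : (ℝ × ℝ × ℝ) × ℝ =>
    (r.1.1 + r.2 * r.1.2.1, r.1.2.2))

lemma exists_chordArc {γ P : ℝ → ℝ → R2} (hP : Continuous (uncurry P))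
    (h : ∀ t, IsRegularLoop (γ · t) (P · t)) {S : Set ℝ} (hS : IsCompact S) :
    ∃ κ > 0, ∀ t ∈ S, ∀ x u, |u| ≤ π → κ * |u| ≤ ‖γ (x + u) t - γ x t‖ := by
  have hQ := continuous_meanTangent hP
  have hne : ∀ t x u, |u| ≤ π → meanTangent (P · t) x u ≠ 0 := fun t x u hu h0 => by
    rcases eq_or_ne u 0 with rfl | hu0
    · simp only [meanTangent, mul_zero, add_zero, intervalIntegral.integral_const, sub_zero,
        one_smul] at h0
      exact (h t).deriv_ne_zero x h0
    · have e := smul_meanTangent (h t).continuous_deriv (h t).hasDerivAt x u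
      rw [h0, smul_zero] at e
      have := (h t).eq_of_abs_sub_lt (x := x + u) (y := x)
        (by rw [add_sub_cancel_left]; linarith [pi_pos]) (sub_eq_zero.1 e.symm)
      exact hu0 (by linarith)
  have hK : IsCompact (Icc (0:ℝ) (2 * π) ×ˢ Icc (-π) π ×ˢ S) :=
    isCompact_Icc.prod (isCompact_Icc.prod hS)
  have key : ∃ κ > 0, ∀ t ∈ S, ∀ x ∈ Icc (0:ℝ) (2 * π), ∀ u, |u| ≤ π →
      κ ≤ ‖meanTangent (P · t) x u‖ := by
    rcases (Icc (0:ℝ) (2 * π) ×ˢ Icc (-π) π ×ˢ S).eq_empty_or_nonempty with he | hn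
    · refine ⟨1, one_pos, fun t ht x hx u hu => ?_⟩
      have : (x, u, t) ∈ (Icc (0:ℝ) (2 * π) ×ˢ Icc (-π) π ×ˢ S) := ⟨hx, abs_le.1 hu, ht⟩
      rw [he] at this; exact this.elim
    · obtain ⟨q, hq, hmin⟩ := hK.exists_isMinOn hn hQ.norm.continuousOn
      refine ⟨_, norm_pos_iff.2 (hne q.2.2 q.1 q.2.1 (abs_le.2 hq.2.1)),
        fun t ht x hx u hu => ?_⟩
      have := isMinOn_iff.1 hmin (x, u, t) ⟨hx, abs_le.1 hu, ht⟩
      simpa only using this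
  obtain ⟨κ, hκ, hmin⟩ := key
  refine ⟨κ, hκ, fun t ht x u hu => ?_⟩
  have hper : ∃ y ∈ Icc (0:ℝ) (2 * π), γ (x + u) t - γ x t = γ (y + u) t - γ y t := by
    refine ⟨toIcoMod two_pi_pos 0 x, ?_, ?_⟩
    · have := toIcoMod_mem_Ico two_pi_pos 0 x
      rw [zero_add] at this
      exact ⟨this.1, this.2.le⟩
    · have e1 := (h t).periodic.sub_zsmul_eq (x := x) (toIcoDiv two_pi_pos 0 x)
      have e2 := (h t).periodic.sub_zsmul_eq (x := x + u) (toIcoDiv two_pi_pos 0 x)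
      rw [toIcoMod, e1, ← e2]; congr 3; ring
  obtain ⟨y, hy, e⟩ := hper
  rw [e, ← smul_meanTangent (h t).continuous_deriv (h t).hasDerivAt y u, norm_smul,
    Real.norm_eq_abs, mul_comm]
  exact mul_le_mul_of_nonneg_left (hmin t ht y hy u hu) (abs_nonneg _)

/-- A continuous family of `C^{1,β}` loops of constant orientation `c`, the tangent of which evolves
by the stretching of its own velocity field. -/
structure IsHolderEvolution (α β κ M c T : ℝ) (γ P : ℝ → ℝ → R2) : Prop where
  continuous : Continuous (uncurry γ)
  continuous_deriv : Continuous (uncurry P)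
  loop : ∀ t, IsHolderLoop β κ M (γ · t) (P · t)
  orientation : c = -1 ∨ c = 1
  area_pos : ∀ t, 0 < c * ∫ x in (0:ℝ)..2 * π, γ x t 0 * P x t 1
  deriv_eq : ∀ t ∈ Icc (0:ℝ) T, ∀ x,
    P x t = P x 0 + c • ∫ τ in (0:ℝ)..t, stretching α (γ · τ) (P · τ) x

lemma exists_holderEvolution {α β T : ℝ} (hα0 : 0 < α) (hα : α < 1 / 2) (hβ : 2 * α < β)
    (hT : 0 ≤ T) {Ω : ℝ → Set R2} {γ : ℝ → ℝ → R2} (hΩ : IsPatchSol α T Ω)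
    (hγ : IsC1BetaFlow α β T Ω γ) :
    ∃ κ M c γ' P', IsHolderEvolution α β κ M c T γ' P' ∧
      ∀ t ∈ Icc (0:ℝ) T, ∀ x, P' x t = pderiv γ x t := by
  obtain ⟨⟨hpar, hflow⟩, M, hM⟩ := hγ
  obtain ⟨hdom, -⟩ := hΩ
  set σ : ℝ → ℝ := fun t => (projIcc 0 T hT t : ℝ) with hσ
  have hσm : ∀ t, σ t ∈ Icc (0:ℝ) T := fun t => (projIcc 0 T hT t).2
  have hσc : Continuous σ := continuous_subtype_val.comp continuous_projIcc
  have hσe : ∀ t ∈ Icc (0:ℝ) T, σ t = t := fun t ht => by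
    simp only [hσ, projIcc_of_mem hT ht]
  have hσσ : ∀ t, σ (σ t) = σ t := fun t => hσe _ (hσm t)
  set G : ℝ → ℝ → R2 := fun x t => γ x (σ t) with hG
  set P : ℝ → ℝ → R2 := fun x t => pderiv γ x (σ t) with hPdef
  have hM0 : 0 ≤ M := (norm_nonneg _).trans (hM 0 ⟨le_rfl, hT⟩ 0 0).1
  have hd : ∀ t x, HasDerivAt (G · t) (P x t) x := fun t x =>
    ((hpar _ (hσm t)).2.1.differentiable one_ne_zero x).hasDerivAt
  have hPn : ∀ t x, ‖P x t‖ ≤ M := fun t x => (hM _ (hσm t) x x).2.1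
  have hPH : ∀ t x y, ‖P x t - P y t‖ ≤ M * |x - y| ^ β := fun t x y => (hM _ (hσm t) x y).2.2
  have hGt : ∀ x, Continuous (G x) := fun x => by
    have h1 : ContinuousOn (γ x) (Icc 0 T) := fun t ht => (hflow x t ht).continuousWithinAt
    exact h1.comp_continuous hσc hσm
  have hGc : Continuous (uncurry G) := by
    refine continuous_prod_of_continuous_lipschitzWith _ M.toNNReal hGt fun t => ?_
    have hl : LipschitzWith M.toNNReal (G · t) :=
      lipschitzWith_of_nnnorm_deriv_le (fun x => (hd t x).differentiableAt) fun x => by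
        rw [(hd t x).deriv, ← NNReal.coe_le_coe, Real.coe_toNNReal M hM0]; exact hPn t x
    exact hl
  have hPc : Continuous (uncurry P) := continuous_deriv_of_holder (by linarith) hM0 hGc hd hPH
  have hloop : ∀ t, IsRegularLoop (G · t) (P · t) := fun t =>
    { periodic := (hpar _ (hσm t)).1
      hasDerivAt := hd t
      continuous_deriv := hPc.comp (Continuous.prodMk_left t)
      injOn := (hpar _ (hσm t)).2.2.1
      deriv_ne_zero := (hpar _ (hσm t)).2.2.2.1 }
  obtain ⟨κ, hκ, hchord⟩ := exists_chordArc hPc hloop (isCompact_Icc (a := (0:ℝ)) (b := T))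
  have hH : ∀ t, IsHolderLoop β κ M (G · t) (P · t) := fun t =>
    { hloop t with
      pos := hκ
      norm_deriv_le := hPn t
      holder := hPH t
      chord := fun x u hu => by
        have := hchord (σ t) (hσm t) x u hu
        simpa only [hG, hσσ] using this }
  have hgreen : ∀ t, _ := fun t => (hloop t).exists_green (hdom _ (hσm t)).1 (hdom _ (hσm t)).2.1
    (hdom _ (hσm t)).2.2.nonempty (hpar _ (hσm t)).2.2.2.2
  choose c hc1 harea hgr using hgreen
  have hcoord : ∀ i : Fin 2, Continuous fun z : R2 => z i := fun i => by fun_prop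
  have hAc : Continuous fun t => ∫ x in (0:ℝ)..2 * π, G x t 0 * P x t 1 := by
    refine intervalIntegral.continuous_parametric_intervalIntegral_of_continuous' ?_ _ _
    exact ((hcoord 0).comp (hGc.comp continuous_swap)).mul
      ((hcoord 1).comp (hPc.comp continuous_swap))
  have hcc : ∀ t, c t = c 0 := fun t => by
    by_contra hne
    have h0 : ∃ s, (∫ x in (0:ℝ)..2 * π, G x s 0 * P x s 1) = 0 := by
      have a0 := harea 0
      have at' := harea t
      rcases hc1 t with e | e <;> rcases hc1 0 with e0 | e0 <;> rw [e] at at' <;> rw [e0] at a0 <;>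
        first
        | exact absurd (e.trans e0.symm) hne
        | exact mem_range_of_exists_le_of_exists_ge hAc ⟨t, by linarith⟩ ⟨0, by linarith⟩
        | exact mem_range_of_exists_le_of_exists_ge hAc ⟨0, by linarith⟩ ⟨t, by linarith⟩
    obtain ⟨s, hs⟩ := h0
    have := harea s
    rw [hs, mul_zero] at this
    exact lt_irrefl _ this
  obtain ⟨S, hS⟩ : ∃ S : ℝ → ℝ → R2, ∀ x t, S x t = stretching α (G · t) (P · t) x :=
    ⟨_, fun _ _ => rfl⟩
  have hSc : Continuous (uncurry S) := by
    have := continuous_stretching hα0 hβ hGc hPc hH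
    simp_rw [← hS] at this
    exact this
  have hdiff : ∀ t ∈ Icc (0:ℝ) T, ∀ b, G b t - G 0 t = G b 0 - G 0 0 +
      c 0 • ∫ x in (0:ℝ)..b, ∫ τ in (0:ℝ)..t, S x τ := by
    intro t ht b
    have hcont : Continuous fun τ => c 0 • ∫ x in (0:ℝ)..b, S x τ := by
      have hc' : Continuous fun τ => ∫ x in (0:ℝ)..b, S x τ := by
        refine intervalIntegral.continuous_parametric_intervalIntegral_of_continuous' ?_ _ _
        exact hSc.comp continuous_swap
      exact (continuous_const (y := c 0)).smul hc'
    have h1 := intervalIntegral.integral_eq_sub_of_hasDerivAt_of_le ht.1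
      (f := fun τ => G b τ - G 0 τ)
      (f' := fun τ => c 0 • ∫ x in (0:ℝ)..b, S x τ)
      ((hGt b).sub (hGt 0)).continuousOn (fun τ hτ => ?_) (hcont.intervalIntegrable _ _)
    · rw [intervalIntegral.integral_smul, integral_swap_of_continuous
        (f := fun τ x => S x τ) (hSc.comp continuous_swap)] at h1
      rw [h1]; abel
    · have hτT : τ ∈ Icc (0:ℝ) T := ⟨hτ.1.le, hτ.2.le.trans ht.2⟩
      have hnh : Icc (0:ℝ) T ∈ 𝓝 τ := Icc_mem_nhds hτ.1 (hτ.2.trans_le ht.2)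
      have hvel := (hH τ).velocity_sub hα0 hα hβ (hdom _ (hσm τ)).2.1 (hgr τ) 0 b
      simp only [hcc τ, ← hS] at hvel
      rw [← hvel]
      have hda : ∀ x, HasDerivAt (G x) (sqgVelocity α (Ω (σ τ)) (G x τ)) τ := fun x => by
        have h2 := (hflow x τ hτT).hasDerivAt hnh
        have h3 : G x =ᶠ[𝓝 τ] fun s => γ x s := by
          filter_upwards [hnh] with s hs
          simp only [hG, hσe s hs]
        have h4 := h2.congr_of_eventuallyEq h3
        simpa only [hG, hσe τ hτT] using h4
      exact (hda b).sub (hda 0)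
  refine ⟨κ, M, c 0, G, P, ⟨hGc, hPc, hH, hc1 0, fun t => ?_, fun t ht x => ?_⟩, fun t ht x => ?_⟩
  · rw [← hcc t]; exact harea t
  · simp_rw [← hS]
    have hcτ : Continuous fun y => ∫ τ in (0:ℝ)..t, S y τ := by
      refine intervalIntegral.continuous_parametric_intervalIntegral_of_continuous' ?_ _ _
      exact hSc
    have h1 : HasDerivAt (fun b => G b 0 - G 0 0 +
        c 0 • ∫ y in (0:ℝ)..b, ∫ τ in (0:ℝ)..t, S y τ)
        (P x 0 + c 0 • ∫ τ in (0:ℝ)..t, S x τ) x :=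
      ((hd 0 x).sub_const _).add
        ((hcτ.integral_hasStrictDerivAt 0 x).hasDerivAt.const_smul (c 0))
    have h2 : HasDerivAt (fun b => G b t - G 0 t) (P x t) x := (hd t x).sub_const _
    rw [funext fun b => hdiff t ht b] at h2
    exact h2.unique h1
  · simp only [hPdef, hσe t ht]

/-! ### Pointwise comparison of the stretching of two loops -/

lemma abs_rpow_neg_sub_le {p κ a b : ℝ} (hp : 0 ≤ p) (hκ : 0 < κ) (ha : κ ≤ a) (hb : κ ≤ b) :
    |a ^ (-p) - b ^ (-p)| ≤ p * κ ^ (-p - 1) * |a - b| := by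
  refine (convex_Ici κ).norm_image_sub_le_of_norm_hasDerivWithin_le (𝕜 := ℝ)
    (f := fun r : ℝ => r ^ (-p)) (f' := fun r => -p * r ^ (-p - 1)) (fun r hr => ?_)
    (fun r hr => ?_) hb ha
  · exact (Real.hasDerivAt_rpow_const (Or.inl (hκ.trans_le hr).ne')).hasDerivWithinAt
  · rw [norm_mul, norm_neg, Real.norm_of_nonneg hp,
      Real.norm_of_nonneg (Real.rpow_nonneg (hκ.trans_le hr).le _)]
    exact mul_le_mul_of_nonneg_left
      (Real.rpow_le_rpow_of_nonpos hκ hr (by linarith)) hp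

lemma abs_mul_mul_sub_le (a₁ b₁ w₁ a₂ b₂ w₂ : ℝ) :
    |a₁ * b₁ * w₁ - a₂ * b₂ * w₂| ≤
      |a₁ - a₂| * |b₁| * |w₁| + |a₂| * |b₁ - b₂| * |w₁| + |a₂| * |b₂| * |w₁ - w₂| := by
  have e : a₁ * b₁ * w₁ - a₂ * b₂ * w₂ =
      (a₁ - a₂) * b₁ * w₁ + a₂ * (b₁ - b₂) * w₁ + a₂ * b₂ * (w₁ - w₂) := by ring
  rw [e]
  simpa only [abs_mul] using abs_add_three ((a₁ - a₂) * b₁ * w₁) (a₂ * (b₁ - b₂) * w₁)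
    (a₂ * b₂ * (w₁ - w₂))

lemma abs_cross_sub_cross_le {a b c d : R2} {M : ℝ} (ha : ‖a‖ ≤ M) (hd : ‖d‖ ≤ M) :
    |cross a b - cross c d| ≤ M * (‖a - c‖ + ‖b - d‖) := by
  have e : cross a b - cross c d = cross a (b - d) + cross (a - c) d := by
    rw [cross_sub_right, cross_sub_left]; ring
  rw [e]
  have h1 := abs_cross_le a (b - d)
  have h2 := abs_cross_le (a - c) d
  have h3 := mul_le_mul_of_nonneg_right ha (norm_nonneg (b - d))
  have h4 := mul_le_mul_of_nonneg_left hd (norm_nonneg (a - c))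
  linarith [abs_add_le (cross a (b - d)) (cross (a - c) d)]

namespace IsHolderLoop

variable {α β κ M : ℝ} {γ P : ℝ → R2}

lemma mono (h : IsHolderLoop β κ M γ P) {κ' M' : ℝ} (h0 : 0 < κ') (hκ : κ' ≤ κ) (hM : M ≤ M') :
    IsHolderLoop β κ' M' γ P where
  toIsRegularLoop := h.toIsRegularLoop
  pos := h0
  norm_deriv_le x := (h.norm_deriv_le x).trans hM
  holder x y := (h.holder x y).trans
    (mul_le_mul_of_nonneg_right hM (Real.rpow_nonneg (abs_nonneg _) _))
  chord x u hu := (mul_le_mul_of_nonneg_right hκ (abs_nonneg _)).trans (h.chord x u hu)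

lemma le_norm_meanTangent_of_ne (h : IsHolderLoop β κ M γ P) {x u : ℝ} (hu : |u| ≤ π)
    (hu0 : u ≠ 0) : κ ≤ ‖meanTangent P x u‖ := by
  have h1 := h.chord x u hu
  rw [← smul_meanTangent h.continuous_deriv h.hasDerivAt x u, norm_smul, Real.norm_eq_abs,
    mul_comm] at h1
  exact le_of_mul_le_mul_left h1 (abs_pos.2 hu0)

lemma norm_meanTangent_sub_le (h : IsHolderLoop β κ M γ P) (hβ : 0 < β) (x u : ℝ) :
    ‖meanTangent P x u - P x‖ ≤ M * |u| ^ β := by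
  have hP := h.continuous_deriv
  have e : meanTangent P x u - P x = ∫ s in (0:ℝ)..1, (P (x + s * u) - P x) := by
    rw [intervalIntegral.integral_sub (Continuous.intervalIntegrable (by fun_prop) _ _)
      (Continuous.intervalIntegrable (by fun_prop) _ _)]
    simp [meanTangent]
  rw [e]
  refine (intervalIntegral.norm_integral_le_of_norm_le_const (C := M * |u| ^ β)
    fun s hs => ?_).trans (by simp)
  rw [uIoc_of_le zero_le_one] at hs
  refine (h.holder _ _).trans (mul_le_mul_of_nonneg_left
    (Real.rpow_le_rpow (abs_nonneg _) ?_ hβ.le) h.bound_nonneg)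
  rw [add_sub_cancel_left, abs_mul, abs_of_pos hs.1]
  exact mul_le_of_le_one_left (abs_nonneg _) hs.2

lemma le_norm_deriv (h : IsHolderLoop β κ M γ P) (x : ℝ) : κ ≤ ‖P x‖ := by
  have hl := (hasDerivAt_iff_tendsto_slope_zero.1 (h.hasDerivAt x)).norm
  refine ge_of_tendsto hl ?_
  have hπ : ∀ᶠ u : ℝ in 𝓝[≠] 0, |u| ≤ π := by
    refine Filter.Eventually.filter_mono nhdsWithin_le_nhds ?_
    have : Tendsto (fun u : ℝ => |u|) (𝓝 0) (𝓝 0) := by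
      simpa using (continuous_abs (G := ℝ)).tendsto 0
    exact (this.eventually (gt_mem_nhds pi_pos)).mono fun u hu => le_of_lt hu
  filter_upwards [hπ, self_mem_nhdsWithin] with u hu hu0
  have hpos : 0 < |u| := abs_pos.2 hu0
  rw [norm_smul, norm_inv, Real.norm_eq_abs, inv_mul_eq_div, le_div_iff₀ hpos]
  exact h.chord x u hu

lemma abs_inner_perp_meanTangent_le (h : IsHolderLoop β κ M γ P) (hβ : 0 < β) (x u : ℝ) :
    |⟪P x, perp (meanTangent P x u)⟫| ≤ M * (M * |u| ^ β) := by
  have e : ⟪P x, perp (meanTangent P x u)⟫ = ⟪P x, perp (meanTangent P x u - P x)⟫ := by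
    rw [perp_sub, inner_sub_right, real_inner_comm (perp (P x)), ← cross_eq_inner, cross_same,
      sub_zero]
  rw [e]
  refine (abs_real_inner_le_norm _ _).trans ?_
  rw [norm_perp]
  exact mul_le_mul (h.norm_deriv_le x) (h.norm_meanTangent_sub_le hβ x u) (norm_nonneg _)
    h.bound_nonneg

lemma inner_stretchKernel (h : IsHolderLoop β κ M γ P) {x u : ℝ} (hu0 : u ≠ 0) :
    ⟪P x, stretchKernel α γ P x u⟫ = |u| ^ (-(2 + 2 * α)) * u *
      (cross (P x) (P (x + u)) * ⟪P x, perp (meanTangent P x u)⟫ *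
        ‖meanTangent P x u‖ ^ (-(2 + 2 * α))) := by
  have hu := abs_pos.2 hu0
  rw [stretchKernel, ← smul_meanTangent h.continuous_deriv h.hasDerivAt x u, perp_smul, norm_smul,
    Real.norm_eq_abs, Real.mul_rpow hu.le (norm_nonneg _), Real.rpow_neg hu.le,
    Real.rpow_neg (norm_nonneg _), mul_inv]
  simp only [inner_smul_right]
  ring

end IsHolderLoop

lemma norm_meanTangent_sub_le {P₁ P₂ : ℝ → R2} (h₁ : Continuous P₁) (h₂ : Continuous P₂)
    (x u : ℝ) : ‖meanTangent P₁ x u - meanTangent P₂ x u‖ ≤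
      ∫ s in (0:ℝ)..1, ‖P₁ (x + s * u) - P₂ (x + s * u)‖ := by
  rw [meanTangent, meanTangent, ← intervalIntegral.integral_sub
    (Continuous.intervalIntegrable (by fun_prop) _ _)
    (Continuous.intervalIntegrable (by fun_prop) _ _)]
  exact intervalIntegral.norm_integral_le_integral_norm zero_le_one

lemma exists_abs_inner_stretchKernel_sub_le {α β κ M : ℝ} (hα : 0 < α) (hβ : 0 < β)
    (hκ : 0 < κ) (hM : 0 ≤ M) : ∃ C, 0 ≤ C ∧ ∀ γ₁ P₁ γ₂ P₂ : ℝ → R2,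
      IsHolderLoop β κ M γ₁ P₁ → IsHolderLoop β κ M γ₂ P₂ → ∀ x u, |u| ≤ π → u ≠ 0 →
      |⟪P₁ x, stretchKernel α γ₁ P₁ x u⟫ - ⟪P₂ x, stretchKernel α γ₂ P₂ x u⟫| ≤
        C * (|u| ^ (β - 1 - 2 * α) * (‖P₁ x - P₂ x‖ + ‖P₁ (x + u) - P₂ (x + u)‖ +
          ∫ s in (0:ℝ)..1, ‖P₁ (x + s * u) - P₂ (x + s * u)‖)) := by
  set p := 2 + 2 * α with hp
  have hp0 : 0 ≤ p := by linarith
  obtain ⟨w, hw⟩ : ∃ w, w = κ ^ (-p) := ⟨_, rfl⟩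
  obtain ⟨L, hL⟩ : ∃ L, L = p * κ ^ (-p - 1) := ⟨_, rfl⟩
  have hw0 : 0 ≤ w := hw ▸ by positivity
  have hL0 : 0 ≤ L := hL ▸ by positivity
  refine ⟨2 * M ^ 3 * w + M ^ 4 * π ^ β * L, by positivity, ?_⟩
  intro γ₁ P₁ γ₂ P₂ h₁ h₂ x u hu hu0
  have hu1 := abs_pos.2 hu0
  rw [h₁.inner_stretchKernel hu0, h₂.inner_stretchKernel hu0, ← mul_sub, abs_mul, abs_mul,
    abs_of_nonneg (Real.rpow_nonneg hu1.le _), ← hp]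
  have hk₁ := h₁.le_norm_meanTangent_of_ne (x := x) hu hu0
  have hk₂ := h₂.le_norm_meanTangent_of_ne (x := x) hu hu0
  have hq := norm_meanTangent_sub_le h₁.continuous_deriv h₂.continuous_deriv x u
  have hW : |‖meanTangent P₁ x u‖ ^ (-p)| ≤ w := by
    rw [abs_of_nonneg (by positivity), hw]
    exact Real.rpow_le_rpow_of_nonpos hκ hk₁ (by linarith)
  have hWd := abs_rpow_neg_sub_le hp0 hκ hk₁ hk₂
  have hWn := abs_norm_sub_norm_le (meanTangent P₁ x u) (meanTangent P₂ x u)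
  have hA := h₂.abs_cross_le x u
  have hAd := abs_cross_sub_cross_le (b := P₁ (x + u)) (c := P₂ x)
    (h₁.norm_deriv_le x) (h₂.norm_deriv_le (x + u))
  have hB₁ := h₁.abs_inner_perp_meanTangent_le hβ x u
  have hB₂ := h₂.abs_inner_perp_meanTangent_le hβ x u
  have hBd : |⟪P₁ x, perp (meanTangent P₁ x u)⟫ - ⟪P₂ x, perp (meanTangent P₂ x u)⟫| ≤
      M * (‖P₁ x - P₂ x‖ + ‖meanTangent P₁ x u - meanTangent P₂ x u‖) := by
    have e : ∀ a b : R2, ⟪a, perp b⟫ = cross b a := fun a b => by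
      rw [cross_eq_inner, real_inner_comm]
    rw [e, e, add_comm]
    refine abs_cross_sub_cross_le ?_ (h₂.norm_deriv_le x)
    refine (intervalIntegral.norm_integral_le_of_norm_le_const
      fun s _ => h₁.norm_deriv_le _).trans (by simp)
  obtain ⟨q, hqe⟩ : ∃ q, q = ∫ s in (0:ℝ)..1, ‖P₁ (x + s * u) - P₂ (x + s * u)‖ := ⟨_, rfl⟩
  rw [← hqe] at hq ⊢
  have hq0 : 0 ≤ q := (norm_nonneg _).trans hq
  obtain ⟨v, hv⟩ : ∃ v, v = |u| ^ β := ⟨_, rfl⟩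
  rw [← hv] at hA hB₁ hB₂
  have hv0 : 0 ≤ v := hv ▸ by positivity
  have hvπ : v ≤ π ^ β := hv ▸ Real.rpow_le_rpow (abs_nonneg _) hu hβ.le
  have hrp : |u| ^ (β - 1 - 2 * α) = |u| ^ (-p) * |u| * v := by
    rw [hv, ← Real.rpow_add_one hu1.ne', ← Real.rpow_add hu1]
    congr 1; rw [hp]; ring
  have hmain := abs_mul_mul_sub_le (cross (P₁ x) (P₁ (x + u)))
    ⟪P₁ x, perp (meanTangent P₁ x u)⟫ (‖meanTangent P₁ x u‖ ^ (-p))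
    (cross (P₂ x) (P₂ (x + u))) ⟪P₂ x, perp (meanTangent P₂ x u)⟫ (‖meanTangent P₂ x u‖ ^ (-p))
  obtain ⟨d, hd⟩ : ∃ d, d = ‖P₁ x - P₂ x‖ := ⟨_, rfl⟩
  obtain ⟨d', hd'⟩ : ∃ d', d' = ‖P₁ (x + u) - P₂ (x + u)‖ := ⟨_, rfl⟩
  have hd0 : 0 ≤ d := hd ▸ norm_nonneg _
  have hd0' : 0 ≤ d' := hd' ▸ norm_nonneg _
  rw [← hd, ← hd'] at hAd
  rw [← hd] at hBd
  rw [← hd, ← hd', hrp]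
  have hbound : |cross (P₁ x) (P₁ (x + u)) * ⟪P₁ x, perp (meanTangent P₁ x u)⟫ *
      ‖meanTangent P₁ x u‖ ^ (-p) - cross (P₂ x) (P₂ (x + u)) *
      ⟪P₂ x, perp (meanTangent P₂ x u)⟫ * ‖meanTangent P₂ x u‖ ^ (-p)| ≤
      (2 * M ^ 3 * w + M ^ 4 * π ^ β * L) * v * (d + d' + q) := by
    have hWd' : |‖meanTangent P₁ x u‖ ^ (-p) - ‖meanTangent P₂ x u‖ ^ (-p)| ≤ L * q := by
      rw [← hL] at hWd
      exact hWd.trans (mul_le_mul_of_nonneg_left (hWn.trans hq) hL0)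
    have hBd' := hBd.trans (mul_le_mul_of_nonneg_left (add_le_add_right hq d) hM)
    have t1 := mul_le_mul (mul_le_mul hAd hB₁ (abs_nonneg _) (by positivity)) hW
      (abs_nonneg _) (by positivity)
    have t2 := mul_le_mul (mul_le_mul hA hBd' (abs_nonneg _) (by positivity)) hW
      (abs_nonneg _) (by positivity)
    have t3 := mul_le_mul (mul_le_mul hA hB₂ (abs_nonneg _) (by positivity)) hWd'
      (abs_nonneg _) (by positivity)
    have s1 : M ^ 3 * w * v * (d + d' + (d + q)) ≤ M ^ 3 * w * v * (2 * (d + d' + q)) := by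
      refine mul_le_mul_of_nonneg_left (by linarith) (by positivity)
    have s2 : M ^ 4 * L * v * (v * q) ≤ M ^ 4 * L * v * (π ^ β * (d + d' + q)) := by
      refine mul_le_mul_of_nonneg_left ?_ (by positivity)
      exact mul_le_mul hvπ (by linarith) hq0 (by positivity)
    nlinarith [hmain, t1, t2, t3, s1, s2]
  calc _ ≤ |u| ^ (-p) * |u| * ((2 * M ^ 3 * w + M ^ 4 * π ^ β * L) * v * (d + d' + q)) :=
        mul_le_mul_of_nonneg_left hbound (by positivity)
    _ = _ := by ring

/-! ### Square integrals of the difference of the stretchings -/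

lemma integral_mul_shift_le {f : ℝ → ℝ} {L : ℝ} (hf : Continuous f) (hp : Periodic f L)
    (hL : 0 ≤ L) (v : ℝ) : ∫ x in (0:ℝ)..L, f x * f (x + v) ≤ ∫ x in (0:ℝ)..L, f x ^ 2 := by
  have h1 : ∫ x in (0:ℝ)..L, f (x + v) ^ 2 = ∫ x in (0:ℝ)..L, f x ^ 2 := by
    rw [intervalIntegral.integral_comp_add_right (fun x => f x ^ 2), add_comm L v, zero_add]
    have hp2 : Periodic (fun x => f x ^ 2) L := fun x => by simp only [hp x]
    simpa using hp2.intervalIntegral_add_eq v 0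
  have h2 : ∫ x in (0:ℝ)..L, f x * f (x + v) ≤
      ∫ x in (0:ℝ)..L, (1 / 2) * (f x ^ 2 + f (x + v) ^ 2) :=
    intervalIntegral.integral_mono_on hL (Continuous.intervalIntegrable (by fun_prop) _ _)
      (Continuous.intervalIntegrable (by fun_prop) _ _)
      fun x _ => by nlinarith [sq_nonneg (f x - f (x + v))]
  rw [intervalIntegral.integral_const_mul, intervalIntegral.integral_add
    (Continuous.intervalIntegrable (by fun_prop) _ _)
    (Continuous.intervalIntegrable (by fun_prop) _ _), h1] at h2
  linarith

lemma integral_mul_average_le {f : ℝ → ℝ} {L : ℝ} (hf : Continuous f) (hp : Periodic f L)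
    (hL : 0 ≤ L) (u : ℝ) :
    ∫ x in (0:ℝ)..L, f x * ∫ s in (0:ℝ)..1, f (x + s * u) ≤ ∫ x in (0:ℝ)..L, f x ^ 2 := by
  simp_rw [← intervalIntegral.integral_const_mul]
  rw [integral_swap_of_continuous (f := fun x s => f x * f (x + s * u))
    (by unfold uncurry; fun_prop)]
  have h := intervalIntegral.integral_mono_on (a := 0) (b := 1) (μ := volume)
    (f := fun s => ∫ x in (0:ℝ)..L, f x * f (x + s * u))
    (g := fun _ => ∫ x in (0:ℝ)..L, f x ^ 2) zero_le_one
    (Continuous.intervalIntegrable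
      (intervalIntegral.continuous_parametric_intervalIntegral_of_continuous'
        (by unfold uncurry; fun_prop) _ _) _ _)
    (by simp) fun s _ => integral_mul_shift_le hf hp hL _
  simpa using h

lemma integral_mul_singular_le {f : ℝ → ℝ} {L r : ℝ} (hf : Continuous f) (hp : Periodic f L)
    (hL : 0 ≤ L) (hr : -1 < r) {a b : ℝ} (hab : a ≤ b) :
    IntervalIntegrable (fun x => f x * ∫ u in a..b,
        |u| ^ r * (f x + f (x + u) + ∫ s in (0:ℝ)..1, f (x + s * u))) volume 0 L ∧
      ∫ x in (0:ℝ)..L, f x * ∫ u in a..b,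
        |u| ^ r * (f x + f (x + u) + ∫ s in (0:ℝ)..1, f (x + s * u)) ≤
      3 * (∫ u in a..b, |u| ^ r) * ∫ x in (0:ℝ)..L, f x ^ 2 := by
  obtain ⟨m, hm⟩ : ∃ m : ℝ → ℝ → ℝ, ∀ x u, m x u = ∫ s in (0:ℝ)..1, f (x + s * u) :=
    ⟨_, fun _ _ => rfl⟩
  have hmc : Continuous (uncurry m) := by
    have : uncurry m = fun q : ℝ × ℝ => ∫ s in (0:ℝ)..1, f (q.1 + s * q.2) :=
      funext fun q => hm _ _
    rw [this]
    exact intervalIntegral.continuous_parametric_intervalIntegral_of_continuous'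
      (by unfold uncurry; fun_prop) _ _
  obtain ⟨F, hF⟩ : ∃ F : ℝ → ℝ → ℝ, ∀ x u, F x u = f x * (f x + f (x + u) + m x u) :=
    ⟨_, fun _ _ => rfl⟩
  have hFc : Continuous (uncurry F) := by
    have : uncurry F = fun q : ℝ × ℝ => f q.1 * (f q.1 + f (q.1 + q.2) + uncurry m q) :=
      funext fun q => hF _ _
    rw [this]; fun_prop
  have hw := (intervalIntegrable_abs_rpow hr a b).1
  have hint : Integrable (uncurry fun x u => |u| ^ r * F x u)
      ((volume.restrict (Ioc 0 L)).prod (volume.restrict (Ioc a b))) := by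
    have h1 : Integrable (fun q : ℝ × ℝ => (1:ℝ) * |q.2| ^ r)
        ((volume.restrict (Ioc 0 L)).prod (volume.restrict (Ioc a b))) :=
      Integrable.mul_prod (f := fun _ => (1:ℝ)) (integrable_const _) hw
    obtain ⟨B, hB⟩ := (isCompact_Icc.prod isCompact_Icc :
      IsCompact (Icc 0 L ×ˢ Icc a b)).exists_bound_of_continuousOn hFc.continuousOn
    have h2 := h1.mul_bdd (c := B) (g := uncurry F) hFc.aestronglyMeasurable ?_
    · simpa [uncurry_def] using h2
    · rw [Measure.prod_restrict]
      refine (ae_restrict_iff' (measurableSet_Ioc.prod measurableSet_Ioc)).2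
        (Eventually.of_forall fun q hq => hB q ⟨Ioc_subset_Icc_self hq.1, Ioc_subset_Icc_self hq.2⟩)
  have hinner : ∀ x, f x * ∫ u in a..b, |u| ^ r * (f x + f (x + u) + m x u) =
      ∫ u in a..b, |u| ^ r * F x u := fun x => by
    rw [← intervalIntegral.integral_const_mul]
    congr 1; ext u; rw [hF]; ring
  have hcorr : ∀ u, ∫ x in (0:ℝ)..L, F x u ≤ 3 * ∫ x in (0:ℝ)..L, f x ^ 2 := fun u => by
    have hmu : Continuous fun x => m x u := hmc.comp (Continuous.prodMk_left u)
    have e : ∫ x in (0:ℝ)..L, F x u = (∫ x in (0:ℝ)..L, f x ^ 2) +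
        (∫ x in (0:ℝ)..L, f x * f (x + u)) + ∫ x in (0:ℝ)..L, f x * m x u := by
      rw [← intervalIntegral.integral_add (Continuous.intervalIntegrable (by fun_prop) _ _)
        (Continuous.intervalIntegrable (by fun_prop) _ _), ← intervalIntegral.integral_add
        (Continuous.intervalIntegrable (by fun_prop) _ _)
        (Continuous.intervalIntegrable (by fun_prop) _ _)]
      congr 1; ext x; rw [hF]; ring
    have h1 := integral_mul_shift_le hf hp hL u
    have h2 := integral_mul_average_le hf hp hL u
    simp_rw [← hm] at h2
    rw [e]; linarith
  simp_rw [← hm, hinner]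
  constructor
  · rw [intervalIntegrable_iff_integrableOn_Ioc_of_le hL, IntegrableOn]
    simpa only [intervalIntegral.integral_of_le hab, uncurry] using hint.integral_prod_left
  · have hsw : ∫ x in (0:ℝ)..L, ∫ u in a..b, |u| ^ r * F x u =
        ∫ u in a..b, |u| ^ r * ∫ x in (0:ℝ)..L, F x u := by
      simp_rw [← intervalIntegral.integral_const_mul, intervalIntegral.integral_of_le hab,
        intervalIntegral.integral_of_le hL]
      exact integral_integral_swap hint
    rw [hsw]
    have hc : Continuous fun u => ∫ x in (0:ℝ)..L, F x u := by
      refine intervalIntegral.continuous_parametric_intervalIntegral_of_continuous' ?_ _ _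
      exact hFc.comp continuous_swap
    have hmono := intervalIntegral.integral_mono_on (μ := volume) hab
      (f := fun u => |u| ^ r * ∫ x in (0:ℝ)..L, F x u)
      (g := fun u => |u| ^ r * (3 * ∫ x in (0:ℝ)..L, f x ^ 2))
      ((intervalIntegrable_abs_rpow hr a b).mul_continuousOn hc.continuousOn)
      ((intervalIntegrable_abs_rpow hr a b).mul_const _)
      fun u _ => mul_le_mul_of_nonneg_left (hcorr u) (by positivity)
    rw [intervalIntegral.integral_mul_const] at hmono
    linarith

lemma exists_norm_stretching_le {α β κ M : ℝ} (hα : 0 < α) (hβ : 2 * α < β) (hκ : 0 < κ)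
    (hM : 0 ≤ M) : ∃ C, 0 ≤ C ∧ ∀ γ P : ℝ → R2, IsHolderLoop β κ M γ P →
      ∀ x, ‖stretching α γ P x‖ ≤ C := by
  have hr : -1 < β - 1 - 2 * α := by linarith
  have hπ : -π ≤ π := by linarith [pi_pos]
  refine ⟨(κ ^ (2 + 2 * α))⁻¹ * M ^ 3 * ∫ u in (-π)..π, |u| ^ (β - 1 - 2 * α), ?_, ?_⟩
  · exact mul_nonneg (by positivity)
      (intervalIntegral.integral_nonneg hπ fun u _ => by positivity)
  · intro γ P h x
    rw [stretching, ← intervalIntegral.integral_const_mul]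
    refine intervalIntegral.norm_integral_le_of_norm_le hπ ?_
      ((intervalIntegrable_abs_rpow hr _ _).const_mul _)
    filter_upwards [ae_ne_zero] with u hu0 hu
    exact h.norm_stretchKernel_le hα (abs_le.2 ⟨hu.1.le, hu.2⟩) hu0

lemma exists_integral_stretching_sub_le {α β κ M : ℝ} (hα : 0 < α) (hβ : 2 * α < β)
    (hκ : 0 < κ) (hM : 0 ≤ M) : ∃ C, 0 ≤ C ∧ ∀ γ₁ P₁ γ₂ P₂ : ℝ → R2,
      IsHolderLoop β κ M γ₁ P₁ → IsHolderLoop β κ M γ₂ P₂ →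
      ∫ x in (0:ℝ)..2 * π, |‖P₁ x‖ - ‖P₂ x‖| *
          |⟪P₁ x, stretching α γ₁ P₁ x⟫ / ‖P₁ x‖ - ⟪P₂ x, stretching α γ₂ P₂ x⟫ / ‖P₂ x‖| ≤
        C * ∫ x in (0:ℝ)..2 * π, ‖P₁ x - P₂ x‖ ^ 2 := by
  have hr : -1 < β - 1 - 2 * α := by linarith
  have hπ : -π ≤ π := by linarith [pi_pos]
  have h2π : 0 ≤ 2 * π := by positivity
  obtain ⟨B, hB0, hB⟩ := exists_norm_stretching_le hα hβ hκ hM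
  obtain ⟨C, hC0, hC⟩ := exists_abs_inner_stretchKernel_sub_le hα (by linarith : 0 < β) hκ hM
  obtain ⟨I, hI⟩ : ∃ I, I = ∫ u in (-π)..π, |u| ^ (β - 1 - 2 * α) := ⟨_, rfl⟩
  have hI0 : 0 ≤ I := hI ▸ intervalIntegral.integral_nonneg hπ fun u _ => by positivity
  refine ⟨C / κ * (3 * I) + B / κ, by positivity, ?_⟩
  intro γ₁ P₁ γ₂ P₂ h₁ h₂
  have hP₁ := h₁.continuous_deriv
  have hP₂ := h₂.continuous_deriv
  obtain ⟨δ, hδ⟩ : ∃ δ : ℝ → ℝ, ∀ x, δ x = ‖P₁ x - P₂ x‖ := ⟨_, fun _ => rfl⟩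
  have hδc : Continuous δ := by
    rw [funext hδ]; fun_prop
  have hδp : Periodic δ (2 * π) := fun x => by
    rw [hδ, hδ, h₁.periodic_deriv x, h₂.periodic_deriv x]
  have hδ0 : ∀ x, 0 ≤ δ x := fun x => hδ x ▸ norm_nonneg _
  obtain ⟨hRi, hRle⟩ := integral_mul_singular_le hδc hδp h2π hr hπ
  obtain ⟨R, hR⟩ : ∃ R : ℝ → ℝ, ∀ x, R x = ∫ u in (-π)..π, |u| ^ (β - 1 - 2 * α) *
    (δ x + δ (x + u) + ∫ s in (0:ℝ)..1, δ (x + s * u)) := ⟨_, fun _ => rfl⟩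
  simp_rw [← hR] at hRi hRle
  rw [← hI] at hRle
  have hN : ∀ x, |⟪P₁ x, stretching α γ₁ P₁ x⟫ - ⟪P₂ x, stretching α γ₂ P₂ x⟫| ≤ C * R x := by
    intro x
    have hi₁ := h₁.intervalIntegrable_stretchKernel hα hβ x
    have hi₂ := h₂.intervalIntegrable_stretchKernel hα hβ x
    have e₁ := (innerSL ℝ (P₁ x)).intervalIntegral_comp_comm hi₁
    have e₂ := (innerSL ℝ (P₂ x)).intervalIntegral_comp_comm hi₂
    have j₁ : IntervalIntegrable (fun u => innerSL ℝ (P₁ x) (stretchKernel α γ₁ P₁ x u)) volume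
        (-π) π := ⟨(innerSL ℝ (P₁ x)).integrable_comp hi₁.1, (innerSL ℝ (P₁ x)).integrable_comp hi₁.2⟩
    have j₂ : IntervalIntegrable (fun u => innerSL ℝ (P₂ x) (stretchKernel α γ₂ P₂ x u)) volume
        (-π) π := ⟨(innerSL ℝ (P₂ x)).integrable_comp hi₂.1, (innerSL ℝ (P₂ x)).integrable_comp hi₂.2⟩
    simp only [innerSL_apply_apply] at e₁ e₂ j₁ j₂
    rw [stretching, stretching, ← e₁, ← e₂, ← intervalIntegral.integral_sub j₁ j₂, hR,
      ← intervalIntegral.integral_const_mul, ← Real.norm_eq_abs]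
    have hmc : Continuous fun u => ∫ s in (0:ℝ)..1, δ (x + s * u) :=
      intervalIntegral.continuous_parametric_intervalIntegral_of_continuous'
        (by unfold uncurry; fun_prop) _ _
    refine intervalIntegral.norm_integral_le_of_norm_le hπ ?_
      (((intervalIntegrable_abs_rpow hr _ _).mul_continuousOn
        (Continuous.continuousOn (by fun_prop))).const_mul _)
    filter_upwards [ae_ne_zero] with u hu0 hu
    simp only [hδ]
    exact hC γ₁ P₁ γ₂ P₂ h₁ h₂ x u (abs_le.2 ⟨hu.1.le, hu.2⟩) hu0
  have hE : ∀ x, |⟪P₁ x, stretching α γ₁ P₁ x⟫ / ‖P₁ x‖ -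
      ⟪P₂ x, stretching α γ₂ P₂ x⟫ / ‖P₂ x‖| ≤ C / κ * R x + B / κ * δ x := by
    intro x
    have hg₁ := h₁.le_norm_deriv x
    have hg₂ := h₂.le_norm_deriv x
    have hp₁ := hκ.trans_le hg₁
    have hp₂ := hκ.trans_le hg₂
    have hn := hN x
    have hb : |⟪P₂ x, stretching α γ₂ P₂ x⟫| ≤ ‖P₂ x‖ * B :=
      (abs_real_inner_le_norm _ _).trans
        (mul_le_mul_of_nonneg_left (hB γ₂ P₂ h₂ x) (norm_nonneg _))
    have hs := abs_norm_sub_norm_le (P₁ x) (P₂ x)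
    rw [← hδ] at hs
    generalize ⟪P₁ x, stretching α γ₁ P₁ x⟫ = n₁ at *
    generalize ⟪P₂ x, stretching α γ₂ P₂ x⟫ = n₂ at *
    generalize ‖P₁ x‖ = g₁ at *
    generalize ‖P₂ x‖ = g₂ at *
    have e : n₁ / g₁ - n₂ / g₂ = ((n₁ - n₂) - n₂ / g₂ * (g₁ - g₂)) / g₁ := by
      field_simp; ring
    have hb' : |n₂ / g₂| ≤ B := by
      rw [abs_div, abs_of_pos hp₂, div_le_iff₀ hp₂, mul_comm]; exact hb
    rw [e, abs_div, abs_of_pos hp₁, div_le_iff₀ hp₁]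
    have h3 : |(n₁ - n₂) - n₂ / g₂ * (g₁ - g₂)| ≤ C * R x + B * δ x := by
      refine (abs_sub _ _).trans (add_le_add hn ?_)
      rw [abs_mul]
      exact mul_le_mul hb' hs (abs_nonneg _) hB0
    have h4 : 0 ≤ C * R x + B * δ x := (abs_nonneg _).trans h3
    have h5 : C / κ * R x + B / κ * δ x = (C * R x + B * δ x) / κ := by ring
    rw [h5, div_mul_eq_mul_div (C * R x + B * δ x), le_div_iff₀ hκ]
    exact mul_le_mul h3 hg₁ hκ.le h4
  have hSc₁ := h₁.continuous_stretching hα hβ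
  have hSc₂ := h₂.continuous_stretching hα hβ
  have hcont : Continuous fun x => |‖P₁ x‖ - ‖P₂ x‖| *
      |⟪P₁ x, stretching α γ₁ P₁ x⟫ / ‖P₁ x‖ - ⟪P₂ x, stretching α γ₂ P₂ x⟫ / ‖P₂ x‖| := by
    refine Continuous.mul (by fun_prop) (Continuous.abs (Continuous.sub
      (Continuous.div (hP₁.inner hSc₁) hP₁.norm fun x => ?_)
      (Continuous.div (hP₂.inner hSc₂) hP₂.norm fun x => ?_)))
    · exact (hκ.trans_le (h₁.le_norm_deriv x)).ne'
    · exact (hκ.trans_le (h₂.le_norm_deriv x)).ne'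
  have hδ2 : IntervalIntegrable (fun x => δ x ^ 2) volume 0 (2 * π) :=
    Continuous.intervalIntegrable (by fun_prop) _ _
  have hmono := intervalIntegral.integral_mono_on (μ := volume) h2π
    (g := fun x => C / κ * (δ x * R x) + B / κ * δ x ^ 2) (hcont.intervalIntegrable _ _)
    ((hRi.const_mul _).add (hδ2.const_mul _)) fun x _ => by
      have hs := abs_norm_sub_norm_le (P₁ x) (P₂ x)
      rw [← hδ] at hs
      exact (mul_le_mul hs (hE x) (abs_nonneg _) (hδ0 x)).trans (le_of_eq (by ring))
  rw [intervalIntegral.integral_add (hRi.const_mul _) (hδ2.const_mul _),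
    intervalIntegral.integral_const_mul, intervalIntegral.integral_const_mul] at hmono
  simp_rw [← hδ]
  have h6 := mul_le_mul_of_nonneg_left hRle (by positivity : 0 ≤ C / κ)
  nlinarith [hmono, h6]

/-! ### Stability of the arc-length metric -/

lemma HasDerivAt.norm_of_ne_zero {f : ℝ → R2} {f' : R2} {t : ℝ} (h : HasDerivAt f f' t)
    (h0 : f t ≠ 0) : HasDerivAt (fun s => ‖f s‖) (⟪f t, f'⟫ / ‖f t‖) t := by
  have h1 := h.norm_sq.sqrt (by positivity)
  simp only [Real.sqrt_sq (norm_nonneg _)] at h1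
  exact h1.congr_deriv (mul_div_mul_left _ _ two_ne_zero)

namespace IsHolderEvolution

variable {α β κ M c T : ℝ} {γ P : ℝ → ℝ → R2}

lemma mono (h : IsHolderEvolution α β κ M c T γ P) {κ' M' : ℝ} (h0 : 0 < κ') (hκ : κ' ≤ κ)
    (hM : M ≤ M') : IsHolderEvolution α β κ' M' c T γ P :=
  { h with loop := fun t => (h.loop t).mono h0 hκ hM }

lemma continuous_stretching (h : IsHolderEvolution α β κ M c T γ P) (hα : 0 < α)
    (hβ : 2 * α < β) : Continuous fun q : ℝ × ℝ => stretching α (γ · q.2) (P · q.2) q.1 :=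
  _root_.continuous_stretching hα hβ h.continuous h.continuous_deriv h.loop

lemma hasDerivAt_norm_deriv (h : IsHolderEvolution α β κ M c T γ P) (hα : 0 < α)
    (hβ : 2 * α < β) {t : ℝ} (ht : t ∈ Ioo 0 T) (x : ℝ) :
    HasDerivAt (fun s => ‖P x s‖)
      (c * (⟪P x t, stretching α (γ · t) (P · t) x⟫ / ‖P x t‖)) t := by
  have hS : Continuous fun τ => stretching α (γ · τ) (P · τ) x := by
    simpa only [comp_def] using
      (h.continuous_stretching hα hβ).comp (Continuous.prodMk_right (Y := ℝ) x)
  obtain ⟨S, hSe⟩ : ∃ S : ℝ → R2, ∀ τ, S τ = stretching α (γ · τ) (P · τ) x := ⟨_, fun _ => rfl⟩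
  have hP : ∀ s ∈ Icc (0:ℝ) T, P x s = P x 0 + c • ∫ τ in (0:ℝ)..s, S τ := fun s hs => by
    simp_rw [hSe]; exact h.deriv_eq s hs x
  simp_rw [← hSe] at hS ⊢
  have h2 : HasDerivAt (P x) (c • S t) t := by
    refine ((((hS.integral_hasStrictDerivAt 0 t).hasDerivAt).const_smul c).const_add
      (P x 0)).congr_of_eventuallyEq ?_
    filter_upwards [Icc_mem_nhds ht.1 ht.2] with s hs
    exact hP s hs
  refine (h2.norm_of_ne_zero ((h.loop t).deriv_ne_zero x)).congr_deriv ?_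
  rw [inner_smul_right, mul_div_assoc]

end IsHolderEvolution

lemma area_eq_of_deriv_eq {γ₁ γ₂ P : ℝ → R2} (h₁ : IsRegularLoop γ₁ P)
    (h₂ : IsRegularLoop γ₂ P) :
    ∫ x in (0:ℝ)..2 * π, γ₁ x 0 * P x 1 = ∫ x in (0:ℝ)..2 * π, γ₂ x 0 * P x 1 := by
  have hP := h₁.continuous_deriv
  have hγ₁ := h₁.continuous
  have hγ₂ := h₂.continuous
  have hv : ∀ x, γ₁ x - γ₂ x = γ₁ 0 - γ₂ 0 := fun x =>
    is_const_of_deriv_eq_zero (f := fun x => γ₁ x - γ₂ x)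
      (fun y => ((h₁.hasDerivAt y).sub (h₂.hasDerivAt y)).differentiableAt)
      (fun y => ((h₁.hasDerivAt y).sub (h₂.hasDerivAt y)).deriv.trans (sub_self _)) x 0
  have h0 : ∫ x in (0:ℝ)..2 * π, P x 1 = 0 := by
    rw [intervalIntegral.integral_eq_sub_of_hasDerivAt
      (fun x _ => (h₁.hasDerivAt x).coord 1) (Continuous.intervalIntegrable (by fun_prop) _ _)]
    have := h₁.periodic 0
    rw [zero_add] at this
    rw [this, sub_self]
  rw [← sub_eq_zero, ← intervalIntegral.integral_sub
    (Continuous.intervalIntegrable (by fun_prop) _ _)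
    (Continuous.intervalIntegrable (by fun_prop) _ _)]
  have e : ∀ x, γ₁ x 0 * P x 1 - γ₂ x 0 * P x 1 = (γ₁ 0 - γ₂ 0) 0 * P x 1 := fun x => by
    rw [← sub_mul, ← hv x, PiLp.sub_apply]
  simp_rw [e]
  rw [intervalIntegral.integral_const_mul, h0, mul_zero]

lemma integral_norm_sub_sq_pos {P₁ P₂ : ℝ → R2} {L : ℝ} (h₁ : Continuous P₁) (h₂ : Continuous P₂)
    (p₁ : Periodic P₁ L) (p₂ : Periodic P₂ L) (hL : 0 < L) (hne : P₁ ≠ P₂) :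
    0 < ∫ x in (0:ℝ)..L, ‖P₁ x - P₂ x‖ ^ 2 := by
  have hc : Continuous fun x => ‖P₁ x - P₂ x‖ ^ 2 := by fun_prop
  obtain ⟨x, hx⟩ := ne_iff.1 hne
  have hp : Periodic (fun x => ‖P₁ x - P₂ x‖ ^ 2) L := fun y => by
    simp only [p₁ y, p₂ y]
  obtain ⟨y, hy, hxy⟩ := hp.exists_mem_Ico₀ hL x
  refine intervalIntegral.integral_pos hL hc.continuousOn (fun _ _ => by positivity)
    ⟨y, Ico_subset_Icc_self hy, ?_⟩
  rw [← hxy]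
  have := norm_pos_iff.2 (sub_ne_zero.2 hx)
  positivity

lemma exists_integral_rate_le {α β κ M c₁ c₂ T : ℝ} (hα : 0 < α) (hβ : 2 * α < β) (hT : 0 ≤ T)
    {γ₁ P₁ γ₂ P₂ : ℝ → ℝ → R2} (h₁ : IsHolderEvolution α β κ M c₁ T γ₁ P₁)
    (h₂ : IsHolderEvolution α β κ M c₂ T γ₂ P₂) : ∃ C, 0 ≤ C ∧ ∀ t ∈ Icc 0 T,
      ∫ x in (0:ℝ)..2 * π, |‖P₁ x t‖ - ‖P₂ x t‖| *
          |c₁ * (⟪P₁ x t, stretching α (γ₁ · t) (P₁ · t) x⟫ / ‖P₁ x t‖) -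
            c₂ * (⟪P₂ x t, stretching α (γ₂ · t) (P₂ · t) x⟫ / ‖P₂ x t‖)| ≤
        C * ∫ x in (0:ℝ)..2 * π, ‖P₁ x t - P₂ x t‖ ^ 2 := by
  have hκ := (h₁.loop 0).pos
  have hM := (h₁.loop 0).bound_nonneg
  have h2π : 0 ≤ 2 * π := by positivity
  by_cases hc : c₁ = c₂
  · subst hc
    obtain ⟨C, hC0, hC⟩ := exists_integral_stretching_sub_le hα hβ hκ hM
    refine ⟨C, hC0, fun t _ => ?_⟩
    have hc1 : |c₁| = 1 := by rcases h₁.orientation with e | e <;> simp [e]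
    simp_rw [← mul_sub, abs_mul, hc1, one_mul]
    exact hC _ _ _ _ (h₁.loop t) (h₂.loop t)
  · obtain ⟨B, hB0, hB⟩ := exists_norm_stretching_le hα hβ hκ hM
    obtain ⟨N, hN⟩ : ∃ N : ℝ → ℝ, ∀ t, N t = ∫ x in (0:ℝ)..2 * π, ‖P₁ x t - P₂ x t‖ ^ 2 :=
      ⟨_, fun _ => rfl⟩
    have hNc : Continuous N := by
      rw [funext hN]
      refine intervalIntegral.continuous_parametric_intervalIntegral_of_continuous' ?_ _ _
      exact (((h₁.continuous_deriv.comp continuous_swap).sub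
        (h₂.continuous_deriv.comp continuous_swap)).norm).pow 2
    have hNpos : ∀ t, 0 < N t := fun t => by
      rw [hN]
      refine integral_norm_sub_sq_pos (P₁ := (P₁ · t)) (P₂ := (P₂ · t))
        (h₁.loop t).continuous_deriv (h₂.loop t).continuous_deriv
        (h₁.loop t).periodic_deriv (h₂.loop t).periodic_deriv two_pi_pos fun he => hc ?_
      have l₁ := (h₁.loop t).toIsRegularLoop
      have l₂ := (h₂.loop t).toIsRegularLoop
      rw [← he] at l₂
      have ha := area_eq_of_deriv_eq l₁ l₂
      have a₁ := h₁.area_pos t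
      have a₂ := h₂.area_pos t
      simp_rw [← fun x => congrFun he x] at a₂
      rw [← ha] at a₂
      rcases h₁.orientation with e₁ | e₁ <;> rcases h₂.orientation with e₂ | e₂ <;>
        rw [e₁] at a₁ ⊢ <;> rw [e₂] at a₂ ⊢ <;> linarith
    obtain ⟨s, -, hs⟩ := isCompact_Icc.exists_isMinOn (nonempty_Icc.2 hT) hNc.continuousOn
    have hs0 := hNpos s
    refine ⟨2 * π * (2 * M * (2 * B)) / N s, by positivity, fun t ht => ?_⟩
    have hE : ∀ {c : ℝ} {γ P : ℝ → ℝ → R2}, IsHolderEvolution α β κ M c T γ P → ∀ x,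
        |c * (⟪P x t, stretching α (γ · t) (P · t) x⟫ / ‖P x t‖)| ≤ B := by
      intro c γ P h x
      have hp := hκ.trans_le ((h.loop t).le_norm_deriv x)
      have hc1 : |c| = 1 := by rcases h.orientation with e | e <;> simp [e]
      rw [abs_mul, hc1, one_mul, abs_div, abs_norm, div_le_iff₀ hp, mul_comm]
      exact (abs_real_inner_le_norm _ _).trans
        (mul_le_mul_of_nonneg_left (hB _ _ (h.loop t) x) (norm_nonneg _))
    have hb : ‖∫ x in (0:ℝ)..2 * π, |‖P₁ x t‖ - ‖P₂ x t‖| *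
          |c₁ * (⟪P₁ x t, stretching α (γ₁ · t) (P₁ · t) x⟫ / ‖P₁ x t‖) -
            c₂ * (⟪P₂ x t, stretching α (γ₂ · t) (P₂ · t) x⟫ / ‖P₂ x t‖)|‖ ≤
        2 * M * (2 * B) * |2 * π - 0| := by
      refine intervalIntegral.norm_integral_le_of_norm_le_const fun x _ => ?_
      rw [Real.norm_of_nonneg (by positivity)]
      have m₁ := (h₁.loop t).norm_deriv_le x
      have m₂ := (h₂.loop t).norm_deriv_le x
      have n₁ := norm_nonneg (P₁ x t)
      have n₂ := norm_nonneg (P₂ x t)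
      refine mul_le_mul (abs_le.2 ⟨by linarith, by linarith⟩)
        ((abs_sub _ _).trans ?_) (abs_nonneg _) (by positivity)
      linarith [hE h₁ x, hE h₂ x]
    have hm := isMinOn_iff.1 hs t ht
    rw [← hN]
    rw [sub_zero, abs_of_nonneg h2π] at hb
    refine (Real.le_norm_self _).trans (hb.trans ?_)
    rw [div_mul_eq_mul_div, le_div_iff₀ hs0]
    rw [mul_comm (2 * M * (2 * B))]
    exact mul_le_mul_of_nonneg_left hm (by positivity)

lemma exists_integral_norm_sub_sq_le {α β κ M c₁ c₂ T : ℝ} (hα : 0 < α) (hβ : 2 * α < β)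
    (hT : 0 ≤ T) {γ₁ P₁ γ₂ P₂ : ℝ → ℝ → R2} (h₁ : IsHolderEvolution α β κ M c₁ T γ₁ P₁)
    (h₂ : IsHolderEvolution α β κ M c₂ T γ₂ P₂) : ∃ C, 0 ≤ C ∧ ∀ t ∈ Icc 0 T,
      ∫ x in (0:ℝ)..2 * π, (‖P₁ x t‖ - ‖P₂ x t‖) ^ 2 ≤
        (∫ x in (0:ℝ)..2 * π, (‖P₁ x 0‖ - ‖P₂ x 0‖) ^ 2) +
          C * ∫ τ in (0:ℝ)..t, ∫ x in (0:ℝ)..2 * π, ‖P₁ x τ - P₂ x τ‖ ^ 2 := by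
  obtain ⟨C, hC0, hC⟩ := exists_integral_rate_le hα hβ hT h₁ h₂
  refine ⟨2 * C, by positivity, fun t ht => ?_⟩
  have h2π : 0 ≤ 2 * π := by positivity
  have hE : ∀ {c : ℝ} {γ P : ℝ → ℝ → R2}, IsHolderEvolution α β κ M c T γ P →
      Continuous fun q : ℝ × ℝ =>
        c * (⟪P q.1 q.2, stretching α (γ · q.2) (P · q.2) q.1⟫ / ‖P q.1 q.2‖) := by
    intro c γ P h
    refine continuous_const.mul (Continuous.div
      (h.continuous_deriv.inner (h.continuous_stretching hα hβ)) h.continuous_deriv.norm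
      fun q => ?_)
    exact norm_ne_zero_iff.2 ((h.loop q.2).deriv_ne_zero q.1)
  have hd₁ := fun τ (hτ : τ ∈ Ioo 0 T) x => h₁.hasDerivAt_norm_deriv hα hβ hτ x
  have hd₂ := fun τ (hτ : τ ∈ Ioo 0 T) x => h₂.hasDerivAt_norm_deriv hα hβ hτ x
  have hE₁ := hE h₁
  have hE₂ := hE h₂
  obtain ⟨E, hEdef⟩ : ∃ E : ℝ → ℝ → ℝ, ∀ x t, E x t =
      c₁ * (⟪P₁ x t, stretching α (γ₁ · t) (P₁ · t) x⟫ / ‖P₁ x t‖) -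
        c₂ * (⟪P₂ x t, stretching α (γ₂ · t) (P₂ · t) x⟫ / ‖P₂ x t‖) := ⟨_, fun _ _ => rfl⟩
  obtain ⟨k, hk⟩ : ∃ k : ℝ → ℝ → ℝ, ∀ x t, k x t = ‖P₁ x t‖ - ‖P₂ x t‖ := ⟨_, fun _ _ => rfl⟩
  simp_rw [← hEdef, ← hk] at hC
  have hEc : Continuous (uncurry E) := by
    have : uncurry E = fun q : ℝ × ℝ => E q.1 q.2 := rfl
    rw [this]
    simp_rw [hEdef]
    exact hE₁.sub hE₂
  have hkc : Continuous (uncurry k) := by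
    have : uncurry k = fun q : ℝ × ℝ => k q.1 q.2 := rfl
    rw [this]
    simp_rw [hk]
    exact h₁.continuous_deriv.norm.sub h₂.continuous_deriv.norm
  have hkd : ∀ τ ∈ Ioo 0 T, ∀ x, HasDerivAt (k x) (E x τ) τ := fun τ hτ x => by
    rw [hEdef, funext (hk x)]
    exact (hd₁ τ hτ x).sub (hd₂ τ hτ x)
  have hkEc : Continuous (uncurry fun x τ => 2 * (k x τ * E x τ)) :=
    continuous_const.mul (hkc.mul hEc)
  have hdiff : ∀ x, k x t ^ 2 = k x 0 ^ 2 + ∫ τ in (0:ℝ)..t, 2 * (k x τ * E x τ) := by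
    intro x
    have hkx : Continuous (k x) := hkc.comp (Continuous.prodMk_right x)
    have hi : Continuous fun τ => 2 * (k x τ * E x τ) := hkEc.comp (Continuous.prodMk_right x)
    rw [intervalIntegral.integral_eq_sub_of_hasDerivAt_of_le ht.1 (f := fun τ => k x τ ^ 2)
      (hkx.pow 2).continuousOn (fun τ hτ => ?_)
      (hi.intervalIntegrable _ _)]
    · ring
    · refine ((hkd τ ⟨hτ.1, hτ.2.trans_le ht.2⟩ x).pow 2).congr_deriv ?_
      push_cast; ring
  have hintc : ∀ {f : ℝ → ℝ → ℝ}, Continuous (uncurry f) →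
      Continuous fun τ => ∫ x in (0:ℝ)..2 * π, f x τ := by
    intro f hf
    refine intervalIntegral.continuous_parametric_intervalIntegral_of_continuous' ?_ _ _
    exact hf.comp continuous_swap
  have hNc : Continuous (uncurry fun x τ => ‖P₁ x τ - P₂ x τ‖ ^ 2) :=
    (h₁.continuous_deriv.sub h₂.continuous_deriv).norm.pow 2
  have hrate : ∀ τ ∈ Icc 0 t, ∫ x in (0:ℝ)..2 * π, 2 * (k x τ * E x τ) ≤
      2 * C * ∫ x in (0:ℝ)..2 * π, ‖P₁ x τ - P₂ x τ‖ ^ 2 := by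
    intro τ hτ
    have hkτ : Continuous fun x => k x τ := hkc.comp (Continuous.prodMk_left τ)
    have hEτ : Continuous fun x => E x τ := hEc.comp (Continuous.prodMk_left τ)
    rw [intervalIntegral.integral_const_mul, mul_assoc]
    refine mul_le_mul_of_nonneg_left (le_trans ?_ (hC τ ⟨hτ.1, hτ.2.trans ht.2⟩)) zero_le_two
    refine intervalIntegral.integral_mono_on h2π (Continuous.intervalIntegrable (by fun_prop) _ _)
      (Continuous.intervalIntegrable (by fun_prop) _ _) fun x _ => ?_
    rw [← abs_mul]
    exact le_abs_self _
  simp_rw [← hk, hdiff]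
  have hk0 : Continuous fun x => k x 0 := hkc.comp (Continuous.prodMk_left 0)
  have hJc : Continuous fun x => ∫ τ in (0:ℝ)..t, 2 * (k x τ * E x τ) :=
    intervalIntegral.continuous_parametric_intervalIntegral_of_continuous' hkEc _ _
  rw [intervalIntegral.integral_add (Continuous.intervalIntegrable (by fun_prop) _ _)
    (hJc.intervalIntegrable _ _), integral_swap_of_continuous hkEc,
    ← intervalIntegral.integral_const_mul]
  exact add_le_add_right (intervalIntegral.integral_mono_on ht.1
    ((hintc hkEc).intervalIntegrable _ _)
    (((hintc hNc).const_mul _).intervalIntegrable _ _) hrate) _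

lemma norm_sub_sq_le {a b : R2} {M : ℝ} (ha : a ≠ 0) (hb : b ≠ 0) (hM : ‖a‖ ≤ M) :
    ‖a - b‖ ^ 2 ≤ (2 * M ^ 2 + 2) *
      (‖‖a‖⁻¹ • a - ‖b‖⁻¹ • b‖ ^ 2 + ‖‖a‖ - ‖b‖‖ ^ 2) := by
  have hna := norm_ne_zero_iff.2 ha
  have hnb := norm_ne_zero_iff.2 hb
  have e : a - b = ‖a‖ • (‖a‖⁻¹ • a - ‖b‖⁻¹ • b) + (‖a‖ - ‖b‖) • (‖b‖⁻¹ • b) := by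
    rw [smul_sub, sub_smul, smul_smul, smul_smul ‖b‖, mul_inv_cancel₀ hna, mul_inv_cancel₀ hnb,
      one_smul, one_smul]
    abel
  have h1 : ‖a - b‖ ≤ M * ‖‖a‖⁻¹ • a - ‖b‖⁻¹ • b‖ + ‖‖a‖ - ‖b‖‖ := by
    calc ‖a - b‖ ≤ _ := (congrArg norm e).le.trans (norm_add_le _ _)
      _ = ‖a‖ * ‖‖a‖⁻¹ • a - ‖b‖⁻¹ • b‖ + ‖‖a‖ - ‖b‖‖ := by
        rw [norm_smul, norm_smul _ (‖b‖⁻¹ • b), norm_norm, norm_smul, norm_inv, norm_norm,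
          inv_mul_cancel₀ hnb, mul_one]
      _ ≤ _ := by gcongr
  generalize ‖‖a‖⁻¹ • a - ‖b‖⁻¹ • b‖ = p at *
  generalize ‖‖a‖ - ‖b‖‖ = q at *
  have h2 := pow_le_pow_left₀ (norm_nonneg _) h1 2
  nlinarith [sq_nonneg (M * p - q), sq_nonneg (M * q), sq_nonneg p]

lemma L2sq_eq_intervalIntegral {E : Type*} [NormedAddCommGroup E] (f : ℝ → E) :
    L2sq f = ∫ x in (0:ℝ)..2 * π, ‖f x‖ ^ 2 := by
  rw [L2sq, intervalIntegral.integral_of_le (by positivity)]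

/-- **Proposition 5.3, estimate (5.2) (stability of the arc-length evolution)**: for
`0 < α < 1/2` and `β > 2α`, if `γ₁, γ₂` are `C^{1,β}` flows of two `C^{1,β}` patch
solutions of α-SQG, then
`|g₁(t)-g₂(t)|²_{L²} ≤ |g₁(0)-g₂(0)|²_{L²} + C ∫₀ᵗ (|T₁-T₂|²_{L²} + |g₁-g₂|²_{L²}) dτ`. -/
theorem metric_stability (α β T : ℝ) (hα0 : 0 < α) (hα : α < 1/2)
    (hβ : 2 * α < β) (hT : 0 ≤ T)
    (Ω₁ Ω₂ : ℝ → Set R2) (γ₁ γ₂ : ℝ → ℝ → R2)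
    (hΩ₁ : IsC1BetaPatchSol α T β Ω₁) (hΩ₂ : IsC1BetaPatchSol α T β Ω₂)
    (hγ₁ : IsC1BetaFlow α β T Ω₁ γ₁) (hγ₂ : IsC1BetaFlow α β T Ω₂ γ₂) :
    ∃ C > (0:ℝ), ∀ t ∈ Icc (0:ℝ) T,
      L2sq (fun x => metricOf γ₁ x t - metricOf γ₂ x t) ≤
        L2sq (fun x => metricOf γ₁ x 0 - metricOf γ₂ x 0) +
        C * ∫ τ in (0:ℝ)..t,
          (L2sq (fun x => tangentOf γ₁ x τ - tangentOf γ₂ x τ) +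
            L2sq (fun x => metricOf γ₁ x τ - metricOf γ₂ x τ)) := by
  obtain ⟨κ₁, M₁, c₁, G₁, P₁, h₁, hP₁⟩ := exists_holderEvolution hα0 hα hβ hT hΩ₁.1 hγ₁
  obtain ⟨κ₂, M₂, c₂, G₂, P₂, h₂, hP₂⟩ := exists_holderEvolution hα0 hα hβ hT hΩ₂.1 hγ₂
  have hκ := lt_min (h₁.loop 0).pos (h₂.loop 0).pos
  have h₁ := h₁.mono hκ (min_le_left _ _) (le_max_left M₁ M₂)
  have h₂ := h₂.mono hκ (min_le_right _ _) (le_max_right M₁ M₂)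
  generalize min κ₁ κ₂ = κ at *
  generalize max M₁ M₂ = M at *
  obtain ⟨C, hC0, hC⟩ := exists_integral_norm_sub_sq_le hα0 hβ hT h₁ h₂
  have hne₁ : ∀ x t, P₁ x t ≠ 0 := fun x t => (h₁.loop t).deriv_ne_zero x
  have hne₂ : ∀ x t, P₂ x t ≠ 0 := fun x t => (h₂.loop t).deriv_ne_zero x
  have hc₁ := h₁.continuous_deriv
  have hc₂ := h₂.continuous_deriv
  obtain ⟨N, hN⟩ : ∃ N : ℝ → ℝ → ℝ, ∀ x τ, N x τ = ‖P₁ x τ - P₂ x τ‖ ^ 2 :=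
    ⟨_, fun _ _ => rfl⟩
  obtain ⟨A, hA⟩ : ∃ A : ℝ → ℝ → ℝ, ∀ x τ,
      A x τ = ‖‖P₁ x τ‖⁻¹ • P₁ x τ - ‖P₂ x τ‖⁻¹ • P₂ x τ‖ ^ 2 := ⟨_, fun _ _ => rfl⟩
  obtain ⟨B, hB⟩ : ∃ B : ℝ → ℝ → ℝ, ∀ x τ, B x τ = ‖‖P₁ x τ‖ - ‖P₂ x τ‖‖ ^ 2 :=
    ⟨_, fun _ _ => rfl⟩
  have hNc : Continuous (uncurry N) :=
    ((hc₁.sub hc₂).norm.pow 2).congr fun q => (hN q.1 q.2).symm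
  have hAc : Continuous (uncurry A) :=
    ((((hc₁.norm.inv₀ fun q => norm_ne_zero_iff.2 (hne₁ q.1 q.2)).smul hc₁).sub
      ((hc₂.norm.inv₀ fun q => norm_ne_zero_iff.2 (hne₂ q.1 q.2)).smul hc₂)).norm.pow 2).congr
      fun q => (hA q.1 q.2).symm
  have hBc : Continuous (uncurry B) :=
    ((hc₁.norm.sub hc₂.norm).norm.pow 2).congr fun q => (hB q.1 q.2).symm
  have hslice : ∀ {f : ℝ → ℝ → ℝ}, Continuous (uncurry f) → ∀ τ,
      IntervalIntegrable (fun x => f x τ) volume 0 (2 * π) := fun hf τ =>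
    Continuous.intervalIntegrable (hf.comp (Continuous.prodMk_left τ)) _ _
  have hintc : ∀ {f : ℝ → ℝ → ℝ}, Continuous (uncurry f) →
      Continuous fun τ => ∫ x in (0:ℝ)..2 * π, f x τ := by
    intro f hf
    refine intervalIntegral.continuous_parametric_intervalIntegral_of_continuous' ?_ _ _
    exact hf.comp continuous_swap
  have h2π : 0 ≤ 2 * π := by positivity
  have hg : ∀ t ∈ Icc (0:ℝ) T, L2sq (fun x => metricOf γ₁ x t - metricOf γ₂ x t) =
      ∫ x in (0:ℝ)..2 * π, B x t := fun t ht => by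
    simp_rw [L2sq_eq_intervalIntegral, metricOf, ← hP₁ t ht, ← hP₂ t ht, hB]
  have hτ : ∀ t ∈ Icc (0:ℝ) T, L2sq (fun x => tangentOf γ₁ x t - tangentOf γ₂ x t) =
      ∫ x in (0:ℝ)..2 * π, A x t := fun t ht => by
    simp_rw [L2sq_eq_intervalIntegral, tangentOf, metricOf, ← hP₁ t ht, ← hP₂ t ht, hA]
  refine ⟨C * (2 * M ^ 2 + 2) + 1, by positivity, fun t ht => ?_⟩
  have hrhs : ∫ τ in (0:ℝ)..t, (L2sq (fun x => tangentOf γ₁ x τ - tangentOf γ₂ x τ) +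
      L2sq (fun x => metricOf γ₁ x τ - metricOf γ₂ x τ)) =
      ∫ τ in (0:ℝ)..t, ((∫ x in (0:ℝ)..2 * π, A x τ) + ∫ x in (0:ℝ)..2 * π, B x τ) := by
    refine intervalIntegral.integral_congr fun τ h => ?_
    rw [uIcc_of_le ht.1] at h
    have hτT : τ ∈ Icc 0 T := ⟨h.1, h.2.trans ht.2⟩
    simp only [hg τ hτT, hτ τ hτT]
  rw [hg t ht, hg 0 ⟨le_rfl, hT⟩, hrhs]
  have hmain := hC t ht
  simp_rw [← hN, ← sq_abs (‖P₁ _ _‖ - _), ← Real.norm_eq_abs, ← hB] at hmain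
  have hpt : ∀ τ, ∫ x in (0:ℝ)..2 * π, N x τ ≤ (2 * M ^ 2 + 2) *
      ((∫ x in (0:ℝ)..2 * π, A x τ) + ∫ x in (0:ℝ)..2 * π, B x τ) := fun τ => by
    rw [← intervalIntegral.integral_add (hslice hAc τ) (hslice hBc τ),
      ← intervalIntegral.integral_const_mul]
    refine intervalIntegral.integral_mono_on h2π (hslice hNc τ)
      (((hslice hAc τ).add (hslice hBc τ)).const_mul _) fun x _ => ?_
    rw [hN, hA, hB]
    exact norm_sub_sq_le (hne₁ x τ) (hne₂ x τ) ((h₁.loop τ).norm_deriv_le x)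
  have hABc : Continuous fun τ => (∫ x in (0:ℝ)..2 * π, A x τ) + ∫ x in (0:ℝ)..2 * π, B x τ :=
    (hintc hAc).add (hintc hBc)
  have hNAB : ∫ τ in (0:ℝ)..t, ∫ x in (0:ℝ)..2 * π, N x τ ≤ (2 * M ^ 2 + 2) *
      ∫ τ in (0:ℝ)..t, ((∫ x in (0:ℝ)..2 * π, A x τ) + ∫ x in (0:ℝ)..2 * π, B x τ) := by
    rw [← intervalIntegral.integral_const_mul]
    exact intervalIntegral.integral_mono_on ht.1 ((hintc hNc).intervalIntegrable _ _)
      ((hABc.const_mul _).intervalIntegrable _ _) fun τ _ => hpt τ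
  have hnn : 0 ≤ ∫ τ in (0:ℝ)..t,
      ((∫ x in (0:ℝ)..2 * π, A x τ) + ∫ x in (0:ℝ)..2 * π, B x τ) :=
    intervalIntegral.integral_nonneg ht.1 fun τ _ => add_nonneg
      (intervalIntegral.integral_nonneg h2π fun x _ => hA x τ ▸ by positivity)
      (intervalIntegral.integral_nonneg h2π fun x _ => hB x τ ▸ by positivity)
  have hCN := mul_le_mul_of_nonneg_left hNAB hC0
  linarith
end
end

section
/- Let 0<α<1/2 and β>2α. Let γ : ℝ → ℝ² be a 2π-periodic, continuously differentiable map, injective on [0,2π), with arc-length metric g := ‖γ'‖ satisfying g(x) ≥ c > 0 for all x, unit tangent T := γ'/g, such that T and g are β-Hölder continuous and the chord-arc condition ‖γ(x)−γ(y)‖ ≥ c·d(x,y) holds, where d(x,y) := min_{k∈ℤ} |x−y−2πk|. Define K(y,x) := g(y)·((γ(x)−γ(y))·T(x))/‖γ(x)−γ(y)‖^{2+2α}. Then there exists a constant C (depending only on α, β, c, the β-Hölder constants of T and g, and sup g) such that |K(y,x) + K(x,y)| ≤ C·|x−y|^{−1+β−2α} for all x, y with 0 < |x−y| ≤ π. 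-/
open MeasureTheory Real Set Function Filter Bornology
open scoped RealInnerProductSpace Topology

noncomputable section

/-- Unit tangent of a parametrized curve. -/
def tangent1 (γ : ℝ → R2) (x : ℝ) : R2 := (‖deriv γ x‖)⁻¹ • deriv γ x

/-- The distance on the torus `ℝ/2πℤ`: `d(x,y) = min_{k∈ℤ} |x-y-2πk|`. -/
def perDist (x y : ℝ) : ℝ := ⨅ k : ℤ, |x - y - 2 * π * (k:ℝ)|

/-- The kernel `K(y,x) = g(y) (γ(x)-γ(y))·T(x) / ‖γ(x)-γ(y)‖^{2+2α}`. -/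
def kerK (α : ℝ) (γ : ℝ → R2) (y x : ℝ) : ℝ :=
  ‖deriv γ y‖ * (⟪γ x - γ y, tangent1 γ x⟫ / ‖γ x - γ y‖ ^ (2 + 2 * α))

/-- On pairs at distance at most `π`, the torus distance dominates the distance on the line. -/
theorem abs_sub_le_perDist {x y : ℝ} (h : |x - y| ≤ π) : |x - y| ≤ perDist x y := by
  refine le_ciInf fun k => ?_
  rcases eq_or_ne k 0 with rfl | hk
  · simp
  have hk1 : (1 : ℝ) ≤ |(k : ℝ)| := by exact_mod_cast Int.one_le_abs hk
  have hπ := Real.pi_pos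
  have h1 : |2 * π * (k : ℝ)| - |x - y| ≤ |x - y - 2 * π * (k : ℝ)| := by
    rw [abs_sub_comm (x - y)]
    exact abs_sub_abs_le_abs_sub _ _
  rw [abs_mul, abs_of_pos (by positivity : (0 : ℝ) < 2 * π)] at h1
  nlinarith

/-- The symmetrized kernel, with the singular denominator factored out. -/
theorem kerK_add_kerK_swap (α : ℝ) (γ : ℝ → R2) (x y : ℝ) :
    kerK α γ y x + kerK α γ x y =
      ⟪γ x - γ y, (‖deriv γ y‖ - ‖deriv γ x‖) • tangent1 γ x +
        ‖deriv γ x‖ • (tangent1 γ x - tangent1 γ y)⟫ / ‖γ x - γ y‖ ^ (2 + 2 * α) := by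
  have h : γ y - γ x = -(γ x - γ y) := (neg_sub _ _).symm
  unfold kerK
  rw [norm_sub_rev (γ y), h, inner_neg_left, inner_add_right, inner_smul_right,
    inner_smul_right, inner_sub_right]
  ring

/-- The unit tangent has norm at most one. -/
theorem norm_tangent1_le_one (γ : ℝ → R2) (x : ℝ) : ‖tangent1 γ x‖ ≤ 1 := by
  rw [tangent1, norm_smul, norm_inv, norm_norm]
  exact inv_mul_le_one

/-- **Lemma 5.1, estimate (5.4) (odd-symmetry bound for the kernel)**: for
`0 < α < 1/2` and `β > 2α`, and any `2π`-periodic `C¹` chord-arc curve `γ` with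
`β`-Hölder tangent and arc-length metric (with constants `c`, `A`), the kernel
`K(y,x) = g(y)(γ(x)-γ(y))·T(x)/‖γ(x)-γ(y)‖^{2+2α}` satisfies
`|K(y,x)+K(x,y)| ≤ C |x-y|^{-1+β-2α}` for `0 < |x-y| ≤ π`,
with `C = C(α,β,c,A)`. -/
theorem kernel_odd_symmetry_bound (α β c A : ℝ) (hα0 : 0 < α) (hα : α < 1/2)
    (hβ : 2 * α < β) (hc : 0 < c) :
    ∃ C : ℝ, ∀ γ : ℝ → R2,
      Periodic γ (2 * π) → ContDiff ℝ 1 γ → InjOn γ (Ico 0 (2 * π)) →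
      (∀ x : ℝ, c ≤ ‖deriv γ x‖) → (∀ x : ℝ, ‖deriv γ x‖ ≤ A) →
      (∀ x y : ℝ, ‖tangent1 γ x - tangent1 γ y‖ ≤ A * |x - y| ^ β) →
      (∀ x y : ℝ, |‖deriv γ x‖ - ‖deriv γ y‖| ≤ A * |x - y| ^ β) →
      (∀ x y : ℝ, c * perDist x y ≤ ‖γ x - γ y‖) →
      ∀ x y : ℝ, 0 < |x - y| → |x - y| ≤ π →
        |kerK α γ y x + kerK α γ x y| ≤ C * |x - y| ^ (-1 + β - 2 * α) := by
  refine ⟨(A + A * A) * c ^ (-1 - 2 * α), ?_⟩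
  intro γ _ _ _ hg hgA hT hH hca x y hpos hle
  have hA : 0 < A := hc.trans_le ((hg x).trans (hgA x))
  have hchord : c * |x - y| ≤ ‖γ x - γ y‖ :=
    (mul_le_mul_of_nonneg_left (abs_sub_le_perDist hle) hc.le).trans (hca x y)
  have hct : 0 < c * |x - y| := mul_pos hc hpos
  have hΔ : 0 < ‖γ x - γ y‖ := hct.trans_le hchord
  have hv : ‖(‖deriv γ y‖ - ‖deriv γ x‖) • tangent1 γ x +
      ‖deriv γ x‖ • (tangent1 γ x - tangent1 γ y)‖ ≤ (A + A * A) * |x - y| ^ β := by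
    refine (norm_add_le _ _).trans ?_
    rw [norm_smul, norm_smul, norm_norm, Real.norm_eq_abs, abs_sub_comm, add_mul, mul_assoc]
    refine add_le_add ?_ (mul_le_mul (hgA x) (hT x y) (norm_nonneg _) hA.le)
    exact (mul_le_of_le_one_right (abs_nonneg _) (norm_tangent1_le_one γ x)).trans (hH x y)
  rw [kerK_add_kerK_swap, abs_div, abs_of_pos (rpow_pos_of_pos hΔ (2 + 2 * α))]
  calc _ ≤ ‖γ x - γ y‖ * ((A + A * A) * |x - y| ^ β) / ‖γ x - γ y‖ ^ (2 + 2 * α) := by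
        gcongr
        exact (abs_real_inner_le_norm _ _).trans (mul_le_mul_of_nonneg_left hv hΔ.le)
    _ = (A + A * A) * |x - y| ^ β * ‖γ x - γ y‖ ^ (-1 - 2 * α) := by
        rw [show -1 - 2 * α = 1 - (2 + 2 * α) by ring, rpow_sub hΔ, rpow_one]
        ring
    _ ≤ (A + A * A) * |x - y| ^ β * (c * |x - y|) ^ (-1 - 2 * α) := by
        gcongr ?_ * ?_
        exact rpow_le_rpow_of_nonpos hct hchord (by linarith)
    _ = (A + A * A) * c ^ (-1 - 2 * α) * |x - y| ^ (-1 + β - 2 * α) := by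
        rw [mul_rpow hc.le hpos.le, show -1 + β - 2 * α = β + (-1 - 2 * α) by ring,
          rpow_add hpos]
        ring
end
end

section
/- Let 0<α<1/2 and β>2α. Let γ : ℝ → ℝ² be a 2π-periodic, continuously differentiable map, injective on [0,2π), with arc-length metric g := ‖γ'‖ ≥ c > 0, unit tangent T := γ'/g, with T and g β-Hölder, satisfying the chord-arc condition ‖γ(x)−γ(y)‖ ≥ c·d(x,y) where d(x,y) := min_{k∈ℤ}|x−y−2πk|. Define K(y,x) := g(y)·((γ(x)−γ(y))·T(x))/‖γ(x)−γ(y)‖^{2+2α}. Then there is a constant C (depending on α, β, c and the Hölder constants and bounds of T, g) such that for every 2π-periodic β-Hölder function a : ℝ → ℝ: (i) for every x the principal value lim_{ε→0⁺} ∫_{{y∈[x−π,x+π] : |y−x|≥ε}} a(y)·K(y,x) dy exists and has absolute value at most C·‖a‖_{C^β}; and (ii) for every y the principal value lim_{ε→0⁺} ∫_{{x∈[y−π,y+π] : |x−y|≥ε}} a(x)·K(y,x) dx exists and has absolute value at most C·‖a‖_{C^β}. Here ‖a‖_{C^β} is the sup norm plus the β-Hölder seminorm of a. -/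
open MeasureTheory Real Set Function Filter Bornology
open scoped RealInnerProductSpace Topology

noncomputable section

/-- `|y - p|^e` is integrable around `p` for `e > -1`. -/
theorem integrableOn_abs_sub_rpow {e : ℝ} (he : -1 < e) (p : ℝ) :
    IntegrableOn (fun y : ℝ => |y - p| ^ e) (Icc (p - π) (p + π)) := by
  have hpi := Real.pi_pos
  have h1 : IntervalIntegrable (fun y : ℝ => |y| ^ e) volume 0 π := by
    refine (intervalIntegral.intervalIntegrable_rpow' (a := 0) (b := π) he).congr ?_
    intro y hy
    rw [uIoc_of_le hpi.le] at hy
    simp only [abs_of_pos hy.1]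
  have h2 : IntervalIntegrable (fun y : ℝ => |y| ^ e) volume (-π) 0 := by
    have := (IntervalIntegrable.iff_comp_neg (by simp)).1 h1
    simpa using this.symm
  have h3 := (h2.trans h1).comp_sub_right p (by simp)
  rw [intervalIntegrable_iff_integrableOn_Icc_of_le (by linarith)] at h3
  rwa [show -π + p = p - π by ring, add_comm π p] at h3

theorem setIntegral_abs_sub_rpow (e p : ℝ) :
    ∫ y in Icc (p - π) (p + π), |y - p| ^ e = ∫ y in Icc (-π) π, |y| ^ e := by
  have hpi := Real.pi_pos
  rw [integral_Icc_eq_integral_Ioc, integral_Icc_eq_integral_Ioc,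
    ← intervalIntegral.integral_of_le (by linarith),
    ← intervalIntegral.integral_of_le (by linarith),
    intervalIntegral.integral_comp_sub_right (fun y : ℝ => |y| ^ e) p]
  congr 1 <;> ring

theorem measurableSet_truncation (p ε : ℝ) :
    MeasurableSet {y : ℝ | y ∈ Icc (p - π) (p + π) ∧ ε ≤ |y - p|} :=
  measurableSet_Icc.inter
    (measurableSet_le measurable_const (by fun_prop : Measurable fun y : ℝ => |y - p|))

/-- The odd singular kernel has vanishing integral over symmetric truncations. -/
theorem setIntegral_odd_kernel (p s ε : ℝ) :
    ∫ y in {y : ℝ | y ∈ Icc (p - π) (p + π) ∧ ε ≤ |y - p|}, (y - p) / |y - p| ^ s = 0 := by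
  rw [← integral_indicator (measurableSet_truncation p ε)]
  set F : ℝ → ℝ := indicator {y : ℝ | y ∈ Icc (p - π) (p + π) ∧ ε ≤ |y - p|}
    (fun y => (y - p) / |y - p| ^ s) with hF
  have h1 := integral_sub_left_eq_self F volume (2 * p)
  have h2 : ∀ y, F (2 * p - y) = - F y := by
    intro y
    have ha : 2 * p - y - p = -(y - p) := by ring
    by_cases hy : y ∈ {y : ℝ | y ∈ Icc (p - π) (p + π) ∧ ε ≤ |y - p|}
    · have hy' : 2 * p - y ∈ {y : ℝ | y ∈ Icc (p - π) (p + π) ∧ ε ≤ |y - p|} := by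
        refine ⟨⟨by linarith [hy.1.2], by linarith [hy.1.1]⟩, ?_⟩
        rw [ha, abs_neg]
        exact hy.2
      rw [hF, indicator_of_mem hy, indicator_of_mem hy', ha, abs_neg, neg_div]
    · have hy' : 2 * p - y ∉ {y : ℝ | y ∈ Icc (p - π) (p + π) ∧ ε ≤ |y - p|} := by
        intro h
        refine hy ⟨⟨by linarith [h.1.2], by linarith [h.1.1]⟩, ?_⟩
        have := h.2
        rwa [ha, abs_neg] at this
      rw [hF, indicator_of_notMem hy, indicator_of_notMem hy', neg_zero]
  simp only [h2, integral_neg] at h1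
  linarith

/-- A function which differs from an odd singular kernel by an integrable power has a
principal value, controlled by the difference alone. -/
theorem exists_principal_value {e s m D p : ℝ} (he : -1 < e) (hs : 0 ≤ s) (f : ℝ → ℝ)
    (hf : Measurable f)
    (hfb : ∀ y, y ≠ p → |y - p| ≤ π →
      |f y - m * ((y - p) / |y - p| ^ s)| ≤ D * |y - p| ^ e) :
    ∃ I : ℝ, Tendsto (fun ε : ℝ =>
        ∫ y in {y : ℝ | y ∈ Icc (p - π) (p + π) ∧ ε ≤ |y - p|}, f y) (𝓝[>] (0:ℝ)) (𝓝 I) ∧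
      |I| ≤ D * ∫ y in Icc (-π) π, |y| ^ e := by
  set r : ℝ → ℝ := fun y => f y - m * ((y - p) / |y - p| ^ s) with hr
  have hrm : Measurable r := by
    rw [hr]
    fun_prop
  have hbi : IntegrableOn (fun y : ℝ => D * |y - p| ^ e) (Icc (p - π) (p + π)) :=
    (integrableOn_abs_sub_rpow he p).const_mul D
  have habs : ∀ y ∈ Icc (p - π) (p + π), |y - p| ≤ π := fun y hy =>
    abs_le.2 ⟨by linarith [hy.1], by linarith [hy.2]⟩
  have hne : ∀ᵐ y : ℝ, y ≠ p := by
    simp [ae_iff]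
  have hrb : ∀ᵐ y ∂(volume.restrict (Icc (p - π) (p + π))), ‖r y‖ ≤ D * |y - p| ^ e := by
    rw [ae_restrict_iff' measurableSet_Icc]
    filter_upwards [hne] with y hy hyI
    exact hfb y hy (habs y hyI)
  have hri : IntegrableOn r (Icc (p - π) (p + π)) :=
    Integrable.mono' hbi hrm.aestronglyMeasurable hrb
  refine ⟨∫ y in Icc (p - π) (p + π), r y, ?_, ?_⟩
  · have hlim : Tendsto (fun ε : ℝ => ∫ y in Icc (p - π) (p + π),
        indicator {y : ℝ | ε ≤ |y - p|} r y) (𝓝[>] (0:ℝ))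
        (𝓝 (∫ y in Icc (p - π) (p + π), r y)) := by
      have hms : ∀ ε : ℝ, MeasurableSet {y : ℝ | ε ≤ |y - p|} := fun ε =>
        measurableSet_le measurable_const (by fun_prop)
      refine tendsto_integral_filter_of_dominated_convergence (fun y => D * |y - p| ^ e)
        ?_ ?_ hbi ?_
      · exact Eventually.of_forall fun ε => (hrm.indicator (hms ε)).aestronglyMeasurable
      · refine Eventually.of_forall fun ε => ?_
        filter_upwards [hrb] with y hy
        exact (norm_indicator_le_norm_self r y).trans hy
      · filter_upwards [ae_restrict_of_ae hne] with y hy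
        refine tendsto_const_nhds.congr' ?_
        have : 0 < |y - p| := abs_pos.2 (sub_ne_zero.2 hy)
        filter_upwards [nhdsWithin_le_nhds (Iio_mem_nhds this)] with ε hε
        rw [indicator_of_mem]
        exact (show ε < |y - p| from hε).le
    refine hlim.congr' ?_
    filter_upwards [self_mem_nhdsWithin] with ε hε
    have hε : 0 < ε := hε
    have hST : {y : ℝ | y ∈ Icc (p - π) (p + π) ∧ ε ≤ |y - p|} =
      Icc (p - π) (p + π) ∩ {y : ℝ | ε ≤ |y - p|} := rfl
    rw [setIntegral_indicator (measurableSet_le measurable_const (by fun_prop)), ← hST]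
    have hφi : IntegrableOn (fun y : ℝ => m * ((y - p) / |y - p| ^ s))
        {y : ℝ | y ∈ Icc (p - π) (p + π) ∧ ε ≤ |y - p|} := by
      refine Integrable.const_mul ?_ m
      refine Measure.integrableOn_of_bounded (M := π / ε ^ s) ?_
        (Measurable.aestronglyMeasurable (by fun_prop)) ?_
      · exact ((measure_mono inter_subset_left).trans_lt measure_Icc_lt_top).ne
      · rw [ae_restrict_iff' (measurableSet_truncation p ε)]
        refine Eventually.of_forall fun y hy => ?_
        have h0 : 0 < ε ^ s := Real.rpow_pos_of_pos hε s
        have h1 : ε ^ s ≤ |y - p| ^ s := Real.rpow_le_rpow hε.le hy.2 hs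
        rw [norm_div, Real.norm_eq_abs, Real.norm_eq_abs, abs_of_pos (h0.trans_le h1)]
        exact div_le_div₀ Real.pi_pos.le (habs y hy.1) h0 h1
    have hfr : ∀ y, f y = r y + m * ((y - p) / |y - p| ^ s) := fun y => by
      simp only [hr]; ring
    simp only [hfr]
    rw [integral_add (hri.mono_set (by rw [hST]; exact inter_subset_left)) hφi, integral_const_mul,
      setIntegral_odd_kernel, mul_zero, add_zero]
  · rw [← setIntegral_abs_sub_rpow e p, ← integral_const_mul]
    exact norm_integral_le_of_norm_le hbi hrb

theorem perDist_eq_abs {x y : ℝ} (h : |x - y| ≤ π) : perDist x y = |x - y| := by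
  have hpi := Real.pi_pos
  unfold perDist
  refine le_antisymm ?_ (le_ciInf fun k => ?_)
  · refine (ciInf_le ⟨0, ?_⟩ (0 : ℤ)).trans (by simp)
    rintro _ ⟨k, rfl⟩
    exact abs_nonneg _
  · rcases eq_or_ne k 0 with rfl | hk
    · simp
    · have h1 : (1 : ℝ) ≤ |(k : ℝ)| := by exact_mod_cast Int.one_le_abs hk
      have h2 : |2 * π * (k : ℝ)| = 2 * π * |(k : ℝ)| := by
        rw [abs_mul, abs_of_pos (by positivity)]
      have h3 := abs_sub_abs_le_abs_sub (2 * π * (k : ℝ)) (x - y)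
      rw [abs_sub_comm (2 * π * (k : ℝ))] at h3
      nlinarith

theorem abs_inv_rpow_sub_inv_rpow_le {s b M N : ℝ} (hs : 0 ≤ s) (hb : 0 < b)
    (hM : b ≤ M) (hN : b ≤ N) :
    |(N ^ s)⁻¹ - (M ^ s)⁻¹| ≤ s * b ^ (-s - 1) * |N - M| := by
  rw [← Real.rpow_neg (hb.le.trans hM), ← Real.rpow_neg (hb.le.trans hN)]
  refine Convex.norm_image_sub_le_of_norm_hasDerivWithin_le (s := Ici b)
    (f := fun t : ℝ => t ^ (-s)) (f' := fun t => -s * t ^ (-s - 1)) ?_ ?_ (convex_Ici b) hM hN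
  · intro t ht
    exact (Real.hasDerivAt_rpow_const (Or.inl (hb.trans_le ht).ne')).hasDerivWithinAt
  · intro t ht
    have ht0 : 0 < t := hb.trans_le ht
    rw [norm_mul, norm_neg, Real.norm_of_nonneg hs,
      Real.norm_of_nonneg (Real.rpow_nonneg ht0.le _)]
    exact mul_le_mul_of_nonneg_left
      (Real.rpow_le_rpow_of_nonpos hb ht (by linarith)) hs

theorem norm_deriv_smul_tangent1 {γ : ℝ → R2} {x : ℝ} (h : 0 < ‖deriv γ x‖) :
    ‖deriv γ x‖ • tangent1 γ x = deriv γ x := by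
  rw [tangent1, smul_smul, mul_inv_cancel₀ h.ne', one_smul]

theorem norm_tangent1 {γ : ℝ → R2} {x : ℝ} (h : 0 < ‖deriv γ x‖) : ‖tangent1 γ x‖ = 1 := by
  rw [tangent1, norm_smul, norm_inv, norm_norm, inv_mul_cancel₀ h.ne']

section Kernel

variable {β c A : ℝ} {γ : ℝ → R2}

theorem norm_deriv_sub_deriv_le (hc : 0 < c)
    (hgc : ∀ x : ℝ, c ≤ ‖deriv γ x‖) (hgA : ∀ x : ℝ, ‖deriv γ x‖ ≤ A)
    (hT : ∀ x y : ℝ, ‖tangent1 γ x - tangent1 γ y‖ ≤ A * |x - y| ^ β)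
    (hg : ∀ x y : ℝ, |‖deriv γ x‖ - ‖deriv γ y‖| ≤ A * |x - y| ^ β) (t p : ℝ) :
    ‖deriv γ t - deriv γ p‖ ≤ A * (1 + A) * |t - p| ^ β := by
  have hpos : ∀ x, 0 < ‖deriv γ x‖ := fun x => hc.trans_le (hgc x)
  have h1 : deriv γ t - deriv γ p = (‖deriv γ t‖ - ‖deriv γ p‖) • tangent1 γ t +
      ‖deriv γ p‖ • (tangent1 γ t - tangent1 γ p) := by
    rw [sub_smul, smul_sub, norm_deriv_smul_tangent1 (hpos t),
      norm_deriv_smul_tangent1 (hpos p)]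
    abel
  rw [h1]
  refine (norm_add_le _ _).trans ?_
  rw [norm_smul, norm_smul, norm_tangent1 (hpos t), Real.norm_eq_abs, norm_norm, mul_one]
  have h2 : ‖deriv γ p‖ * ‖tangent1 γ t - tangent1 γ p‖ ≤ A * (A * |t - p| ^ β) :=
    mul_le_mul (hgA p) (hT t p) (norm_nonneg _) ((norm_nonneg _).trans (hgA p))
  linarith [hg t p]

theorem norm_sub_sub_smul_deriv_le (hβ : 0 ≤ β) (hc : 0 < c) (hγ : ContDiff ℝ 1 γ)
    (hgc : ∀ x : ℝ, c ≤ ‖deriv γ x‖) (hgA : ∀ x : ℝ, ‖deriv γ x‖ ≤ A)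
    (hT : ∀ x y : ℝ, ‖tangent1 γ x - tangent1 γ y‖ ≤ A * |x - y| ^ β)
    (hg : ∀ x y : ℝ, |‖deriv γ x‖ - ‖deriv γ y‖| ≤ A * |x - y| ^ β)
    {x y p : ℝ} (hp : p ∈ uIcc y x) :
    ‖γ x - γ y - (x - y) • deriv γ p‖ ≤ A * (1 + A) * |x - y| ^ β * |x - y| := by
  have hA : 0 ≤ A := (norm_nonneg _).trans (hgA 0)
  have key := Convex.norm_image_sub_le_of_norm_hasDerivWithin_le (s := uIcc y x)
    (f := fun t : ℝ => γ t - t • deriv γ p) (f' := fun t => deriv γ t - deriv γ p)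
    (C := A * (1 + A) * |x - y| ^ β) (x := y) (y := x) ?_ ?_ (convex_uIcc y x)
    left_mem_uIcc right_mem_uIcc
  · rw [Real.norm_eq_abs] at key
    have e1 : γ x - γ y - (x - y) • deriv γ p =
        γ x - x • deriv γ p - (γ y - y • deriv γ p) := by
      rw [sub_smul]
      abel
    rw [e1]
    exact key
  · intro t _
    have h1 : HasDerivAt γ (deriv γ t) t :=
      ((hγ.differentiable (by norm_num)) t).hasDerivAt
    have h2 := h1.sub ((hasDerivAt_id t).smul_const (deriv γ p))
    rw [one_smul] at h2
    exact h2.hasDerivWithinAt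
  · intro t ht
    refine (norm_deriv_sub_deriv_le hc hgc hgA hT hg t p).trans ?_
    have : |t - p| ≤ |x - y| := abs_sub_le_of_uIcc_subset_uIcc (uIcc_subset_uIcc hp ht)
    gcongr

/-- Near the diagonal `kerK` is an odd singular kernel, up to an integrable error. The point `p`
at which the coefficient is frozen may be either endpoint. -/
theorem abs_kerK_sub_odd_le {α : ℝ} (hα : 0 ≤ α) (hβ : 0 ≤ β) (hc : 0 < c)
    (hγ : ContDiff ℝ 1 γ)
    (hgc : ∀ x : ℝ, c ≤ ‖deriv γ x‖) (hgA : ∀ x : ℝ, ‖deriv γ x‖ ≤ A)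
    (hT : ∀ x y : ℝ, ‖tangent1 γ x - tangent1 γ y‖ ≤ A * |x - y| ^ β)
    (hg : ∀ x y : ℝ, |‖deriv γ x‖ - ‖deriv γ y‖| ≤ A * |x - y| ^ β)
    (hch : ∀ x y : ℝ, c * perDist x y ≤ ‖γ x - γ y‖)
    {x y p : ℝ} (hp : p ∈ uIcc y x) (hxy : x ≠ y) (hπ : |x - y| ≤ π) :
    |kerK α γ y x - ‖deriv γ p‖ ^ 2 / ‖deriv γ p‖ ^ (2 + 2 * α) *
        ((x - y) / |x - y| ^ (2 + 2 * α))| ≤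
      ((A * (A * (1 + A) + A ^ 2) + A ^ 2) / c ^ (2 + 2 * α) +
        A ^ 2 * ((2 + 2 * α) * c ^ (-(2 + 2 * α) - 1) * (A * (1 + A)))) *
        |x - y| ^ (1 + β - (2 + 2 * α)) := by
  have hpos : ∀ x, 0 < ‖deriv γ x‖ := fun x => hc.trans_le (hgc x)
  have hA : 0 < A := (hpos 0).trans_le (hgA 0)
  have hu : 0 < |x - y| := abs_pos.2 (sub_ne_zero.2 hxy)
  have hv := norm_sub_sub_smul_deriv_le hβ hc hγ hgc hgA hT hg hp
  have hxp : |x - p| ≤ |x - y| :=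
    abs_sub_le_of_uIcc_subset_uIcc (uIcc_subset_uIcc hp right_mem_uIcc)
  have hyp : |y - p| ≤ |x - y| :=
    abs_sub_le_of_uIcc_subset_uIcc (uIcc_subset_uIcc hp left_mem_uIcc)
  have hN := hch x y
  rw [perDist_eq_abs hπ] at hN
  have hGp := hgc p
  have hGA := hgA p
  have hgy := hgA y
  have hgyp : |‖deriv γ y‖ - ‖deriv γ p‖| ≤ A * |x - y| ^ β := (hg y p).trans (by gcongr)
  have hTxp : ‖tangent1 γ x - tangent1 γ p‖ ≤ A * |x - y| ^ β := (hT x p).trans (by gcongr)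
  have hG0 := hpos p
  have hgT := norm_deriv_smul_tangent1 hG0
  have hTT : ⟪tangent1 γ x, tangent1 γ x⟫ = 1 := by
    rw [real_inner_self_eq_norm_sq, norm_tangent1 (hpos x), one_pow]
  have hTx := norm_tangent1 (hpos x)
  unfold kerK
  set s := 2 + 2 * α with hs
  have hs0 : 0 ≤ s := by positivity
  set u := |x - y| with hu_def
  set h := x - y with hh
  set v := γ x - γ y with hvd
  set G := ‖deriv γ p‖
  set w := u ^ β with hw
  have hw0 : 0 ≤ w := by positivity
  -- the tangential increment
  have hin : |⟪v, tangent1 γ x⟫ - h * G| ≤ (A * (1 + A) + A ^ 2) * w * u := by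
    have e1 : ⟪v, tangent1 γ x⟫ - h * G = ⟪v - h • deriv γ p, tangent1 γ x⟫ -
        h * G * ⟪tangent1 γ x - tangent1 γ p, tangent1 γ x⟫ := by
      rw [← hgT, inner_sub_left v, inner_sub_left (tangent1 γ x), inner_smul_left, inner_smul_left, hTT]
      simp
      ring
    have e2 : |⟪v - h • deriv γ p, tangent1 γ x⟫| ≤ A * (1 + A) * w * u := by
      refine (abs_real_inner_le_norm _ _).trans ?_
      rw [hTx, mul_one]
      exact hv
    have e3 : |⟪tangent1 γ x - tangent1 γ p, tangent1 γ x⟫| ≤ A * w := by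
      refine (abs_real_inner_le_norm _ _).trans ?_
      rw [hTx, mul_one]
      exact hTxp
    rw [e1]
    refine (abs_sub _ _).trans ?_
    rw [abs_mul, abs_mul, abs_of_pos hG0, ← hu_def]
    have e4 : u * G * |⟪tangent1 γ x - tangent1 γ p, tangent1 γ x⟫| ≤ u * A * (A * w) := by
      gcongr
    linarith
  have hnum : |‖deriv γ y‖ * ⟪v, tangent1 γ x⟫ - h * G ^ 2| ≤
      (A * (A * (1 + A) + A ^ 2) + A ^ 2) * (w * u) := by
    have e1 : ‖deriv γ y‖ * ⟪v, tangent1 γ x⟫ - h * G ^ 2 =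
        ‖deriv γ y‖ * (⟪v, tangent1 γ x⟫ - h * G) + (‖deriv γ y‖ - G) * (h * G) := by ring
    rw [e1]
    refine (abs_add_le _ _).trans ?_
    rw [abs_mul, abs_mul, abs_mul, abs_norm, abs_of_pos hG0, ← hu_def]
    have e2 : ‖deriv γ y‖ * |⟪v, tangent1 γ x⟫ - h * G| ≤
      A * ((A * (1 + A) + A ^ 2) * w * u) := by gcongr
    have e3 : |‖deriv γ y‖ - G| * (u * G) ≤ (A * w) * (u * A) := by gcongr
    linarith
  -- the chord length
  have hNM : |‖v‖ - u * G| ≤ A * (1 + A) * w * u := by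
    have e1 := abs_norm_sub_norm_le v (h • deriv γ p)
    rw [norm_smul, Real.norm_eq_abs, ← hu_def] at e1
    exact e1.trans hv
  have hcu : 0 < c * u := by positivity
  have hinv := abs_inv_rpow_sub_inv_rpow_le hs0 hcu
    (show c * u ≤ u * G by rw [mul_comm]; gcongr) hN
  have hN0 : 0 < ‖v‖ := hcu.trans_le hN
  have hsplit : ‖deriv γ y‖ * (⟪v, tangent1 γ x⟫ / ‖v‖ ^ s) - G ^ 2 / G ^ s * (h / u ^ s) =
      (‖deriv γ y‖ * ⟪v, tangent1 γ x⟫ - h * G ^ 2) * (‖v‖ ^ s)⁻¹ +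
        h * G ^ 2 * ((‖v‖ ^ s)⁻¹ - ((u * G) ^ s)⁻¹) := by
    rw [Real.mul_rpow hu.le hG0.le, mul_inv]
    ring
  have hp1 : u ^ (1 + β - s) = w * u * (u ^ s)⁻¹ := by
    rw [Real.rpow_sub hu, Real.rpow_add hu, Real.rpow_one, hw]
    ring
  have hp2 : u * (u ^ (-s - 1) * (w * u)) = u ^ (1 + β - s) := by
    rw [hp1, Real.rpow_sub hu, Real.rpow_one, Real.rpow_neg hu.le]
    field_simp
  rw [hsplit]
  refine (abs_add_le _ _).trans ?_
  have t1 : |(‖deriv γ y‖ * ⟪v, tangent1 γ x⟫ - h * G ^ 2) * (‖v‖ ^ s)⁻¹| ≤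
      (A * (A * (1 + A) + A ^ 2) + A ^ 2) / c ^ s * u ^ (1 + β - s) := by
    have e1 : (‖v‖ ^ s)⁻¹ ≤ (c ^ s)⁻¹ * (u ^ s)⁻¹ := by
      rw [← mul_inv, ← Real.mul_rpow hc.le hu.le]
      gcongr
    rw [abs_mul, abs_of_nonneg (show 0 ≤ (‖v‖ ^ s)⁻¹ by positivity), hp1]
    calc _ ≤ (A * (A * (1 + A) + A ^ 2) + A ^ 2) * (w * u) * ((c ^ s)⁻¹ * (u ^ s)⁻¹) := by
          gcongr
      _ = _ := by ring
  have t2 : |h * G ^ 2 * ((‖v‖ ^ s)⁻¹ - ((u * G) ^ s)⁻¹)| ≤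
      A ^ 2 * (s * c ^ (-s - 1) * (A * (1 + A))) * u ^ (1 + β - s) := by
    rw [abs_mul, abs_mul, abs_of_pos (show 0 < G ^ 2 by positivity), ← hu_def, ← hp2]
    calc _ ≤ u * A ^ 2 * (s * (c * u) ^ (-s - 1) * (A * (1 + A) * w * u)) := by
          refine mul_le_mul (by gcongr) (hinv.trans ?_) (abs_nonneg _) (by positivity)
          gcongr
      _ = _ := by
          rw [Real.mul_rpow hc.le hu.le]
          ring
  linarith

end Kernel

theorem abs_mul_sub_const_mul_le {a₀ a₁ k m φ Ca E M u w : ℝ} (h₁ : |a₁| ≤ Ca)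
    (h₀ : |a₁ - a₀| ≤ Ca * w) (hk : |k - m * φ| ≤ E * u) (hm : |m| ≤ M) (hφ : w * |φ| = u)
    (hw : 0 ≤ w) :
    |a₁ * k - a₀ * m * φ| ≤ (E + M) * Ca * u := by
  have hCa : 0 ≤ Ca := (abs_nonneg _).trans h₁
  have e1 : a₁ * k - a₀ * m * φ = a₁ * (k - m * φ) + (a₁ - a₀) * (m * φ) := by ring
  rw [e1]
  refine (abs_add_le _ _).trans ?_
  rw [abs_mul, abs_mul, abs_mul m]
  have e2 : |a₁| * |k - m * φ| ≤ Ca * (E * u) := by gcongr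
  have e3 : |a₁ - a₀| * (|m| * |φ|) ≤ Ca * w * (M * |φ|) := by gcongr
  have e4 : Ca * w * (M * |φ|) = Ca * M * u := by rw [← hφ]; ring
  linarith

theorem continuous_of_abs_sub_le_rpow {a : ℝ → ℝ} {Ca β : ℝ} (hβ : 0 < β)
    (ha : ∀ x y : ℝ, |a x - a y| ≤ Ca * |x - y| ^ β) : Continuous a := by
  rw [continuous_iff_continuousAt]
  intro y
  rw [ContinuousAt, tendsto_iff_dist_tendsto_zero]
  have hlim : Tendsto (fun x : ℝ => Ca * |x - y| ^ β) (𝓝 y) (𝓝 0) := by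
    have : Continuous fun x : ℝ => Ca * |x - y| ^ β :=
      continuous_const.mul ((by fun_prop : Continuous fun x : ℝ => |x - y|).rpow_const
        fun _ => Or.inr hβ.le)
    simpa [Real.zero_rpow hβ.ne'] using this.tendsto y
  exact squeeze_zero (fun _ => dist_nonneg) (fun x => ha x y) hlim

/-- **Lemma 5.1, estimate (5.6) (principal-value bounds against Hölder functions)**:
for `0 < α < 1/2` and `β > 2α`, and any `2π`-periodic `C¹` chord-arc curve `γ` with
`β`-Hölder tangent and arc-length metric (constants `c`, `A`), there is `C` such that
for every `2π`-periodic `β`-Hölder function `a` (with `C^β` bound `Ca`), the principal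
values `p.v. ∫ a(y) K(y,x) dy` and `p.v. ∫ a(x) K(y,x) dx` exist and are bounded by
`C·Ca`. -/
theorem kernel_pv_bound (α β c A : ℝ) (hα0 : 0 < α) (hα : α < 1/2)
    (hβ : 2 * α < β) (hc : 0 < c) :
    ∃ C : ℝ, ∀ γ : ℝ → R2,
      Periodic γ (2 * π) → ContDiff ℝ 1 γ → InjOn γ (Ico 0 (2 * π)) →
      (∀ x : ℝ, c ≤ ‖deriv γ x‖) → (∀ x : ℝ, ‖deriv γ x‖ ≤ A) →
      (∀ x y : ℝ, ‖tangent1 γ x - tangent1 γ y‖ ≤ A * |x - y| ^ β) →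
      (∀ x y : ℝ, |‖deriv γ x‖ - ‖deriv γ y‖| ≤ A * |x - y| ^ β) →
      (∀ x y : ℝ, c * perDist x y ≤ ‖γ x - γ y‖) →
      ∀ (a : ℝ → ℝ) (Ca : ℝ), Periodic a (2 * π) →
        (∀ x : ℝ, |a x| ≤ Ca) → (∀ x y : ℝ, |a x - a y| ≤ Ca * |x - y| ^ β) →
        (∀ x : ℝ, ∃ I : ℝ,
          Tendsto (fun ε : ℝ =>
              ∫ y in {y : ℝ | y ∈ Icc (x - π) (x + π) ∧ ε ≤ |y - x|}, a y * kerK α γ y x)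
            (𝓝[>] (0:ℝ)) (𝓝 I) ∧ |I| ≤ C * Ca) ∧
        (∀ y : ℝ, ∃ I : ℝ,
          Tendsto (fun ε : ℝ =>
              ∫ x in {x : ℝ | x ∈ Icc (y - π) (y + π) ∧ ε ≤ |x - y|}, a x * kerK α γ y x)
            (𝓝[>] (0:ℝ)) (𝓝 I) ∧ |I| ≤ C * Ca) := by
  set s : ℝ := 2 + 2 * α with hs
  have hs0 : 0 ≤ s := by positivity
  have hβ0 : 0 < β := by linarith
  have he : -1 < 1 + β - s := by linarith
  set E : ℝ := (A * (A * (1 + A) + A ^ 2) + A ^ 2) / c ^ s +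
    A ^ 2 * (s * c ^ (-s - 1) * (A * (1 + A))) with hE
  refine ⟨(E + A ^ 2 / c ^ s) * ∫ y in Icc (-π) π, |y| ^ (1 + β - s), ?_⟩
  intro γ _ hγ _ hgc hgA hT hg hch a Ca _ haC haH
  have ham := (continuous_of_abs_sub_le_rpow hβ0 haH).measurable
  have hγm := hγ.continuous.measurable
  have hdm : Measurable (deriv γ) := (hγ.continuous_deriv le_rfl).measurable
  have hTm : Measurable (tangent1 γ) := hdm.norm.inv.smul hdm
  have hM : ∀ p, |‖deriv γ p‖ ^ 2 / ‖deriv γ p‖ ^ s| ≤ A ^ 2 / c ^ s := by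
    intro p
    have h0 := hc.trans_le (hgc p)
    rw [abs_of_nonneg (by positivity)]
    have h1 := hgc p
    have h2 := hgA p
    gcongr
  have hφ : ∀ x y : ℝ, x ≠ y →
      |x - y| ^ β * |(x - y) / |x - y| ^ s| = |x - y| ^ (1 + β - s) := by
    intro x y hxy
    have hu : 0 < |x - y| := abs_pos.2 (sub_ne_zero.2 hxy)
    rw [abs_div, abs_of_nonneg (Real.rpow_nonneg hu.le s), Real.rpow_sub hu (1 + β) s,
      Real.rpow_add hu 1 β, Real.rpow_one]
    ring
  have main : ∀ p q x y : ℝ, p ∈ uIcc y x → x ≠ y → |x - y| ≤ π → |q - p| = |x - y| →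
      |a q * kerK α γ y x - a p * (‖deriv γ p‖ ^ 2 / ‖deriv γ p‖ ^ s) *
        ((x - y) / |x - y| ^ s)| ≤ (E + A ^ 2 / c ^ s) * Ca * |x - y| ^ (1 + β - s) := by
    intro p q x y hp hxy hπ hq
    exact abs_mul_sub_const_mul_le (haC q) (hq ▸ haH q p)
      (abs_kerK_sub_odd_le hα0.le hβ0.le hc hγ hgc hgA hT hg hch hp hxy hπ) (hM p)
      (hφ x y hxy) (by positivity)
  constructor
  · intro x
    obtain ⟨I, hI, hIb⟩ := exists_principal_value (p := x) (D := (E + A ^ 2 / c ^ s) * Ca)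
      (m := -(a x * (‖deriv γ x‖ ^ 2 / ‖deriv γ x‖ ^ s))) he hs0
      (fun y => a y * kerK α γ y x) (by unfold kerK; fun_prop) (by
        intro y hy hyπ
        have hxy := abs_sub_comm x y
        have := main x y x y right_mem_uIcc hy.symm (hxy ▸ hyπ) hxy.symm
        rw [hxy] at this
        convert this using 2
        ring)
    exact ⟨I, hI, hIb.trans_eq (by ring)⟩
  · intro y
    obtain ⟨I, hI, hIb⟩ := exists_principal_value (p := y) (D := (E + A ^ 2 / c ^ s) * Ca)
      (m := a y * (‖deriv γ y‖ ^ 2 / ‖deriv γ y‖ ^ s)) he hs0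
      (fun x => a x * kerK α γ y x) (by unfold kerK; fun_prop) (fun x hx hxπ =>
        main y x x y left_mem_uIcc hx hxπ rfl)
    exact ⟨I, hI, hIb.trans_eq (by ring)⟩
end
end

section
/- Let γ : ℝ → ℝ² be an L-periodic unit-speed curve (γ continuously differentiable, ‖γ'(s)‖ = 1 for all s, γ(s+L) = γ(s)) which is injective on [0,L), with unit tangent T := γ', and suppose ‖T(s)−T(s')‖ ≤ A·|s−s'|^β for all s, s' and some A > 0, 0<β≤1. Then there exists a constant C > 0 such that for all s, s' with 0 < |s−s'| ≤ L/2, γ(s) ≠ γ(s') and | |s−s'| / ‖γ(s)−γ(s')‖ − 1 | ≤ C·|s−s'|^{2β}. -/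
open MeasureTheory Real Set Function Filter Bornology
open scoped RealInnerProductSpace Topology

noncomputable section

section ChordArc

variable {E : Type*} [NormedAddCommGroup E]

/-- A periodic function that is injective on one period takes distinct values at points whose
distance is less than a period. -/
theorem Function.Periodic.apply_add_ne {α : Type*} {f : ℝ → α} {L : ℝ} (hL : 0 < L)
    (hf : Periodic f L) (hinj : InjOn f (Ico 0 L)) (s : ℝ) {u : ℝ} (hu : 0 < u) (huL : u < L) :
    f (s + u) ≠ f s := by
  have hP : Periodic (fun s => f (s + u) ≠ f s) L := fun s => by
    simp only [add_right_comm s L u, hf _]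
  obtain ⟨t, ht, hst⟩ := hP.exists_mem_Ico₀ hL s
  refine hst.mpr fun h => ?_
  rcases lt_or_ge (t + u) L with hlt | hge
  · have := hinj ⟨by linarith [ht.1], hlt⟩ ht h
    linarith
  · rw [← hf.sub_eq] at h
    have := hinj ⟨by linarith, by linarith [ht.2]⟩ ht h
    linarith

/-- Chords of a continuous periodic simple closed curve whose parameters are at distance between
`δ > 0` and half a period are bounded below uniformly. -/
theorem exists_pos_le_norm_chord {γ : ℝ → E} {L δ : ℝ} (hL : 0 < L) (hδ : 0 < δ)
    (hγ : Continuous γ) (hper : Periodic γ L) (hinj : InjOn γ (Ico 0 L)) :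
    ∃ m > 0, ∀ s, ∀ u ∈ Icc δ (L / 2), m ≤ ‖γ (s + u) - γ s‖ := by
  obtain ⟨m, hm, hle⟩ :=
    (isCompact_Icc.prod isCompact_Icc : IsCompact (Icc 0 L ×ˢ Icc δ (L / 2))).exists_forall_le'
      (f := fun p : ℝ × ℝ => ‖γ (p.1 + p.2) - γ p.1‖) (a := 0) (by fun_prop)
      (fun p hp => norm_pos_iff.mpr <| sub_ne_zero.mpr <|
        hper.apply_add_ne hL hinj _ (hδ.trans_le hp.2.1) (by linarith [hp.2.2]))
  refine ⟨m, hm, fun s u hu => ?_⟩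
  have hP : Periodic (fun s => ‖γ (s + u) - γ s‖) L := fun s => by
    simp only [add_right_comm s L u, hper _]
  obtain ⟨t, ht, hst⟩ := hP.exists_mem_Ico₀ hL s
  exact (hle (t, u) ⟨Ico_subset_Icc_self ht, hu⟩).trans_eq hst.symm

/-- A chord of a unit-speed curve is no longer than the corresponding arc. -/
theorem norm_chord_le [NormedSpace ℝ E] {γ : ℝ → E} (hγ : Differentiable ℝ γ)
    (hunit : ∀ s, ‖deriv γ s‖ = 1) (s : ℝ) {u : ℝ} (hu : 0 ≤ u) : ‖γ (s + u) - γ s‖ ≤ u := by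
  have := convex_univ.norm_image_sub_le_of_norm_deriv_le (f := γ) (x := s) (y := s + u)
    (fun x _ => hγ x) (fun x _ => (hunit x).le) trivial trivial
  simpa [abs_of_nonneg hu] using this

/-- If the unit tangent is `β`-Hölder, the chord-arc defect is of order `u ^ (2 * β)`. -/
theorem le_norm_chord_of_holder [InnerProductSpace ℝ E] {γ : ℝ → E} {A β : ℝ} (hA : 0 ≤ A)
    (hβ : 0 ≤ β) (hγ : Differentiable ℝ γ) (hunit : ∀ s, ‖deriv γ s‖ = 1)
    (hHol : ∀ s s' : ℝ, ‖deriv γ s - deriv γ s'‖ ≤ A * |s - s'| ^ β)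
    (s : ℝ) {u : ℝ} (hu : 0 ≤ u) :
    (1 - A ^ 2 / 2 * u ^ (2 * β)) * u ≤ ‖γ (s + u) - γ s‖ := by
  set e := deriv γ s with he
  have hd : ∀ t, HasDerivAt (fun t => ⟪e, γ t⟫) ⟪e, deriv γ t⟫ t := fun t => by
    simpa using (hasDerivAt_const t e).inner ℝ (hγ t).hasDerivAt
  have hpow : u ^ (2 * β) = (u ^ β) ^ 2 := by
    rw [mul_comm, rpow_mul hu, rpow_two]
  have hlow : ∀ t ∈ Icc s (s + u), 1 - A ^ 2 / 2 * u ^ (2 * β) ≤ ⟪e, deriv γ t⟫ := by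
    intro t ht
    have h1 : ‖e - deriv γ t‖ ≤ A * u ^ β := by
      refine (hHol s t).trans ?_
      have : |s - t| ≤ u := by rw [abs_le]; constructor <;> linarith [ht.1, ht.2]
      gcongr
    have h2 := norm_sub_sq_real e (deriv γ t)
    rw [hunit t, he, hunit s, ← he] at h2
    have h3 := pow_le_pow_left₀ (norm_nonneg _) h1 2
    rw [hpow]
    linarith [mul_pow A (u ^ β) 2]
  have hmv := (convex_Icc s (s + u)).mul_sub_le_image_sub_of_le_deriv
    (f := fun t => ⟪e, γ t⟫) (fun t _ => (hd t).continuousAt.continuousWithinAt)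
    (fun t _ => (hd t).differentiableAt.differentiableWithinAt)
    (fun t ht => (hlow t (interior_subset ht)).trans_eq (hd t).deriv.symm)
    s ⟨le_rfl, by linarith⟩ (s + u) ⟨by linarith, le_rfl⟩ (by linarith)
  rw [add_sub_cancel_left, ← inner_sub_right] at hmv
  have hcs := real_inner_le_norm e (γ (s + u) - γ s)
  rw [he, hunit s, one_mul, ← he] at hcs
  exact hmv.trans hcs

/-- A simple closed unit-speed curve with Hölder tangent satisfies the chord-arc condition. -/
theorem exists_pos_mul_le_norm_chord [InnerProductSpace ℝ E] {γ : ℝ → E} {L A β : ℝ}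
    (hL : 0 < L) (hA : 0 < A) (hβ : 0 < β) (hγ : Differentiable ℝ γ)
    (hunit : ∀ s, ‖deriv γ s‖ = 1) (hper : Periodic γ L) (hinj : InjOn γ (Ico 0 L))
    (hHol : ∀ s s' : ℝ, ‖deriv γ s - deriv γ s'‖ ≤ A * |s - s'| ^ β) :
    ∃ k > 0, ∀ s, ∀ u ∈ Ioc 0 (L / 2), k * u ≤ ‖γ (s + u) - γ s‖ := by
  set δ : ℝ := ((A ^ 2)⁻¹) ^ (2 * β)⁻¹
  have hδ : 0 < δ := by positivity
  obtain ⟨m, hm, hle⟩ := exists_pos_le_norm_chord hL hδ hγ.continuous hper hinj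
  refine ⟨min (1 / 2) (m / (L / 2)), by positivity, fun s u hu => ?_⟩
  have hu0 : 0 < u := hu.1
  rcases le_total δ u with h | h
  · calc min (1 / 2) (m / (L / 2)) * u ≤ m / (L / 2) * (L / 2) := by
          gcongr
          exacts [min_le_right _ _, hu.2]
      _ = m := by field_simp
      _ ≤ _ := hle s u ⟨h, hu.2⟩
  · have h1 : A ^ 2 * u ^ (2 * β) ≤ 1 := by
      calc A ^ 2 * u ^ (2 * β) ≤ A ^ 2 * δ ^ (2 * β) := by gcongr
        _ = 1 := by
          rw [rpow_inv_rpow (by positivity) (by positivity)]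
          field_simp
    calc min (1 / 2) (m / (L / 2)) * u ≤ (1 - A ^ 2 / 2 * u ^ (2 * β)) * u := by
          gcongr
          exact (min_le_left _ _).trans (by linarith)
      _ ≤ _ := le_norm_chord_of_holder hA.le hβ.le hγ hunit hHol s hu0.le

end ChordArc

/-- **Lemma 2.1, estimate (2.2d) (chord-arc estimate)**: for an injective `L`-periodic
unit-speed curve `γ` with `β`-Hölder tangent (constant `A`), there is `C > 0` with
`γ(s) ≠ γ(s')` and `| |s-s'|/‖γ(s)-γ(s')‖ - 1 | ≤ C|s-s'|^{2β}` whenever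
`0 < |s-s'| ≤ L/2`. -/
theorem chord_arc_estimate (L A β : ℝ) (hL : 0 < L) (hA : 0 < A)
    (hβ0 : 0 < β) (hβ1 : β ≤ 1)
    (γ : ℝ → R2) (hC1 : ContDiff ℝ 1 γ) (hunit : ∀ s, ‖deriv γ s‖ = 1)
    (hper : Periodic γ L) (hinj : InjOn γ (Ico 0 L))
    (hHol : ∀ s s' : ℝ, ‖deriv γ s - deriv γ s'‖ ≤ A * |s - s'| ^ β) :
    ∃ C > (0:ℝ), ∀ s s' : ℝ, 0 < |s - s'| → |s - s'| ≤ L / 2 →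
      γ s ≠ γ s' ∧ |(|s - s'| / ‖γ s - γ s'‖) - 1| ≤ C * |s - s'| ^ (2 * β) := by
  have hγ : Differentiable ℝ γ := hC1.differentiable one_ne_zero
  obtain ⟨k, hk, hchord⟩ := exists_pos_mul_le_norm_chord hL hA hβ0 hγ hunit hper hinj hHol
  refine ⟨A ^ 2 / (2 * k), by positivity, fun s s' h0 h1 => ?_⟩
  wlog hss : s' ≤ s generalizing s s'
  · have := this s' s (by rwa [abs_sub_comm]) (by rwa [abs_sub_comm]) (le_of_not_ge hss)
    rwa [abs_sub_comm s, norm_sub_rev (γ s), ne_comm]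
  obtain ⟨u, rfl⟩ : ∃ u, s = s' + u := ⟨s - s', by ring⟩
  rw [add_sub_cancel_left] at h0 h1 ⊢
  rw [abs_of_nonneg (by linarith : 0 ≤ u)] at h0 h1 ⊢
  have hlow := hchord s' u ⟨h0, h1⟩
  have hc : 0 < ‖γ (s' + u) - γ s'‖ := (mul_pos hk h0).trans_le hlow
  refine ⟨sub_ne_zero.mp (norm_pos_iff.mp hc), ?_⟩
  have hup := norm_chord_le hγ hunit s' h0.le
  have hdefect := le_norm_chord_of_holder hA.le hβ0.le hγ hunit hHol s' h0.le
  rw [abs_of_nonneg (sub_nonneg.mpr ((one_le_div hc).mpr hup)), sub_le_iff_le_add, div_le_iff₀ hc]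
  calc u ≤ A ^ 2 / (2 * k) * u ^ (2 * β) * (k * u) + ‖γ (s' + u) - γ s'‖ := by
        have : A ^ 2 / (2 * k) * u ^ (2 * β) * (k * u) = A ^ 2 / 2 * u ^ (2 * β) * u := by
          field_simp
        linarith
    _ ≤ A ^ 2 / (2 * k) * u ^ (2 * β) * ‖γ (s' + u) - γ s'‖ + ‖γ (s' + u) - γ s'‖ := by gcongr
    _ = _ := by ring
end
end
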